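/- There are exactly two distinct extremal fullerene graphs with 60 vertices that contain the pentagonal fragment B_3 as a subgraph. -/

import Mathlib

namespace FG

/-- A combinatorial plane (spherically embedded) graph: a finite simple graph together with
its collection of faces, each face recorded as the finset of edges of its boundary cycle.
Every face boundary is a cycle, every edge lies on exactly two faces, and Euler's formula
holds (edges are counted via the face incidences). -/
structure PlaneGraph (V : Type) [Fintype V] [DecidableEq V] : Type where
  graph : SimpleGraph V
  faces : Finset (Finset (Sym2 V))
  face_edges : ∀ f ∈ faces, ∀ e ∈ f, e ∈ graph.edgeSet
  face_cycle : ∀ f ∈ faces, ∃ (v : V) (c : graph.Walk v v), c.IsCycle ∧ c.edges.toFinset = f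
  edge_faces : ∀ e ∈ graph.edgeSet, (faces.filter (fun f => e ∈ f)).card = 2
  euler : 2 * (Fintype.card V + faces.card) = (∑ f ∈ faces, f.card) + 4

variable {V : Type} [Fintype V] [DecidableEq V]

/-- The vertices incident with at least one edge of an edge set. -/
def edgeVerts (E : Finset (Sym2 V)) : Finset V :=
  Finset.univ.filter fun v => ∃ e ∈ E, v ∈ e

/-- The degree of a vertex in the subgraph spanned by an edge set. -/
def deg (E : Finset (Sym2 V)) (v : V) : ℕ := (E.filter fun e => v ∈ e).card

/-- The vertices covered by a collection of faces. -/
def facesVerts (H : Finset (Finset (Sym2 V))) : Finset V := edgeVerts (H.sup id)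

/-- An edge set is a matching: non-loop edges, pairwise vertex-disjoint. -/
def IsMatching (M : Finset (Sym2 V)) : Prop :=
  (∀ e ∈ M, ¬e.IsDiag) ∧ ∀ e ∈ M, ∀ e' ∈ M, e ≠ e' → ∀ v : V, v ∈ e → v ∉ e'

/-- A fullerene graph: a cubic 3-connected plane graph with (exactly 12) pentagonal
faces and hexagonal faces. -/
structure IsFullerene (P : PlaneGraph V) : Prop where
  cubic : ∀ v : V, (P.graph.neighborSet v).ncard = 3
  threeConnected : ∀ s : Set V, s.ncard ≤ 2 → (SimpleGraph.induce sᶜ P.graph).Connected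
  faceSize : ∀ f ∈ P.faces, f.card = 5 ∨ f.card = 6
  pentTwelve : (P.faces.filter fun f => f.card = 5).card = 12

/-- A fragment of a plane graph: a nonempty set of faces (a cycle together with its
interior) whose boundary — the set of edges lying on exactly one chosen face — is a
single cycle. -/
structure Fragment (P : PlaneGraph V) : Type where
  inFaces : Finset (Finset (Sym2 V))
  nonempty : inFaces.Nonempty
  subFaces : inFaces ⊆ P.faces
  boundary_cycle : ∃ (v : V) (c : P.graph.Walk v v), c.IsCycle ∧
    c.edges.toFinset =
      (inFaces.sup id).filter fun e => (inFaces.filter fun f => e ∈ f).card = 1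

/-- The edge set of a fragment. -/
def Fragment.edges {P : PlaneGraph V} (B : Fragment P) : Finset (Sym2 V) := B.inFaces.sup id

/-- The boundary edges of a fragment. -/
def Fragment.boundary {P : PlaneGraph V} (B : Fragment P) : Finset (Sym2 V) :=
  B.edges.filter fun e => (B.inFaces.filter fun f => e ∈ f).card = 1

/-- A pentagonal fragment: all inner faces are pentagons. -/
def IsPentagonalFragment {P : PlaneGraph V} (B : Fragment P) : Prop :=
  ∀ f ∈ B.inFaces, f.card = 5

/-- The faces of `P` adjoining the subgraph with edge set `E`: not a face of the
subgraph, but sharing at least one edge with it. -/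
def adjoiningFaces (P : PlaneGraph V) (E : Finset (Sym2 V)) : Finset (Finset (Sym2 V)) :=
  P.faces.filter fun f => ¬f ⊆ E ∧ (f ∩ E).Nonempty

/-- The territory `T[G]` of the subgraph with edge set `E`: the subgraph together with
all adjoining faces. -/
def territoryEdges (P : PlaneGraph V) (E : Finset (Sym2 V)) : Finset (Sym2 V) :=
  E ∪ (adjoiningFaces P E).sup id

/-- `w(G)`: the number of 2-degree vertices of the subgraph spanned by `E`. -/
def wcount (E : Finset (Sym2 V)) : ℕ := ((edgeVerts E).filter fun v => deg E v = 2).card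

/-- A subgraph is maximal in `P` when its hexagon extension is contained in `P`,
i.e. every adjoining face is a hexagon. -/
def IsMaximalIn (P : PlaneGraph V) (E : Finset (Sym2 V)) : Prop :=
  ∀ f ∈ adjoiningFaces P E, f.card = 6

/-- `H ∈ 𝒮(G)` for the subgraph `G` with edge set `E`: `H` is a set of mutually disjoint
hexagons of the hexagon extension `H[G]` (hexagonal faces sharing at least one edge with
`G`) such that `G − H` has a matching covering all remaining 3-degree vertices of `G`. -/
def SextetAdm (P : PlaneGraph V) (E : Finset (Sym2 V)) (H : Finset (Finset (Sym2 V))) : Prop :=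
  (∀ f ∈ H, f ∈ P.faces ∧ f.card = 6 ∧ (f ∩ E).Nonempty) ∧
  (∀ f ∈ H, ∀ g ∈ H, f ≠ g → Disjoint (edgeVerts f) (edgeVerts g)) ∧
  ∃ M : Finset (Sym2 V), M ⊆ E ∧ IsMatching M ∧
    (∀ e ∈ M, ∀ v : V, v ∈ e → v ∉ facesVerts H) ∧
    ∀ v ∈ edgeVerts E, deg E v = 3 → v ∉ facesVerts H → ∃ e ∈ M, v ∈ e

/-- `U_H(G) = V(G) ∖ V(H)`. -/
def Uset (E : Finset (Sym2 V)) (H : Finset (Finset (Sym2 V))) : Finset V :=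
  edgeVerts E \ facesVerts H

/-- A Clar set of `H[G]`: a member of `𝒮(G)` minimizing `|U_H(G)|`. -/
def IsClarSet (P : PlaneGraph V) (E : Finset (Sym2 V)) (H : Finset (Finset (Sym2 V))) : Prop :=
  SextetAdm P E H ∧ ∀ H', SextetAdm P E H' → (Uset E H).card ≤ (Uset E H').card

/-- A normal Clar set: a Clar set such that `G − H` has a perfect matching. -/
def IsNormalClarSet (P : PlaneGraph V) (E : Finset (Sym2 V))
    (H : Finset (Finset (Sym2 V))) : Prop :=
  IsClarSet P E H ∧ ∃ M : Finset (Sym2 V), M ⊆ E ∧ IsMatching M ∧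
    (∀ e ∈ M, ∀ v : V, v ∈ e → v ∉ facesVerts H) ∧
    ∀ v ∈ Uset E H, ∃ e ∈ M, v ∈ e

/-- The pentagonal faces of the subgraph with edge set `E`. -/
def pentFaces (P : PlaneGraph V) (E : Finset (Sym2 V)) : Finset (Finset (Sym2 V)) :=
  P.faces.filter fun f => f.card = 5 ∧ f ⊆ E

/-- A subgraph with `k` pentagons is extremal if `|U_H(G)| = k` for a Clar set `H`. -/
def IsExtremalSub (P : PlaneGraph V) (E : Finset (Sym2 V)) : Prop :=
  ∃ H, IsClarSet P E H ∧ (Uset E H).card = (pentFaces P E).card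

/-- A pentagonal ring `R_k`: `k` pentagonal faces `R 0, …, R (k-1)` such that
`R i` and `R j` intersect iff `|i − j| = 1 (mod k)`. -/
def IsPentRing (P : PlaneGraph V) (k : ℕ) (R : ZMod k → Finset (Sym2 V)) : Prop :=
  Function.Injective R ∧ (∀ i, R i ∈ P.faces ∧ (R i).card = 5) ∧
  ∀ i j : ZMod k, i ≠ j →
    ((edgeVerts (R i) ∩ edgeVerts (R j)).Nonempty ↔ (j = i + 1 ∨ i = j + 1))

/-- The number of pentagons of the pentagonal fragment `B` adjoining (sharing an edge
with) the pentagon `p`. -/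
def pentAdjCount {P : PlaneGraph V} (B : Fragment P) (p : Finset (Sym2 V)) : ℕ :=
  (B.inFaces.filter fun q => q ≠ p ∧ (q ∩ p).Nonempty).card

/-- The fragment consisting of a single pentagon `P`. -/
def IsPentagonFrag {P : PlaneGraph V} (B : Fragment P) : Prop :=
  IsPentagonalFragment B ∧ B.inFaces.card = 1

/-- `B_2`: the extremal pentagonal fragment with 4 pentagons whose Clar extension is
normal. -/
def IsB2Frag {P : PlaneGraph V} (B : Fragment P) : Prop :=
  IsPentagonalFragment B ∧ B.inFaces.card = 4 ∧ IsExtremalSub P B.edges ∧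
    ∃ H, IsNormalClarSet P B.edges H

/-- `B_3`: the extremal pentagonal fragment with 6 pentagons whose Clar extension is
normal. -/
def IsB3Frag {P : PlaneGraph V} (B : Fragment P) : Prop :=
  IsPentagonalFragment B ∧ B.inFaces.card = 6 ∧ IsExtremalSub P B.edges ∧
    ∃ H, IsNormalClarSet P B.edges H

/-- A pasting edge of the subgraph with edge set `E`: an edge of `E` lying on the
boundary of the Clar extension `C[G]` (not an edge of a Clar hexagon) whose two
end-vertices belong to `V(H)` for a Clar set `H`. -/
def IsPastingEdge (P : PlaneGraph V) (E : Finset (Sym2 V)) (e : Sym2 V) : Prop :=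
  e ∈ E ∧ ∃ H, IsClarSet P E H ∧ (∀ v : V, v ∈ e → v ∈ facesVerts H) ∧ e ∉ H.sup id

/-- `B` arises from pasting `A` and `C` along a common pasting edge:
`B = A ∪ C` and `A ∩ C` is a single pasting edge of both. -/
def IsPasting {P : PlaneGraph V} (B A C : Fragment P) : Prop :=
  B.inFaces = A.inFaces ∪ C.inFaces ∧
  ∃ e : Sym2 V, A.edges ∩ C.edges = {e} ∧ IsPastingEdge P A.edges e ∧ IsPastingEdge P C.edges e

def IsBasicFrag {P : PlaneGraph V} (B : Fragment P) : Prop :=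
  IsPentagonFrag B ∨ IsB2Frag B ∨ IsB3Frag B

/-- The pentagonal fragments generated from `P`, `B_2`, `B_3` by the pasting operation. -/
inductive Pasted (P : PlaneGraph V) : Fragment P → Prop
  | base (B : Fragment P) : IsBasicFrag B → Pasted P B
  | paste (B A C : Fragment P) : Pasted P A → IsBasicFrag C → IsPasting B A C → Pasted P B

/-- `P ∗ P`. -/
def IsPPFrag {P : PlaneGraph V} (B : Fragment P) : Prop :=
  ∃ A C : Fragment P, IsPentagonFrag A ∧ IsPentagonFrag C ∧ IsPasting B A C

/-- `P ∗ B_2`. -/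
def IsPB2Frag {P : PlaneGraph V} (B : Fragment P) : Prop :=
  ∃ A C : Fragment P, IsPentagonFrag A ∧ IsB2Frag C ∧ IsPasting B A C

/-- `P ∗ B_2 ∗ P`. -/
def IsPB2PFrag {P : PlaneGraph V} (B : Fragment P) : Prop :=
  ∃ B' A C D : Fragment P, IsPentagonFrag A ∧ IsB2Frag C ∧ IsPentagonFrag D ∧
    IsPasting B' A C ∧ IsPasting B B' D

/-- The six members of `𝓑_{≥60}`. -/
def SixShapes {P : PlaneGraph V} (B : Fragment P) : Prop :=
  IsPentagonFrag B ∨ IsB2Frag B ∨ IsB3Frag B ∨ IsPPFrag B ∨ IsPB2Frag B ∨ IsPB2PFrag B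

/-- `B_1`: two vertex-disjoint pentagons joined by an edge. -/
def IsB1 (P : PlaneGraph V) (E : Finset (Sym2 V)) : Prop :=
  ∃ (f g : Finset (Sym2 V)) (a b : V), f ∈ P.faces ∧ g ∈ P.faces ∧ f.card = 5 ∧ g.card = 5 ∧
    Disjoint (edgeVerts f) (edgeVerts g) ∧ P.graph.Adj a b ∧
    a ∈ edgeVerts f ∧ b ∈ edgeVerts g ∧ E = f ∪ g ∪ {s(a, b)}

/-- `B_1^k`: `k` copies of `B_1` pasted together along pasting edges of their pentagons. -/
inductive B1Pow (P : PlaneGraph V) : ℕ → Finset (Sym2 V) → Prop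
  | one (E : Finset (Sym2 V)) : IsB1 P E → B1Pow P 1 E
  | succ (k : ℕ) (E X : Finset (Sym2 V)) (e : Sym2 V) (f g : Finset (Sym2 V)) :
      B1Pow P k E → IsB1 P X → E ∩ X = {e} → f ∈ P.faces → g ∈ P.faces →
      f.card = 5 → g.card = 5 → f ⊆ E → g ⊆ X → e ∈ f → e ∈ g →
      IsPastingEdge P f e → IsPastingEdge P g e → B1Pow P (k + 1) (E ∪ X)

/-- `F` contains `B_1^k` for some `2 ≤ k ≤ 4` as a subgraph. -/
def ContainsB1Pow (P : PlaneGraph V) : Prop :=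
  ∃ (k : ℕ) (E : Finset (Sym2 V)), 2 ≤ k ∧ k ≤ 4 ∧ B1Pow P k E

/-- A perfect matching of the plane graph `P`. -/
def IsPerfectMatching (P : PlaneGraph V) (M : Finset (Sym2 V)) : Prop :=
  (∀ e ∈ M, e ∈ P.graph.edgeSet) ∧ IsMatching M ∧ ∀ v : V, ∃ e ∈ M, v ∈ e

/-- A sextet pattern of `P`: mutually disjoint hexagonal faces, all alternating with
respect to a common perfect matching. -/
def IsSextetPattern (P : PlaneGraph V) (H : Finset (Finset (Sym2 V))) : Prop :=
  (∀ f ∈ H, f ∈ P.faces ∧ f.card = 6) ∧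
  (∀ f ∈ H, ∀ g ∈ H, f ≠ g → Disjoint (edgeVerts f) (edgeVerts g)) ∧
  ∃ M : Finset (Sym2 V), IsPerfectMatching P M ∧ ∀ f ∈ H, (f ∩ M).card = 3

/-- A Clar formula: a maximum sextet pattern. -/
def IsClarFormula (P : PlaneGraph V) (H : Finset (Finset (Sym2 V))) : Prop :=
  IsSextetPattern P H ∧ ∀ H', IsSextetPattern P H' → H'.card ≤ H.card

/-- An extremal fullerene graph: the Clar number equals `(n − 12)/6`. -/
def IsExtremalFullerene (P : PlaneGraph V) : Prop :=
  ∃ H, IsClarFormula P H ∧ 6 * H.card = Fintype.card V - 12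

/-- The edges of the union of all maximal pentagonal fragments of `P`. -/
noncomputable def maxPentEdges (P : PlaneGraph V) : Finset (Sym2 V) :=
  @Finset.filter _
    (fun e => ∃ B : Fragment P, IsPentagonalFragment B ∧ IsMaximalIn P B.edges ∧ e ∈ B.edges)
    (Classical.decPred _) (P.faces.sup id)

/-- The disjoint union of two copies of `K_2`. -/
def twoK2 : SimpleGraph (Fin 4) := SimpleGraph.fromEdgeSet {s(0, 1), s(2, 3)}

/-- The tree `T_0` on six vertices: two adjacent 3-degree vertices, each also adjacent
to two leaves. -/
def treeT0 : SimpleGraph (Fin 6) :=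
  SimpleGraph.fromEdgeSet {s(0, 1), s(0, 2), s(0, 3), s(1, 4), s(1, 5)}

section PartE4
/-! ### The growth engine -/

def PATS : List (List Bool) :=
  [[true,true,true,true,true,true],[true,false,true,false,true,false],
   [false,true,false,true,false,true],
   [true,false,true,false,false],[false,true,false,true,false],[false,false,true,false,true],
   [true,false,false,true,false],[false,true,false,false,true]]

/-- A partially grown fullerene: number of labels, packed neighbour table, faces -/
structure St where
  N : ℕ
  nb : ℕ
  fs : List (ℕ × List ℕ)

def byt (nb j : ℕ) : ℕ := Nat.land (Nat.shiftRight nb (Nat.mul 8 j)) 255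

def code (x : ℕ) (b : Bool) : ℕ := bif b then Nat.add (Nat.mul 2 x) 3 else Nat.add (Nat.mul 2 x) 2

def alf (e : ℕ) : Bool := Nat.beq (Nat.mod e 2) 1

/-- table entry of neighbour `x` of `u` (zero if absent) -/
def ent (nb u x : ℕ) : ℕ :=
  bif Nat.beq (Nat.div (byt nb (Nat.mul 3 u)) 2) (Nat.succ x) then byt nb (Nat.mul 3 u) else
  bif Nat.beq (Nat.div (byt nb (Nat.add (Nat.mul 3 u) 1)) 2) (Nat.succ x) then
    byt nb (Nat.add (Nat.mul 3 u) 1) else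
  bif Nat.beq (Nat.div (byt nb (Nat.add (Nat.mul 3 u) 2)) 2) (Nat.succ x) then
    byt nb (Nat.add (Nat.mul 3 u) 2) else 0

def has (nb u x : ℕ) : Bool := !(Nat.beq (ent nb u x) 0)

def ins (nb j e : ℕ) : ℕ := Nat.lor nb (Nat.shiftLeft e (Nat.mul 8 j))

def find4 (z u v : ℕ) : List ℕ → Option ℕ
  | [] => none
  | a :: t =>
    match t with
    | b :: c :: d :: _ =>
      bif Nat.beq b u && Nat.beq a z && Nat.beq c v then some d
      else bif Nat.beq c u && Nat.beq b v && Nat.beq d z then some a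
      else find4 z u v t
    | _ => none

def adv (q z u v : ℕ) : List (ℕ × List ℕ) → Option ℕ
  | [] => none
  | (m, E) :: t =>
    bif Nat.beq (Nat.land m q) q then
      match find4 z u v E with
      | some w => some w
      | none => adv q z u v t
    else adv q z u v t

def bit (a : ℕ) : ℕ := Nat.shiftLeft 1 a

def q3 (z u v : ℕ) : ℕ := Nat.lor (bit z) (Nat.lor (bit u) (bit v))

def elem (a : ℕ) : List ℕ → Bool
  | [] => false
  | b :: t => Nat.beq a b || elem a t

/-- labels on a common face -/
def com (q a b : ℕ) : List (ℕ × List ℕ) → Bool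
  | [] => false
  | (m, E) :: t =>
    (Nat.beq (Nat.land m q) q && elem a (E.drop 3) && elem b (E.drop 3)) || com q a b t

def comd (S : St) (a b : ℕ) : Bool :=
  !(Nat.beq a b) && com (Nat.lor (bit a) (bit b)) a b S.fs

def two (nb u x y : ℕ) : Bool := has nb u x && has nb u y && !(Nat.beq x y)

def three (nb u x y z : ℕ) : Bool :=
  two nb u x y && has nb u z && !(Nat.beq y z) && !(Nat.beq x z)

/-- Follow the path; returns the last `z` and the last two vertices -/
def walk (nb : ℕ) (fs : List (ℕ × List ℕ)) (z u v : ℕ) (r : List ℕ) : Option (ℕ × ℕ × ℕ) :=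
  match r with
  | [] => match adv (q3 z u v) z u v fs with
    | none => none
    | some z' => some (z', u, v)
  | w :: r' => match adv (q3 z u v) z u v fs with
    | none => none
    | some z' => bif three nb v u z' w then walk nb fs z' v w r' else none

/-- known edge values along a path -/
def als (nb : ℕ) (u : ℕ) : List ℕ → List Bool
  | [] => []
  | v :: t => alf (ent nb u v) :: als nb v t

def hasAll (nb : ℕ) (u : ℕ) : List ℕ → Bool
  | [] => true
  | v :: t => has nb u v && hasAll nb v t

def beqb (a b : Bool) : Bool := bif a then b else !b

def agree : List Bool → List Bool → Bool
  | [], _ => true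
  | a :: t, l => match l with
    | [] => true
    | b :: s => beqb a b && agree t s

def nodupb : List ℕ → Bool
  | [] => true
  | a :: t => !(elem a t) && nodupb t

def mask : List ℕ → ℕ
  | [] => 0
  | a :: t => Nat.lor (bit a) (mask t)

/-- insert rows for the new labels `cur, ...`, the last of which is followed by `last` -/
def rows (nb prev cur last : ℕ) (a : Bool) : List Bool → ℕ
  | [] => nb
  | b :: t => match t with
    | [] => ins (ins nb (Nat.mul 3 cur) (code prev a)) (Nat.add (Nat.mul 3 cur) 1) (code last b)
    | _ :: _ =>
      rows (ins (ins nb (Nat.mul 3 cur) (code prev a)) (Nat.add (Nat.mul 3 cur) 1)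
        (code (Nat.succ cur) b)) cur (Nat.succ cur) last b t

def vr (a b : Bool) (c : Bool) : Bool := beqb a b && beqb b c

def rng (N : ℕ) : ℕ → List ℕ
  | 0 => []
  | m + 1 => N :: rng (Nat.succ N) m

def opt (S : St) (z0 u0 u1 : ℕ) (p : List ℕ) (zk uj uk : ℕ) (k : ℕ)
    (al : List Bool) (pat : List Bool) : Option (List St) :=
  bif !(agree al pat) || !(nodupb (p.take pat.length)) then some [] else
  bif two S.nb uk uj zk then
    bif Nat.ble (Nat.succ k) pat.length then
      bif Nat.beq (byt S.nb (Nat.add (Nat.mul 3 u0) 2)) 0 &&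
          Nat.beq (byt S.nb (Nat.add (Nat.mul 3 uk) 2)) 0 && Nat.ble S.N 120 then
        match pat.drop k with
        | [] => none
        | fk :: rest =>
        bif vr (alf (ent S.nb u0 u1)) (alf (ent S.nb u0 z0)) (rest.getLastD fk) ||
          vr (alf (ent S.nb uk uj)) (alf (ent S.nb uk zk)) fk then some [] else
        match rest with
        | [] => bif Nat.beq z0 uk then some [] else
          some [⟨S.N, ins (ins S.nb (Nat.add (Nat.mul 3 u0) 2) (code uk fk))
              (Nat.add (Nat.mul 3 uk) 2) (code u0 fk),
            (mask p, p ++ p.take 3) :: S.fs⟩]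
        | b :: t =>
          some [⟨Nat.add S.N (b :: t).length,
            rows (ins (ins S.nb (Nat.add (Nat.mul 3 u0) 2)
                (code (Nat.add S.N t.length) ((b :: t).getLastD fk)))
              (Nat.add (Nat.mul 3 uk) 2) (code S.N fk)) uk S.N u0 fk (b :: t),
            (mask (p ++ rng S.N (b :: t).length),
              (p ++ rng S.N (b :: t).length) ++ (p ++ rng S.N (b :: t).length).take 3) :: S.fs⟩]
      else none
    else
      bif comd S u0 ((p.drop pat.length).headD 0) ||
        (Nat.beq pat.length k &&
          (comd S z0 zk || !(beqb (alf (ent S.nb u0 z0)) (alf (ent S.nb uk zk))) ||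
          (Nat.beq u0 uk && Nat.beq z0 uj))) then some []
      else none
  else none

def opts (S : St) (z0 u0 u1 : ℕ) (p : List ℕ) (zk uj uk : ℕ) (k : ℕ)
    (al : List Bool) : List (List Bool) → Option (List St)
  | [] => some []
  | pat :: t =>
    match opt S z0 u0 u1 p zk uj uk k al pat with
    | none => none
    | some l => match opts S z0 u0 u1 p zk uj uk k al t with
      | none => none
      | some l' => some (l ++ l')

def step (S : St) : List ℕ → Option (List St)
  | z0 :: u0 :: u1 :: r =>
    bif two S.nb u0 u1 z0 && hasAll S.nb u0 (u1 :: r) then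
    match walk S.nb S.fs z0 u0 u1 r with
    | none => none
    | some (zk, uj, uk) =>
      opts S z0 u0 u1 (u0 :: u1 :: r) zk uj uk (Nat.succ r.length) (als S.nb u0 (u1 :: r)) PATS
    else none
  | _ => none

def dec : ℕ → ℕ → List ℕ
  | 0, _ => []
  | f + 1, n => bif Nat.beq n 0 then [] else Nat.pred (Nat.mod n 128) :: dec f (Nat.div n 128)

/-- all labels have three neighbours, symmetrically -/
def closedb (nb : ℕ) : ℕ → Bool
  | 0 => true
  | u + 1 =>
    (!(Nat.beq (byt nb (Nat.mul 3 u)) 0) && !(Nat.beq (byt nb (Nat.add (Nat.mul 3 u) 1)) 0) &&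
      !(Nat.beq (byt nb (Nat.add (Nat.mul 3 u) 2)) 0) &&
      has nb (Nat.pred (Nat.div (byt nb (Nat.mul 3 u)) 2)) u &&
      has nb (Nat.pred (Nat.div (byt nb (Nat.add (Nat.mul 3 u) 1)) 2)) u &&
      has nb (Nat.pred (Nat.div (byt nb (Nat.add (Nat.mul 3 u) 2)) 2)) u) && closedb nb u

/-- `s` (with inverse `t`) maps the table `nb` into the table `T` -/
def homb (nb T s t : ℕ) : ℕ → Bool
  | 0 => true
  | u + 1 =>
    (Nat.ble (Nat.succ (byt s u)) 60 && Nat.beq (byt t (byt s u)) u &&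
      has T (byt s u) (byt s (Nat.pred (Nat.div (byt nb (Nat.mul 3 u)) 2))) &&
      has T (byt s u) (byt s (Nat.pred (Nat.div (byt nb (Nat.add (Nat.mul 3 u) 1)) 2))) &&
      has T (byt s u) (byt s (Nat.pred (Nat.div (byt nb (Nat.add (Nat.mul 3 u) 2)) 2)))) &&
    homb nb T s t u

def third (nb b a c : ℕ) : Option ℕ :=
  bif three nb b a c (Nat.pred (Nat.div (byt nb (Nat.mul 3 b)) 2)) then
    some (Nat.pred (Nat.div (byt nb (Nat.mul 3 b)) 2)) else
  bif three nb b a c (Nat.pred (Nat.div (byt nb (Nat.add (Nat.mul 3 b) 1)) 2)) then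
    some (Nat.pred (Nat.div (byt nb (Nat.add (Nat.mul 3 b) 1)) 2)) else
  bif three nb b a c (Nat.pred (Nat.div (byt nb (Nat.add (Nat.mul 3 b) 2)) 2)) then
    some (Nat.pred (Nat.div (byt nb (Nat.add (Nat.mul 3 b) 2)) 2)) else none

/-- moving a flag: `1` advance along the face, `2` turn, otherwise reverse -/
def mv (S : St) (o : ℕ) (f : ℕ × ℕ × ℕ) : Option (ℕ × ℕ × ℕ) :=
  match f with
  | (a, b, c) =>
    bif Nat.beq o 1 then
      match adv (q3 a b c) a b c S.fs with
      | none => none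
      | some d => some (b, c, d)
    else bif Nat.beq o 2 then
      match third S.nb b a c with
      | none => none
      | some d => some (a, b, d)
    else some (c, b, a)

/-- following the word `w` from both flags leads to distinct labels on a common face -/
def refute (S : St) : ℕ → ℕ → ℕ × ℕ × ℕ → ℕ × ℕ × ℕ → Bool
  | 0, _, _, _ => false
  | k + 1, w, f, f' =>
    bif Nat.beq w 0 then comd S f.2.1 f'.2.1 else
    match mv S (Nat.mod w 4) f, mv S (Nat.mod w 4) f' with
    | some g, some g' => refute S k (Nat.div w 4) g g'
    | _, _ => false

def flg : List ℕ → List (ℕ × ℕ × ℕ)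
  | [] => []
  | a :: t => match t with
    | b :: c :: _ => (a, b, c) :: (c, b, a) :: flg t
    | _ => []

def chkF (S : St) (f : ℕ × ℕ × ℕ) : List (ℕ × ℕ × ℕ) → List ℕ → Bool
  | [], _ => true
  | g :: t, l => match l with
    | [] => false
    | w :: ws => refute S 60 w f g && chkF S f t ws

def chkG (S : St) (f : ℕ × ℕ × ℕ) : List (List ℕ) → List (List ℕ) → Bool
  | [], _ => true
  | E :: t, l => match l with
    | [] => false
    | w :: ws => chkF S f (flg E) w && chkG S f t ws

def hd3 : List ℕ → ℕ × ℕ × ℕ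
  | a :: b :: c :: _ => (a, b, c)
  | _ => (0, 0, 0)

def chkH (S : St) : List (List ℕ) → List (List (List ℕ)) → Bool
  | [], _ => true
  | E :: t, l => match l with
    | [] => false
    | w :: ws => chkG S (hd3 E) t w && chkH S t ws

def allT : List Bool → Bool
  | [] => true
  | a :: t => a && allT t

def isH (nb : ℕ) : List ℕ → Bool
  | [] => false
  | a :: t => Nat.beq t.length 8 && hasAll nb a t && allT (als nb a t)

def Hs (nb : ℕ) : List (ℕ × List ℕ) → List (List ℕ)
  | [] => []
  | (_, E) :: t => bif isH nb E then E :: Hs nb t else Hs nb t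

def bigb (S : St) (l : List (List (List ℕ))) : Bool :=
  Nat.beq ((Hs S.nb S.fs).reverse.take 9).length 9 && chkH S ((Hs S.nb S.fs).reverse.take 9) l

inductive Ct where
  | P (n : ℕ)
  | C
  | I (b : Bool) (s t : ℕ)
  | B (l : List (List (List ℕ)))

/-- neighbour tables of the two target graphs -/
def TT (b : Bool) : ℕ := bif b then 13121556374379474985715955362580589327717379978716559005215540335206240852214990159317432987755247885847511849667327031838769002165667902291398434347284613545099965288259771496768062083262785621510941413803885514061262501033732244689154472280485181349957074123213127481959007456861912540476967899113874056391305334406244100356160474122139692870810924262016400060083698065737399812038705935113017007510656454465077619785107752818312458 else 13834581840491663021563988907624948551091179471622418742594302181451369095521910033751170636950133113393178854477923869643495096346130210831562545076512653960032964082406175204433395297217009965673353551850244495435255987911502234294450926535239980116272500578036613008152948184063249616280084779482906099317859040661031595884567287912478047953233964379847328900728288239640646842282500884474148614765290809665031034822882013880517898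

def run : List Ct → List St → Bool
  | [], l => l.isEmpty
  | c :: cs, l =>
    match l with
    | [] => false
    | S :: T =>
      match c with
      | .P n => match step S (dec 12 n) with
        | none => false
        | some ch => run cs (ch ++ T)
      | .C => closedb S.nb S.N && !(Nat.beq (Nat.mod S.N 60) 0) && run cs T
      | .I b s t => closedb S.nb S.N && Nat.beq S.N 60 && homb S.nb (TT b) s t 60 && run cs T
      | .B l => bigb S l && run cs T

/-! Initial states: the strip of six pentagons. -/

def PENT : List (List Bool) :=
  [[true,false,true,false,false],[false,true,false,true,false],[false,false,true,false,true],
   [true,false,false,true,false],[false,true,false,false,true]]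

def ix (p : List Bool) (i : ℕ) : Bool := p.getD i false

def starts : List (List (List Bool)) :=
  PENT.flatMap fun g => (PENT.filter fun h => beqb (ix g 0) (ix h 0) &&
    !(vr (ix g 0) (ix g 4) (ix h 1)) && !(vr (ix g 0) (ix g 1) (ix h 4))).flatMap fun h =>
  (PENT.filter fun f => beqb (ix g 4) (ix f 0) && beqb (ix h 1) (ix f 4) &&
    !(vr (ix g 3) (ix g 4) (ix f 1)) && !(vr (ix h 1) (ix h 2) (ix f 3))).flatMap fun f =>
  (PENT.filter fun e => beqb (ix h 4) (ix e 0) && beqb (ix g 1) (ix e 4) &&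
    !(vr (ix g 1) (ix g 2) (ix e 3)) && !(vr (ix h 3) (ix h 4) (ix e 1))).flatMap fun e =>
  (PENT.filter fun l => beqb (ix f 2) (ix l 4) &&
    !(vr (ix f 1) (ix f 2) (ix l 0)) && !(vr (ix f 2) (ix f 3) (ix l 3))).flatMap fun l =>
  (PENT.filter fun k => beqb (ix e 2) (ix k 4) &&
    !(vr (ix e 1) (ix e 2) (ix k 0)) && !(vr (ix e 2) (ix e 3) (ix k 3))).map fun k =>
  [g, h, f, e, l, k]

def stripF : List (List ℕ) :=
  [[0,1,2,3,4], [1,0,7,11,10], [0,4,5,6,7], [1,10,9,8,2], [5,12,13,14,6], [9,17,15,16,8]]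

/-- cyclic edges of a face with their values -/
def edg (a0 : ℕ) : List ℕ → List Bool → List (ℕ × ℕ × Bool)
  | a :: t, p :: ps => match t with
    | [] => [(a, a0, p)]
    | b :: _ => (a, b, p) :: edg a0 t ps
  | _, _ => []

def EA : List (List ℕ) → List (List Bool) → List (ℕ × ℕ × Bool)
  | F :: Fs, p :: ps => edg (F.headD 0) F p ++ EA Fs ps
  | _, _ => []

def addE (nb u x : ℕ) (b : Bool) : ℕ :=
  bif has nb u x then nb else
  bif Nat.beq (byt nb (Nat.mul 3 u)) 0 then ins nb (Nat.mul 3 u) (code x b) else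
  bif Nat.beq (byt nb (Nat.add (Nat.mul 3 u) 1)) 0 then
    ins nb (Nat.add (Nat.mul 3 u) 1) (code x b) else
  ins nb (Nat.add (Nat.mul 3 u) 2) (code x b)

def addEs (nb : ℕ) : List (ℕ × ℕ × Bool) → ℕ
  | [] => nb
  | (u, x, b) :: t => addEs (addE (addE nb u x b) x u b) t

def start (ps : List (List Bool)) : St :=
  ⟨18, addEs 0 (EA stripF ps), stripF.map fun F => (mask F, F ++ F.take 3)⟩

def okE (l : List (ℕ × ℕ × Bool)) (u e : ℕ) : Bool :=
  Nat.beq e 0 || l.any fun y => (Nat.beq y.1 u && Nat.beq (code y.2.1 y.2.2) e) ||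
    (Nat.beq y.2.1 u && Nat.beq (code y.1 y.2.2) e)

def nel (x y : ℕ) : Bool := Nat.beq x 0 || !(Nat.beq (Nat.div x 2) (Nat.div y 2))

def okS (nb : ℕ) (l : List (ℕ × ℕ × Bool)) : ℕ → Bool
  | 0 => true
  | u + 1 => okE l u (byt nb (Nat.mul 3 u)) && okE l u (byt nb (Nat.add (Nat.mul 3 u) 1)) &&
    okE l u (byt nb (Nat.add (Nat.mul 3 u) 2)) &&
    nel (byt nb (Nat.mul 3 u)) (byt nb (Nat.add (Nat.mul 3 u) 1)) &&
    nel (byt nb (Nat.mul 3 u)) (byt nb (Nat.add (Nat.mul 3 u) 2)) &&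
    nel (byt nb (Nat.add (Nat.mul 3 u) 1)) (byt nb (Nat.add (Nat.mul 3 u) 2)) && okS nb l u

def startOk (ps : List (List Bool)) : Bool :=
  okS (start ps).nb (EA stripF ps) 18 && Nat.beq (Nat.shiftRight (start ps).nb 432) 0

def runAll : List (List (List Bool)) → List (List Ct) → Bool
  | [], _ => true
  | ps :: t, l => match l with
    | [] => false
    | c :: cs => startOk ps && run c [start ps] && runAll t cs
end PartE4

section PartS1
set_option linter.all false

/-- Abstract local structure of an extremal fullerene graph. -/
structure Sys (W : Type) where
  Adj : W → W → Prop
  al : W → W → Bool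
  Face : ℕ → (ℤ → W) → Prop
  symm : ∀ {a b}, Adj a b → Adj b a
  alsymm : ∀ a b, al a b = al b a
  size : ∀ {n g}, Face n g → n = 5 ∨ n = 6
  per : ∀ {n g}, Face n g → ∀ j, g (j + n) = g j
  inj : ∀ {n g}, Face n g → ∀ i j, g i = g j → (n : ℤ) ∣ i - j
  fadj : ∀ {n g}, Face n g → ∀ j, Adj (g j) (g (j + 1))
  shift : ∀ {n g}, Face n g → ∀ c : ℤ, Face n (fun j => g (j + c))
  rev : ∀ {n g}, Face n g → Face n (fun j => g (-j))
  ex : ∀ {a b c}, Adj b a → Adj b c → a ≠ c → ∃ n g, Face n g ∧ g 0 = a ∧ g 1 = b ∧ g 2 = c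
  uniq : ∀ {n g n' g'}, Face n g → Face n' g' → g 0 = g' 0 → g 1 = g' 1 → g 2 = g' 2 →
    n = n' ∧ g = g'
  cubic : ∀ b, ∃ x y z, x ≠ y ∧ x ≠ z ∧ y ≠ z ∧ ∀ w, Adj b w ↔ (w = x ∨ w = y ∨ w = z)
  pat : ∀ {n g}, Face n g → List.ofFn (fun i : Fin n => al (g i) (g (i + 1))) ∈ PATS
  vrule : ∀ {b x y z}, Adj b x → Adj b y → Adj b z → x ≠ y → x ≠ z → y ≠ z →
    ¬ (al b x = al b y ∧ al b y = al b z)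
  hb : ∀ G : Fin 9 → ℤ → W, (∀ i, Face 6 (G i) ∧ ∀ j, al (G i j) (G i (j + 1)) = true) →
    ∃ i j, i < j ∧ ∃ c : ℤ, (∀ t, G i t = G j (c + t)) ∨ (∀ t, G i t = G j (c - t))
  conn : ∀ T : Set W, T.Nonempty → (∀ a ∈ T, ∀ b, Adj a b → b ∈ T) → T = Set.univ

/-! ### Byte tables -/

theorem byt_ins (nb j e j' : ℕ) (he : e < 256) :
    byt (ins nb j e) j' = if j' = j then (byt nb j) ||| e else byt nb j' := by
  have key : ∀ i, 8 ≤ i → e.testBit i = false := fun i hi =>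
    Nat.testBit_lt_two_pow (lt_of_lt_of_le he (by
      calc 256 = 2 ^ 8 := by norm_num
        _ ≤ 2 ^ i := Nat.pow_le_pow_right (by norm_num) hi))
  have h1 : ∀ a b, Nat.land a b = a &&& b := fun _ _ => rfl
  have h2 : ∀ a b, Nat.lor a b = a ||| b := fun _ _ => rfl
  have h3 : ∀ a b, Nat.shiftRight a b = a >>> b := fun _ _ => rfl
  have h4 : ∀ a b, Nat.shiftLeft a b = a <<< b := fun _ _ => rfl
  have h5 : ∀ a b, Nat.mul a b = a * b := fun _ _ => rfl
  have h255 : ∀ i, (255 : ℕ).testBit i = decide (i < 8) := fun i => by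
    rw [show 255 = 2 ^ 8 - 1 by norm_num, Nat.testBit_two_pow_sub_one]
  unfold byt ins
  simp only [h1, h2, h3, h4, h5]
  split_ifs with h
  · subst h
    apply Nat.eq_of_testBit_eq
    intro i
    simp only [Nat.testBit_and, Nat.testBit_shiftRight, Nat.testBit_or, Nat.testBit_shiftLeft, h255]
    by_cases hi : i < 8
    · simp [hi]
    · simp [hi, key i (by omega)]
  · apply Nat.eq_of_testBit_eq
    intro i
    simp only [Nat.testBit_and, Nat.testBit_shiftRight, Nat.testBit_or, Nat.testBit_shiftLeft, h255]
    by_cases hi : i < 8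
    · by_cases hj : 8 * j ≤ 8 * j' + i
      · have := key (8 * j' + i - 8 * j) (by omega)
        simp [hi, this]
      · simp [hi, hj]
    · simp [hi]

theorem byt_ins_same {nb j e : ℕ} (he : e < 256) (h : byt nb j = 0) : byt (ins nb j e) j = e := by
  rw [byt_ins _ _ _ _ he, if_pos rfl, h]; simp

theorem byt_ins_ne {nb j e j' : ℕ} (he : e < 256) (h : j' ≠ j) : byt (ins nb j e) j' = byt nb j' := by
  rw [byt_ins _ _ _ _ he, if_neg h]

theorem code_eq (x : ℕ) (b : Bool) : code x b = 2 * x + 2 + b.toNat := by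
  cases b <;> rfl

theorem code_inj {x y : ℕ} {b c : Bool} (h : code x b = code y c) : x = y ∧ b = c := by
  rw [code_eq, code_eq] at h
  cases b <;> cases c <;> simp at h ⊢ <;> omega

theorem code_div (x : ℕ) (b : Bool) : code x b / 2 = x + 1 := by
  rw [code_eq]; cases b <;> simp <;> omega

theorem alf_code (x : ℕ) (b : Bool) : alf (code x b) = b := by
  rw [code_eq]; unfold alf
  cases b
  · have : Nat.mod (2 * x + 2 + Bool.toNat false) 2 = 0 := by
      change (2 * x + 2 + 0) % 2 = 0; omega
    rw [this]; rfl
  · have : Nat.mod (2 * x + 2 + Bool.toNat true) 2 = 1 := by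
      change (2 * x + 2 + 1) % 2 = 1; omega
    rw [this]; rfl

theorem eq_code_of_div {e x : ℕ} (h : e / 2 = x + 1) : e = code x (alf e) := by
  rw [code_eq]; unfold alf
  change e = 2 * x + 2 + (Nat.beq (e % 2) 1).toNat
  rcases Nat.mod_two_eq_zero_or_one e with h' | h' <;> rw [h']
  · change e = 2 * x + 2 + 0; omega
  · change e = 2 * x + 2 + 1; omega

theorem code_lt {x : ℕ} (b : Bool) (h : x ≤ 126) : code x b < 256 := by
  rw [code_eq]; cases b <;> simp <;> omega

theorem code_ne (x : ℕ) (b : Bool) : code x b ≠ 0 := by rw [code_eq]; omega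

/-- `x` is listed as a neighbour of `u` with value `b` -/
def Has (nb u x : ℕ) (b : Bool) : Prop := ∃ i < 3, byt nb (3 * u + i) = code x b

theorem beq_iff (a b : ℕ) : Nat.beq a b = true ↔ a = b :=
  ⟨Nat.eq_of_beq_eq_true, fun h => h ▸ Nat.beq_refl a⟩

theorem nbeq_iff (a b : ℕ) : (!(Nat.beq a b)) = true ↔ a ≠ b := by
  rw [Bool.not_eq_true', Ne, ← beq_iff, Bool.not_eq_true]

theorem ent_spec {nb u x : ℕ} (h : ent nb u x ≠ 0) :
    Has nb u x (alf (ent nb u x)) := by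
  unfold ent at h ⊢
  revert h
  cases h1 : Nat.beq (Nat.div (byt nb (Nat.mul 3 u)) 2) (Nat.succ x)
  · cases h2 : Nat.beq (Nat.div (byt nb (Nat.add (Nat.mul 3 u) 1)) 2) (Nat.succ x)
    · cases h3 : Nat.beq (Nat.div (byt nb (Nat.add (Nat.mul 3 u) 2)) 2) (Nat.succ x)
      · intro h; exact absurd rfl h
      · exact fun _ => ⟨2, by omega, eq_code_of_div ((beq_iff _ _).1 h3)⟩
    · exact fun _ => ⟨1, by omega, eq_code_of_div ((beq_iff _ _).1 h2)⟩
  · exact fun _ => ⟨0, by omega, eq_code_of_div ((beq_iff _ _).1 h1)⟩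

theorem has_spec {nb u x : ℕ} (h : has nb u x = true) : Has nb u x (alf (ent nb u x)) :=
  ent_spec ((nbeq_iff _ _).1 h)

variable {W : Type}

structure Good (Y : Sys W) (ι : ℕ → W) (S : St) : Prop where
  cod : ∀ j, byt S.nb j ≠ 0 → j < 3 * S.N ∧ ∃ x b, byt S.nb j = code x b
  nbr : ∀ {u x b}, Has S.nb u x b → x < S.N ∧ Y.Adj (ι u) (ι x) ∧ Y.al (ι u) (ι x) = b
  li : ∀ {u i j x b y c}, i < 3 → j < 3 → i ≠ j → byt S.nb (3 * u + i) = code x b →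
    byt S.nb (3 * u + j) = code y c → ι x ≠ ι y
  fs : ∀ f ∈ S.fs, ∃ n g, Y.Face n g ∧ f.2.length = n + 3 ∧ (∀ x ∈ f.2, x < S.N) ∧
    ∀ i (h : i < f.2.length), ι f.2[i] = g i

theorem two_spec {nb u x y : ℕ} (h : two nb u x y = true) :
    has nb u x = true ∧ has nb u y = true ∧ x ≠ y := by
  simp only [two, Bool.and_eq_true, nbeq_iff] at h
  exact ⟨h.1.1, h.1.2, h.2⟩

namespace Good
variable {Y : Sys W} {ι : ℕ → W} {S : St}

theorem lt (G : Good Y ι S) {u x b} (h : Has S.nb u x b) : u < S.N := by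
  obtain ⟨i, hi, h⟩ := h
  have := (G.cod (3 * u + i) (by rw [h]; exact code_ne _ _)).1
  omega

theorem ne (G : Good Y ι S) {u x b y c} (h : Has S.nb u x b) (h' : Has S.nb u y c) (hxy : x ≠ y) : ι x ≠ ι y := by
  obtain ⟨i, hi, h⟩ := h
  obtain ⟨j, hj, h'⟩ := h'
  refine G.li hi hj ?_ h h'
  rintro rfl
  exact hxy (code_inj (h.symm.trans h')).1

theorem adj (G : Good Y ι S) {u x} (h : has S.nb u x = true) : Y.Adj (ι u) (ι x) := (G.nbr (has_spec h)).2.1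

theorem val (G : Good Y ι S) {u x} (h : has S.nb u x = true) : Y.al (ι u) (ι x) = alf (ent S.nb u x) :=
  (G.nbr (has_spec h)).2.2

theorem hne (G : Good Y ι S) {u x y} (h : has S.nb u x = true) (h' : has S.nb u y = true) (hxy : x ≠ y) :
    ι x ≠ ι y := G.ne (has_spec h) (has_spec h') hxy

end Good

theorem Sys.third (Y : Sys W) {b x y z w : W} (hx : Y.Adj b x) (hy : Y.Adj b y) (hz : Y.Adj b z)
    (hxy : x ≠ y) (hxz : x ≠ z) (hyz : y ≠ z) (hw : Y.Adj b w) : w = x ∨ w = y ∨ w = z := by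
  obtain ⟨p, q, r, -, -, -, h⟩ := Y.cubic b
  rw [h] at hx hy hz hw
  grind

/-- uniqueness at arbitrary positions -/
theorem Sys.uniq' (Y : Sys W) {n g n' g'} (h : Y.Face n g) (h' : Y.Face n' g') (i j : ℤ)
    (h0 : g i = g' j) (h1 : g (i + 1) = g' (j + 1)) (h2 : g (i + 2) = g' (j + 2)) :
    n = n' ∧ ∀ t, g (i + t) = g' (j + t) := by
  obtain ⟨e, e'⟩ := Y.uniq (Y.shift h i) (Y.shift h' j) (by simpa using h0)
    (by simpa [add_comm] using h1) (by simpa [add_comm] using h2)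
  refine ⟨e, fun t => ?_⟩
  have := congrFun e' t
  simpa [add_comm] using this

theorem Sys.ne_of (Y : Sys W) {n g} (h : Y.Face n g) {i j : ℤ} (h1 : i < j) (h2 : j < i + 5) :
    g i ≠ g j := by
  intro e
  have := Y.inj h _ _ e
  have hs := Y.size h
  obtain ⟨c, hc⟩ := this
  rcases hs with rfl | rfl <;> push_cast at hc <;> omega
end PartS1

section PartS2
set_option linter.all false
variable {W : Type}

theorem find4_spec {z u v w : ℕ} : ∀ {E : List ℕ}, find4 z u v E = some w → ∃ i,
    (E[i]? = some z ∧ E[i+1]? = some u ∧ E[i+2]? = some v ∧ E[i+3]? = some w) ∨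
    (E[i]? = some w ∧ E[i+1]? = some v ∧ E[i+2]? = some u ∧ E[i+3]? = some z)
  | [], h => by simp [find4] at h
  | [a], h => by simp [find4] at h
  | [a, b], h => by simp [find4] at h
  | [a, b, c], h => by simp [find4] at h
  | a :: b :: c :: d :: t, h => by
    rw [find4] at h
    cases h1 : Nat.beq b u && Nat.beq a z && Nat.beq c v
    · rw [h1] at h
      cases h2 : Nat.beq c u && Nat.beq b v && Nat.beq d z
      · rw [h2] at h
        obtain ⟨i, hi⟩ := find4_spec (E := b :: c :: d :: t) h
        exact ⟨i + 1, by simpa using hi⟩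
      · rw [h2] at h
        simp only [Bool.and_eq_true, beq_iff] at h2
        obtain ⟨⟨rfl, rfl⟩, rfl⟩ := h2
        simp only [cond_true, cond_false, Option.some.injEq] at h
        subst h
        exact ⟨0, Or.inr (by simp)⟩
    · rw [h1] at h
      simp only [Bool.and_eq_true, beq_iff] at h1
      obtain ⟨⟨rfl, rfl⟩, rfl⟩ := h1
      simp only [cond_true, Option.some.injEq] at h
      subst h
      exact ⟨0, Or.inl (by simp)⟩

theorem adv_spec {q z u v w : ℕ} : ∀ {fs : List (ℕ × List ℕ)}, adv q z u v fs = some w →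
    ∃ f ∈ fs, find4 z u v f.2 = some w
  | [], h => by simp [adv] at h
  | (m, E) :: t, h => by
    rw [adv] at h
    cases h1 : Nat.beq (Nat.land m q) q
    · rw [h1] at h
      obtain ⟨f, hf, h'⟩ := adv_spec (fs := t) h
      exact ⟨f, List.mem_cons_of_mem _ hf, h'⟩
    · rw [h1] at h
      simp only [cond_true] at h
      cases h2 : find4 z u v E with
      | some w' => rw [h2] at h; exact ⟨(m, E), by simp, by simpa [h2] using h⟩
      | none =>
        rw [h2] at h
        obtain ⟨f, hf, h'⟩ := adv_spec (fs := t) h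
        exact ⟨f, List.mem_cons_of_mem _ hf, h'⟩

theorem adv_good {Y : Sys W} {ι : ℕ → W} {S : St} (G : Good Y ι S) {q z u v w : ℕ}
    (h : adv q z u v S.fs = some w) :
    ∃ n g, Y.Face n g ∧ g 0 = ι z ∧ g 1 = ι u ∧ g 2 = ι v ∧ g 3 = ι w := by
  obtain ⟨f, hf, h'⟩ := adv_spec h
  obtain ⟨n, g, hg, hl, -, hi⟩ := G.fs f hf
  have key : ∀ {i x : ℕ}, f.2[i]? = some x → g i = ι x := fun {i x : ℕ} hx => by
    obtain ⟨h1, h2⟩ := List.getElem?_eq_some_iff.1 hx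
    rw [← hi i h1, h2]
  obtain ⟨i, ⟨h0, h1, h2, h3⟩ | ⟨h0, h1, h2, h3⟩⟩ := find4_spec h'
  · refine ⟨n, fun j => g (j + i), Y.shift hg i, ?_, ?_, ?_, ?_⟩
    · rw [← key h0]; simp
    · rw [← key h1]; push_cast; ring_nf
    · rw [← key h2]; push_cast; ring_nf
    · rw [← key h3]; push_cast; ring_nf
  · refine ⟨n, fun j => g (-j + (i + 3)), Y.rev (Y.shift hg (i + 3)), ?_, ?_, ?_, ?_⟩
    · rw [← key h3]; push_cast; ring_nf
    · rw [← key h2]; push_cast; ring_nf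
    · rw [← key h1]; push_cast; ring_nf
    · rw [← key h0]; push_cast; ring_nf

theorem elem_iff (a : ℕ) : ∀ l : List ℕ, elem a l = true ↔ a ∈ l
  | [] => by simp [elem]
  | b :: t => by simp [elem, beq_iff, elem_iff a t]

theorem com_spec {q a b : ℕ} : ∀ {fs : List (ℕ × List ℕ)}, com q a b fs = true →
    ∃ f ∈ fs, a ∈ f.2.drop 3 ∧ b ∈ f.2.drop 3
  | [], h => by simp [com] at h
  | (m, E) :: t, h => by
    simp only [com, Bool.or_eq_true, Bool.and_eq_true, elem_iff] at h
    rcases h with h | h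
    · exact ⟨(m, E), by simp, h.1.2, h.2⟩
    · obtain ⟨f, hf, h'⟩ := com_spec h
      exact ⟨f, List.mem_cons_of_mem _ hf, h'⟩

theorem comd_good {Y : Sys W} {ι : ℕ → W} {S : St} (G : Good Y ι S) {a b : ℕ}
    (h : comd S a b = true) : ι a ≠ ι b := by
  simp only [comd, Bool.and_eq_true, nbeq_iff] at h
  obtain ⟨f, hf, ha, hb⟩ := com_spec h.2
  obtain ⟨n, g, hg, hl, -, hi⟩ := G.fs f hf
  obtain ⟨i, hi1, rfl⟩ := List.getElem_of_mem ha
  obtain ⟨j, hj1, rfl⟩ := List.getElem_of_mem hb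
  have hne : i ≠ j := by rintro rfl; exact h.1 rfl
  simp only [List.length_drop] at hi1 hj1
  simp only [List.getElem_drop]
  rw [hi, hi]
  intro e
  obtain ⟨c, hc⟩ := Y.inj hg _ _ e
  have hs := Y.size hg
  push_cast at hc
  rcases hs with rfl | rfl <;> push_cast at hc <;> omega

theorem three_spec {nb u x y z : ℕ} (h : three nb u x y z = true) :
    has nb u x = true ∧ has nb u y = true ∧ has nb u z = true ∧ x ≠ y ∧ y ≠ z ∧ x ≠ z := by
  simp only [three, Bool.and_eq_true, nbeq_iff] at h
  obtain ⟨⟨⟨h1, h2⟩, h3⟩, h4⟩ := h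
  have := two_spec h1
  tauto

/-- The new face leaves the known face at the next vertex. -/
theorem adv_step {Y : Sys W} {ι : ℕ → W} {S : St} (G : Good Y ι S) {q z u v w : ℕ}
    (h : adv q z u v S.fs = some w) {n : ℕ} {g : ℤ → W} (hg : Y.Face n g) (j : ℤ)
    (h0 : g j ≠ ι z) (h1 : g (j + 1) = ι u) (h2 : g (j + 2) = ι v) : g (j + 3) ≠ ι w := by
  intro h3
  obtain ⟨n', g', hg', e0, e1, e2, e3⟩ := adv_good G h
  obtain ⟨rfl, e⟩ := Y.uniq' hg hg' (j + 1) 1 (by rw [h1, e1])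
    (by rw [show j + 1 + 1 = j + 2 by ring, h2]; exact e2.symm)
    (by rw [show j + 1 + 2 = j + 3 by ring, h3]; exact e3.symm)
  have e4 := e (-1)
  simp at e4
  exact h0 (e4.trans e0)

theorem walk_good {Y : Sys W} {ι : ℕ → W} {S : St} (G : Good Y ι S) {n : ℕ} {g : ℤ → W}
    (hg : Y.Face n g) {zk uj uk : ℕ} : ∀ (r : List ℕ) (z u v : ℕ) (j : ℤ),
    g j ≠ ι z → g (j + 1) = ι u → g (j + 2) = ι v →
    walk S.nb S.fs z u v r = some (zk, uj, uk) →
    (∀ i (h : i < (u :: v :: r).length), g (j + 1 + i) = ι (u :: v :: r)[i]) ∧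
    (u :: v :: r)[r.length]? = some uj ∧ (u :: v :: r)[r.length + 1]? = some uk ∧
    g (j + r.length + 3) ≠ ι zk
  | [], z, u, v, j, h0, h1, h2, h => by
    rw [walk] at h
    cases ha : adv (q3 z u v) z u v S.fs with
    | none => rw [ha] at h; simp at h
    | some z' =>
      rw [ha] at h
      simp only [Option.some.injEq, Prod.mk.injEq] at h
      obtain ⟨rfl, rfl, rfl⟩ := h
      refine ⟨?_, by simp, by simp, ?_⟩
      · intro i hi
        simp only [List.length_cons, List.length_nil] at hi
        interval_cases i
        · simpa using h1
        · simpa [add_assoc] using h2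
      · simpa using adv_step G ha hg j h0 h1 h2
  | w :: r, z, u, v, j, h0, h1, h2, h => by
    rw [walk] at h
    cases ha : adv (q3 z u v) z u v S.fs with
    | none => rw [ha] at h; simp at h
    | some z' =>
      rw [ha] at h
      simp only at h
      cases h3 : three S.nb v u z' w
      · rw [h3] at h; simp at h
      rw [h3, cond_true] at h
      obtain ⟨a1, a2, a3, a4, a5, a6⟩ := three_spec h3
      have hz := adv_step G ha hg j h0 h1 h2
      have hadj : Y.Adj (ι v) (g (j + 3)) := by
        have := Y.fadj hg (j + 2)
        rw [h2] at this
        rwa [show j + 2 + 1 = j + 3 by ring] at this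
      have hu : g (j + 3) ≠ ι u := by
        rw [← h1]; exact (Y.ne_of hg (by omega) (by omega)).symm
      have hw : g (j + 3) = ι w := by
        rcases Y.third (G.adj a1) (G.adj a2) (G.adj a3) (G.hne a1 a2 a4) (G.hne a1 a3 a6)
          (G.hne a2 a3 a5) hadj with e | e | e
        · exact absurd e hu
        · exact absurd e hz
        · exact e
      obtain ⟨b1, b2, b3, b4⟩ := walk_good G hg r z' v w (j + 1)
        (by rw [h1]; exact G.hne a1 a2 a4) (by rw [show j + 1 + 1 = j + 2 by ring]; exact h2)
        (by rw [show j + 1 + 2 = j + 3 by ring]; exact hw) h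
      refine ⟨?_, ?_, ?_, ?_⟩
      · intro i hi
        rcases i with _ | i
        · simpa using h1
        · have := b1 i (by simpa using hi)
          rw [List.getElem_cons_succ, ← this]
          push_cast; ring_nf
      · simpa using b2
      · simpa using b3
      · have e : j + ((w :: r).length : ℤ) + 3 = j + 1 + r.length + 3 := by
          simp only [List.length_cons]; push_cast; ring
        rw [e]; exact b4
end PartS2

section PartS3
set_option linter.all false
variable {W : Type} {Y : Sys W} {ι : ℕ → W} {S : St}

theorem Good.insert (G : Good Y ι S) {u i x : ℕ} {b : Bool} (hi : i < 3) (hu : u < S.N) (hx : x < S.N)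
    (hN : S.N ≤ 126) (h0 : byt S.nb (3 * u + i) = 0) (ha : Y.Adj (ι u) (ι x)) (hb : Y.al (ι u) (ι x) = b)
    (hn : ∀ j y c, j < 3 → byt S.nb (3 * u + j) = code y c → ι y ≠ ι x) :
    Good Y ι ⟨S.N, ins S.nb (3 * u + i) (code x b), S.fs⟩ := by
  have hc : code x b < 256 := code_lt b (by omega)
  have hsame := byt_ins_same hc h0
  refine ⟨?_, ?_, ?_, G.fs⟩
  · intro j hj
    by_cases h : j = 3 * u + i
    · subst h; exact ⟨by simp only; omega, x, b, hsame⟩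
    · rw [byt_ins_ne hc h] at hj ⊢; exact G.cod j hj
  · rintro u' x' b' ⟨j, hj, h⟩
    simp only at h
    by_cases h' : 3 * u' + j = 3 * u + i
    · have : u' = u := by omega
      subst this
      rw [h', hsame] at h
      obtain ⟨rfl, rfl⟩ := code_inj h
      exact ⟨hx, ha, hb⟩
    · rw [byt_ins_ne hc h'] at h
      exact G.nbr ⟨j, hj, h⟩
  · intro u' j j' y c y' c' hj hj' hjj e e'
    simp only at e e'
    by_cases h' : 3 * u' + j = 3 * u + i
    · have : u' = u := by omega
      subst this
      rw [h', hsame] at e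
      obtain ⟨rfl, rfl⟩ := code_inj e
      rw [byt_ins_ne hc (by omega)] at e'
      exact (hn _ _ _ hj' e').symm
    · by_cases h'' : 3 * u' + j' = 3 * u + i
      · have : u' = u := by omega
        subst this
        rw [h'', hsame] at e'
        obtain ⟨rfl, rfl⟩ := code_inj e'
        rw [byt_ins_ne hc (by omega)] at e
        exact hn _ _ _ hj e
      · rw [byt_ins_ne hc h'] at e
        rw [byt_ins_ne hc h''] at e'
        exact G.li hj hj' hjj e e'

theorem Good.extend (G : Good Y ι S) {ι' : ℕ → W} {N' : ℕ} (hN : S.N ≤ N') (h : ∀ x < S.N, ι' x = ι x) :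
    Good Y ι' ⟨N', S.nb, S.fs⟩ := by
  refine ⟨?_, ?_, ?_, ?_⟩
  · intro j hj
    obtain ⟨h1, h2⟩ := G.cod j hj
    exact ⟨by simp only; omega, h2⟩
  · intro u x b hx
    have h1 := G.lt hx
    have h2 := G.nbr hx
    rw [h _ h1, h _ h2.1]
    exact ⟨by simp only; omega, h2.2⟩
  · intro u i j x b y c hi hj hij e e'
    rw [h _ (G.nbr ⟨i, hi, e⟩).1, h _ (G.nbr ⟨j, hj, e'⟩).1]
    exact G.li hi hj hij e e'
  · intro f hf
    obtain ⟨n, g, h1, h2, h3, h4⟩ := G.fs f hf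
    refine ⟨n, g, h1, h2, fun x hx => by have := h3 x hx; simp only; omega, fun i hi => ?_⟩
    rw [← h4 i hi, h _ (h3 _ (List.getElem_mem hi))]

theorem Good.addFace (G : Good Y ι S) {n : ℕ} {g : ℤ → W} {p : List ℕ} {m : ℕ} (hg : Y.Face n g) (hl : p.length = n)
    (hp : ∀ x ∈ p, x < S.N) (hi : ∀ i (h : i < p.length), ι p[i] = g i) :
    Good Y ι ⟨S.N, S.nb, (m, p ++ p.take 3) :: S.fs⟩ := by
  refine ⟨G.cod, G.nbr, G.li, ?_⟩
  intro f hf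
  rcases List.mem_cons.1 hf with rfl | hf
  · have hs := Y.size hg
    refine ⟨n, g, hg, ?_, ?_, ?_⟩
    · simp only [List.length_append, List.length_take]; omega
    · intro x hx
      rcases List.mem_append.1 hx with hx | hx
      · exact hp x hx
      · exact hp x (List.mem_of_mem_take hx)
    · intro i h
      simp only [List.length_append, List.length_take] at h
      simp only [List.getElem_append]
      split_ifs with h'
      · exact hi i h'
      · rw [List.getElem_take, hi]
        rw [← Y.per hg]
        congr 1
        push_cast [Nat.cast_sub (not_lt.1 h')]
        rw [hl]; ring
  · exact G.fs f hf

theorem rows_good {n : ℕ} {g : ℤ → W} (hg : Y.Face n g) {N : ℕ} (hN : N ≤ 126)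
    {fs : List (ℕ × List ℕ)} {last : ℕ} (hlast : last < N) : ∀ (l : List Bool) (nb prev cur : ℕ) (a : Bool) (s : ℤ),
    Good Y ι ⟨N, nb, fs⟩ → prev < N → cur + l.length ≤ N →
    (∀ j, 3 * cur ≤ j → byt nb j = 0) →
    ι prev = g (s - 1) → (∀ i, i < l.length → ι (cur + i) = g (s + i)) → ι last = g (s + l.length) →
    Y.al (g (s - 1)) (g s) = a → (∀ i (h : i < l.length), l[i] = Y.al (g (s + i)) (g (s + i + 1))) →
    Good Y ι ⟨N, rows nb prev cur last a l, fs⟩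
  | [], nb, prev, cur, a, s, G, _, _, _, _, _, _, _, _ => by
    rw [rows]; exact G
  | b :: t, nb, prev, cur, a, s, G, hp, hcur, h0, e1, e2, e3, e4, e5 => by
    simp only [List.length_cons] at hcur e2 e3 e5
    have ec : ι cur = g s := by simpa using e2 0 (by omega)
    have hb : b = Y.al (g s) (g (s + 1)) := by simpa using e5 0 (by omega)
    have G1 : Good Y ι ⟨N, ins nb (3 * cur + 0) (code prev a), fs⟩ := by
      refine G.insert (by omega) (show cur < N by omega) hp hN (h0 _ (by omega)) ?_ ?_ ?_
      · rw [ec, e1]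
        have := Y.symm (Y.fadj hg (s - 1))
        simpa using this
      · rw [ec, e1, Y.alsymm]; exact e4
      · intro j y c hj h
        rw [h0 _ (by omega)] at h
        exact absurd h.symm (code_ne _ _)
    have hz : ∀ j, 3 * cur + 0 ≠ j → 3 * cur ≤ j → byt (ins nb (3 * cur + 0) (code prev a)) j = 0 := by
      intro j hj hj'
      rw [byt_ins_ne (code_lt _ (by omega)) (Ne.symm hj)]
      exact h0 j hj'
    have step : ∀ nx, nx < N → ι nx = g (s + 1) →
        Good Y ι ⟨N, ins (ins nb (3 * cur + 0) (code prev a)) (3 * cur + 1) (code nx b), fs⟩ := by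
      intro nx hnx enx
      refine G1.insert (by omega) (show cur < N by omega) hnx hN (hz _ (by omega) (by omega)) ?_ ?_ ?_
      · rw [ec, enx]
        exact Y.fadj hg s
      · rw [ec, enx]; exact hb.symm
      · intro j y c hj h
        simp only at h
        by_cases hj0 : j = 0
        · subst hj0
          rw [byt_ins_same (code_lt _ (by omega)) (h0 _ (by omega))] at h
          obtain ⟨rfl, rfl⟩ := code_inj h
          rw [e1, enx]
          exact Y.ne_of hg (by omega) (by omega)
        · rw [hz _ (by omega) (by omega)] at h
          exact absurd h.symm (code_ne _ _)
    cases t with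
    | nil =>
      exact step last hlast (by simpa using e3)
    | cons b' t =>
      have ec1 : ι (cur + 1) = g (s + 1) := by simpa using e2 1 (by simp)
      have G2 := step (cur + 1) (by simp at hcur; omega) ec1
      simp only [List.length_cons] at hcur e2 e3 e5
      refine rows_good hg hN hlast (b' :: t) _ cur (cur + 1) b (s + 1) G2 (by omega) (by simp only [List.length_cons]; omega) ?_ ?_ ?_ ?_ ?_ ?_
      · intro j hj
        change byt (ins (ins nb (3 * cur + 0) (code prev a)) (3 * cur + 1) (code (cur + 1) b)) j = 0
        rw [byt_ins_ne (code_lt _ (by omega)) (by omega)]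
        exact hz _ (by omega) (by omega)
      · rw [ec]; congr 1; ring
      · intro i hi
        have := e2 (i + 1) (by simp only [List.length_cons] at hi; omega)
        rw [show cur + 1 + i = cur + (i + 1) by ring, this]
        congr 1; push_cast; ring
      · rw [e3]; congr 1; push_cast [List.length_cons]; ring
      · rw [hb]; congr 2; ring
      · intro i hi
        have := e5 (i + 1) (by simp only [List.length_cons] at hi; omega)
        rw [List.getElem_cons_succ] at this
        rw [this]
        congr 2 <;> (push_cast; ring)

theorem two_slots {nb u x y w : ℕ} {b c d : Bool} (h2 : byt nb (3 * u + 2) = 0) (hx : Has nb u x b) (hy : Has nb u y c)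
    (hxy : x ≠ y) {i : ℕ} (hi : i < 3) (h : byt nb (3 * u + i) = code w d) : w = x ∨ w = y := by
  obtain ⟨j, hj, e⟩ := hx
  obtain ⟨k, hk, e'⟩ := hy
  have hjk : j ≠ k := by
    rintro rfl; exact hxy (code_inj (e.symm.trans e')).1
  have hj2 : j ≠ 2 := by rintro rfl; rw [h2] at e; exact code_ne _ _ e.symm
  have hk2 : k ≠ 2 := by rintro rfl; rw [h2] at e'; exact code_ne _ _ e'.symm
  have hi2 : i ≠ 2 := by rintro rfl; rw [h2] at h; exact code_ne _ _ h.symm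
  have : i = j ∨ i = k := by omega
  rcases this with rfl | rfl
  · exact Or.inl (code_inj (h.symm.trans e)).1
  · exact Or.inr (code_inj (h.symm.trans e')).1

theorem beqb_iff (a b : Bool) : beqb a b = true ↔ a = b := by cases a <;> cases b <;> simp [beqb]

theorem vr_iff (a b c : Bool) : vr a b c = true ↔ a = b ∧ b = c := by simp [vr, beqb_iff]

theorem nodupb_of : ∀ {l : List ℕ}, l.Nodup → nodupb l = true
  | [], _ => rfl
  | a :: t, h => by
    obtain ⟨h1, h2⟩ := List.nodup_cons.1 h
    rw [nodupb, nodupb_of h2, Bool.and_true, Bool.not_eq_true', Bool.eq_false_iff, Ne, elem_iff]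
    exact h1

theorem agree_of : ∀ {l l' : List Bool}, (∀ i (h : i < l.length) (h' : i < l'.length), l[i] = l'[i]) → agree l l' = true
  | [], _, _ => by rw [agree]
  | a :: t, [], _ => by rw [agree]
  | a :: t, b :: s, h => by
    rw [agree, Bool.and_eq_true, beqb_iff]
    exact ⟨h 0 (Nat.succ_pos _) (Nat.succ_pos _), agree_of fun i hi hi' =>
      h (i + 1) (Nat.succ_lt_succ hi) (Nat.succ_lt_succ hi')⟩

theorem hasAll_spec {nb : ℕ} : ∀ {l : List ℕ} {u : ℕ}, hasAll nb u l = true →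
    ∀ i (h : i < l.length), has nb ((u :: l)[i]'(by simp; omega)) (l[i]) = true
  | [], u, _, i, h => by simp at h
  | v :: t, u, H, i, h => by
    rw [hasAll, Bool.and_eq_true] at H
    rcases i with _ | i
    · exact H.1
    · have := hasAll_spec H.2 i (by simpa using h)
      simpa using this

theorem als_length {nb : ℕ} : ∀ (l : List ℕ) (u : ℕ), (als nb u l).length = l.length
  | [], u => rfl
  | v :: t, u => by simp [als, als_length t v]

theorem als_get {nb : ℕ} : ∀ (l : List ℕ) (u : ℕ) (i : ℕ) (h : i < (als nb u l).length) ,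
    (als nb u l)[i] = alf (ent nb ((u :: l)[i]'(by rw [als_length] at h; simp; omega)) (l[i]'(by rw [als_length] at h; exact h)))
  | [], u, i, h => by simp [als] at h
  | v :: t, u, i, h => by
    rcases i with _ | i
    · rfl
    · have := als_get t v i (by simpa [als] using h)
      simpa [als] using this

theorem rng_eq : ∀ (m N : ℕ), rng N m = List.range' N m
  | 0, N => rfl
  | m + 1, N => by rw [rng, rng_eq m, List.range'_succ]
end PartS3

section PartS4
set_option linter.all false
variable {W : Type} {Y : Sys W} {ι : ℕ → W} {S : St}

theorem bif_none {α : Type} {c : Bool} {a : Option α} {x : α} (h : (bif c then a else none) = some x) :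
    c = true ∧ a = some x := by
  cases c <;> simp_all

theorem opts_mem {z0 u0 u1 : ℕ} {p : List ℕ} {zk uj uk k : ℕ} {al pat : List Bool} : ∀ {l : List (List Bool)} {ch},
    opts S z0 u0 u1 p zk uj uk k al l = some ch → pat ∈ l →
    ∃ c, opt S z0 u0 u1 p zk uj uk k al pat = some c ∧ ∀ x ∈ c, x ∈ ch
  | [], ch, h, hm => by simp at hm
  | a :: t, ch, h, hm => by
    rw [opts] at h
    cases h1 : opt S z0 u0 u1 p zk uj uk k al a with
    | none => rw [h1] at h; simp at h
    | some l =>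
      rw [h1] at h
      cases h2 : opts S z0 u0 u1 p zk uj uk k al t with
      | none => rw [h2] at h; simp at h
      | some l' =>
        rw [h2] at h
        simp only [Option.some.injEq] at h
        subst h
        rcases List.mem_cons.1 hm with rfl | hm
        · exact ⟨l, h1, fun x hx => List.mem_append_left _ hx⟩
        · obtain ⟨c, hc, hc'⟩ := opts_mem h2 hm
          exact ⟨c, hc, fun x hx => List.mem_append_right _ (hc' x hx)⟩

theorem drop_tail_get {l : List Bool} {k : ℕ} {fk : Bool} {rest : List Bool} (h : l.drop k = fk :: rest) :
    ∃ hk : k < l.length, fk = l[k] ∧ rest.length + k + 1 = l.length ∧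
    ∀ i (hi : i < rest.length), ∃ h', rest[i] = l[k + 1 + i]'(h') := by
  have hl := congrArg List.length h
  simp only [List.length_drop, List.length_cons] at hl
  refine ⟨by omega, ?_, by omega, ?_⟩
  · have : (l.drop k)[0]'(by simp; omega) = fk := by simp [h]
    rw [← this, List.getElem_drop]; simp
  · intro i hi
    refine ⟨by omega, ?_⟩
    have : (l.drop k)[i + 1]'(by simp; omega) = rest[i] := by simp [h]
    rw [← this, List.getElem_drop]; congr 1; ring

theorem getLastD_get (fk : Bool) (rest : List Bool) :
    rest.getLastD fk = (fk :: rest)[rest.length]'(by simp) := by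
  cases rest with
  | nil => rfl
  | cons b t =>
    have : (b :: t).getLastD fk = (b :: t).getLast (by simp) := by simp [List.getLastD]
    rw [this, List.getLast_eq_getElem]; simp

theorem opt_good (G : Good Y ι S) {z0 u0 u1 : ℕ} {p : List ℕ} {zk uj uk k : ℕ} {al : List Bool}
    {n : ℕ} {g : ℤ → W} (hg : Y.Face n g) (hk1 : 1 ≤ k) (hpl : p.length = k + 1)
    (hpN : ∀ x ∈ p, x < S.N)
    (hp : ∀ i (h : i < p.length), g i = ι p[i]) (hp0 : p[0]'(by omega) = u0) (hp1 : p[1]'(by omega) = u1)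
    (hpj : p[k - 1]'(by omega) = uj) (hpk : p[k]'(by omega) = uk)
    (hz0 : g (-1) ≠ ι z0) (hzk : g (k + 1) ≠ ι zk)
    (h2 : two S.nb u0 u1 z0 = true)
    (hal : ∀ i (h : i < al.length), al[i] = Y.al (g i) (g (i + 1))) {c : List St}
    (h : opt S z0 u0 u1 p zk uj uk k al (List.ofFn (fun i : Fin n => Y.al (g i) (g (i + 1)))) = some c) :
    ∃ ι', ∃ S' ∈ c, Good Y ι' S' := by
  have hn := Y.size hg
  set pat := List.ofFn (fun i : Fin n => Y.al (g i) (g (i + 1))) with hpat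
  have hpatl : pat.length = n := by simp [hpat]
  have hpatg : ∀ i (h : i < pat.length), pat[i] = Y.al (g i) (g (i + 1)) := by
    intro i h; simp [hpat]
  have e0 : g 0 = ι u0 := by have := hp 0 (by omega); rw [hp0] at this; simpa using this
  have e1 : g 1 = ι u1 := by have := hp 1 (by omega); rw [hp1] at this; simpa using this
  have ek : g k = ι uk := by have := hp k (by omega); rwa [hpk] at this
  have ej : g (k - 1) = ι uj := by
    have := hp (k - 1) (by omega); rw [hpj] at this
    rw [← this]; congr 1; push_cast [Nat.cast_sub hk1]; ring
  have hu0 : u0 < S.N := hpN _ (hp0 ▸ List.getElem_mem _)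
  have huk : uk < S.N := hpN _ (hpk ▸ List.getElem_mem _)
  obtain ⟨hu01, hu0z, hne0⟩ := two_spec h2
  have a0 : Y.Adj (ι u0) (g (-1)) := by
    rw [← e0]; have := Y.symm (Y.fadj hg (-1)); simpa using this
  have n01 : g (-1) ≠ ι u1 := by rw [← e1]; exact Y.ne_of hg (by omega) (by omega)
  have ak : Y.Adj (ι uk) (g (k + 1)) := by rw [← ek]; exact Y.fadj hg k
  have nkj : g (k + 1) ≠ ι uj := by
    rw [← ej]; exact (Y.ne_of hg (by omega) (by omega)).symm
  have hper : ∀ j : ℤ, g (j + n) = g j := Y.per hg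
  rw [opt] at h
  have c1 : agree al pat = true := by
    apply agree_of
    intro i hi hi'
    rw [hal, hpatg]
  have c2 : nodupb (p.take pat.length) = true := by
    apply nodupb_of
    rw [List.nodup_iff_injective_get]
    rintro ⟨i, hi⟩ ⟨j, hj⟩ hij
    simp only [List.length_take] at hi hj
    simp only [List.get_eq_getElem, List.getElem_take] at hij
    have : g i = g j := by rw [hp i (by omega), hp j (by omega), hij]
    obtain ⟨d, hd⟩ := Y.inj hg _ _ this
    ext
    simp only
    rcases hn with rfl | rfl <;> push_cast at hd <;> omega
  rw [c1, c2] at h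
  simp only [Bool.not_true, Bool.or_false, cond_false] at h
  cases c3 : two S.nb uk uj zk
  · rw [c3] at h; simp at h
  obtain ⟨hukj, hukz, hnek⟩ := two_spec c3
  rw [c3, cond_true] at h
  cases c4 : Nat.ble (Nat.succ k) pat.length
  · -- closed up too early
    rw [c4, cond_false] at h
    have hlt : n ≤ k := by
      have : ¬ (Nat.succ k ≤ pat.length) := by
        rw [← Nat.ble_eq, c4]; simp
      omega
    obtain ⟨hc, h⟩ := bif_none h
    exfalso
    have hd : (p.drop pat.length).headD 0 = p[n]'(by omega) := by
      rw [hpatl, List.drop_eq_getElem_cons (by omega)]; rfl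
    rw [hd, hpatl] at hc
    have egn : g n = ι u0 := by rw [← e0]; have := hper 0; simpa using this
    simp only [Bool.or_eq_true, Bool.and_eq_true, beq_iff] at hc
    rcases hc with hc | ⟨rfl, hc⟩
    · apply comd_good G hc
      rw [← egn]; exact hp n (by omega)
    · have eku : ι uk = ι u0 := by rw [← ek, egn]
      have ek1 : g (n + 1) = ι u1 := by rw [← e1, ← hper 1]; congr 1; ring
      have ek2 : ι uj = g (-1) := by rw [← ej, ← hper (-1)]; congr 1 <;> ring
      have ezz : ι zk = ι z0 := by
        have := Y.third (G.adj hu01) (G.adj hu0z) a0 (G.hne hu01 hu0z hne0) n01.symm hz0.symm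
          (w := ι zk) (by rw [← eku]; exact G.adj hukz)
        rcases this with e | e | e
        · exact absurd (ek1.trans e.symm) hzk
        · exact e
        · exact absurd (ek2.trans e.symm) (G.hne hukj hukz hnek)
      rcases hc with (hc | hc) | ⟨hc, hc'⟩
      · exact comd_good G hc ezz.symm
      · rw [← G.val hu0z, ← G.val hukz, ezz, eku] at hc
        simp [beqb] at hc
      · rw [← hc'] at ek2
        exact hz0 ek2.symm
  · rw [c4, cond_true] at h
    have hlt : k + 1 ≤ n := by
      rw [Nat.ble_eq] at c4; omega
    obtain ⟨hc, h⟩ := bif_none h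
    simp only [Bool.and_eq_true, beq_iff] at hc
    obtain ⟨⟨hs0, hsk⟩, hN⟩ := hc
    have hN : S.N ≤ 120 := by rwa [Nat.ble_eq] at hN
    change byt S.nb (3 * u0 + 2) = 0 at hs0
    change byt S.nb (3 * uk + 2) = 0 at hsk
    cases hd : pat.drop k with
    | nil => rw [hd] at h; simp at h
    | cons fk rest =>
    rw [hd] at h
    simp only at h
    obtain ⟨hkl, hfk, hrl, hrest⟩ := drop_tail_get hd
    rw [hpatg] at hfk
    have hlastval : rest.getLastD fk = Y.al (g (-1)) (g 0) := by
      have key : ∀ i (hi : i < (fk :: rest).length), (fk :: rest)[i] = Y.al (g (k + i)) (g (k + i + 1)) := by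
        intro i hi
        rcases i with _ | i
        · simp only [List.getElem_cons_zero]; rw [hfk]; simp
        · obtain ⟨h', e⟩ := hrest i (by simpa using hi)
          rw [List.getElem_cons_succ, e, hpatg]
          congr 2 <;> (push_cast; ring)
      rw [getLastD_get, key, ← hper (-1), ← hper 0]
      congr 2 <;> (rw [← hpatl, ← hrl]; push_cast; ring)
    have hu0k : u0 ≠ uk := by
      intro e
      have : g 0 = g k := by rw [e0, ek, e]
      obtain ⟨d, hd⟩ := Y.inj hg _ _ this
      rcases hn with rfl | rfl <;> push_cast at hd <;> omega
    have v1 : vr (alf (ent S.nb u0 u1)) (alf (ent S.nb u0 z0)) (rest.getLastD fk) = false := by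
      rw [Bool.eq_false_iff, Ne, vr_iff, ← G.val hu01, ← G.val hu0z, hlastval, Y.alsymm (g (-1)), e0]
      exact Y.vrule (G.adj hu01) (G.adj hu0z) a0 (G.hne hu01 hu0z hne0) n01.symm hz0.symm
    have v2 : vr (alf (ent S.nb uk uj)) (alf (ent S.nb uk zk)) fk = false := by
      rw [Bool.eq_false_iff, Ne, vr_iff, ← G.val hukj, ← G.val hukz, hfk, ek]
      exact Y.vrule (G.adj hukj) (G.adj hukz) ak (G.hne hukj hukz hnek) nkj.symm hzk.symm
    rw [v1, v2] at h
    simp only [Bool.or_false, cond_false] at h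
    cases rest with
    | nil =>
      simp only [List.length_nil] at hrl
      have hnk : n = k + 1 := by omega
      have eg0 : g (k + 1) = ι u0 := by rw [← e0, ← hper 0]; congr 1; rw [hnk]; push_cast; ring
      have egk : g (-1) = ι uk := by rw [← ek, ← hper (-1)]; congr 1; rw [hnk]; push_cast; ring
      simp only at h
      cases hc : Nat.beq z0 uk
      swap
      · rw [beq_iff] at hc
        exact absurd (by rw [hc]; exact egk) hz0
      · rw [hc, cond_false] at h
        simp only [Option.some.injEq] at h
        subst h
        refine ⟨ι, _, List.mem_singleton.2 rfl, ?_⟩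
        have G1 := G.insert (b := fk) (show 2 < 3 by omega) hu0 huk (by omega) hs0 (by rw [← egk]; exact a0)
          (by rw [← egk, ← e0, Y.alsymm]; exact hlastval.symm) (by
            intro j y c hj hc
            rcases two_slots hs0 (has_spec hu01) (has_spec hu0z) hne0 hj hc with rfl | rfl
            · rw [← egk]; exact n01.symm
            · rw [← egk]; exact hz0.symm)
        have G2 := G1.insert (b := fk) (u := uk) (x := u0) (show 2 < 3 by omega) huk hu0 (by simp only; omega)
          (by simp only; rw [byt_ins_ne (code_lt _ (by omega)) (by omega)]; exact hsk)
          (by rw [← eg0]; exact ak)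
          (by rw [hfk, ek, eg0]) (by
            intro j y c hj hc
            simp only at hc
            rw [byt_ins_ne (code_lt _ (by omega)) (by omega)] at hc
            rcases two_slots hsk (has_spec hukj) (has_spec hukz) hnek hj hc with rfl | rfl
            · rw [← eg0]; exact nkj.symm
            · rw [← eg0]; exact hzk.symm)
        exact G2.addFace (m := mask p) hg (by omega) hpN (fun i hi => (hp i hi).symm)
    | cons b t =>
      simp only [Option.some.injEq] at h
      subst h
      simp only [List.length_cons] at hrl
      let ι' : ℕ → W := fun y => if y < S.N then ι y else g (k + 1 + ((y - S.N : ℕ) : ℤ))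
      have hι : ∀ x < S.N, ι' x = ι x := fun x hx => if_pos hx
      have hι2 : ∀ i, ι' (S.N + i) = g (k + 1 + (i : ℤ)) := fun i => by
        simp only [ι']; rw [if_neg (by omega)]; congr 3; omega
      refine ⟨ι', _, List.mem_singleton.2 rfl, ?_⟩
      have elast : ι' (S.N + t.length) = g (-1) := by
        rw [hι2, ← hper (-1)]; congr 1; rw [← hpatl, ← hrl]; push_cast; ring
      have efirst : ι' (S.N + 0) = g (k + 1) := by
        rw [hι2]; simp
      have G0 : Good Y ι' ⟨S.N + (b :: t).length, S.nb, S.fs⟩ := G.extend (by omega) hι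
      have hM : S.N + (b :: t).length ≤ 126 := by simp only [List.length_cons]; omega
      have x0 : ι' u0 = ι u0 := hι _ hu0
      have xk : ι' uk = ι uk := hι _ huk
      have lt1 := (G.nbr (has_spec hu01)).1
      have lt2 := (G.nbr (has_spec hu0z)).1
      have lt3 := (G.nbr (has_spec hukj)).1
      have lt4 := (G.nbr (has_spec hukz)).1
      have G1 := G0.insert (b := (b :: t).getLastD fk) (u := u0) (x := S.N + t.length) (show 2 < 3 by omega)
        (by simp only; omega) (by simp only [List.length_cons]; omega) hM hs0
        (by rw [elast, x0]; exact a0)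
        (by rw [elast, x0, ← e0, Y.alsymm]; exact hlastval.symm) (by
          intro j y c hj hc
          rcases two_slots hs0 (has_spec hu01) (has_spec hu0z) hne0 hj hc with rfl | rfl
          · rw [elast, hι _ lt1]; exact n01.symm
          · rw [elast, hι _ lt2]; exact hz0.symm)
      have G2 := G1.insert (b := fk) (u := uk) (x := S.N + 0) (show 2 < 3 by omega)
        (by simp only; omega) (by simp only [List.length_cons]; omega) hM
        (by simp only; rw [byt_ins_ne (code_lt _ (by omega)) (by omega)]; exact hsk)
        (by rw [efirst, xk]; exact ak)
        (by rw [efirst, xk, hfk, ek]) (by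
          intro j y c hj hc
          simp only at hc
          rw [byt_ins_ne (code_lt _ (by omega)) (by omega)] at hc
          rcases two_slots hsk (has_spec hukj) (has_spec hukz) hnek hj hc with rfl | rfl
          · rw [efirst, hι _ lt3]; exact nkj.symm
          · rw [efirst, hι _ lt4]; exact hzk.symm)
      have G3 := rows_good hg hM (last := u0) (by omega) (b :: t) _ uk S.N fk (k + 1) G2 (by omega) (le_refl _)
        (by
          intro j hj
          simp only
          rw [byt_ins_ne (code_lt _ (by omega)) (by omega), byt_ins_ne (code_lt _ (by omega)) (by omega)]
          by_contra hne
          have := (G.cod j hne).1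
          omega)
        (by rw [xk, ← ek]; congr 1; ring)
        (fun i hi => hι2 i)
        (by rw [x0, ← e0, ← hper 0]; congr 1; rw [← hpatl, ← hrl]; push_cast [List.length_cons]; ring)
        (by rw [hfk]; congr 2; ring)
        (by
          intro i hi
          obtain ⟨h', e⟩ := hrest i hi
          rw [e, hpatg]; congr 2 <;> (push_cast; ring))
      refine G3.addFace (m := mask (p ++ rng S.N (b :: t).length)) (p := p ++ rng S.N (b :: t).length) hg ?_ ?_ ?_
      · rw [rng_eq]; simp only [List.length_append, List.length_range', List.length_cons]; omega
      · intro x hx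
        rw [rng_eq] at hx
        rcases List.mem_append.1 hx with hx | hx
        · have := hpN x hx; simp only; omega
        · rw [List.mem_range'_1] at hx; simp only; omega
      · intro i hi
        simp only [rng_eq] at hi ⊢
        simp only [List.length_append, List.length_range', List.length_cons] at hi
        rw [List.getElem_append]
        split_ifs with h'
        · rw [hι _ (hpN _ (List.getElem_mem _)), hp i h']
        · rw [List.getElem_range', one_mul, hι2]; congr 1; push_cast [Nat.cast_sub (not_lt.1 h')]; rw [hpl]; push_cast; ring

theorem step_good (G : Good Y ι S) {p : List ℕ} {c : List St} (h : step S p = some c) :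
    ∃ ι', ∃ S' ∈ c, Good Y ι' S' := by
  match p, h with
  | [], h => simp [step] at h
  | [_], h => simp [step] at h
  | [_, _], h => simp [step] at h
  | z0 :: u0 :: u1 :: r, h =>
    rw [step] at h
    obtain ⟨hc, h⟩ := bif_none h
    rw [Bool.and_eq_true] at hc
    obtain ⟨h2, hA⟩ := hc
    obtain ⟨hu01, hu0z, hne0⟩ := two_spec h2
    cases hw : walk S.nb S.fs z0 u0 u1 r with
    | none => rw [hw] at h; simp at h
    | some w =>
    obtain ⟨zk, uj, uk⟩ := w
    rw [hw] at h
    simp only at h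
    have : ∃ x, Y.Adj (ι u0) x ∧ x ≠ ι u1 ∧ x ≠ ι z0 := by
      obtain ⟨p, q, r, h1, h2, h3, h4⟩ := Y.cubic (ι u0)
      by_cases hp : p ≠ ι u1 ∧ p ≠ ι z0
      · exact ⟨p, by rw [h4]; simp, hp.1, hp.2⟩
      by_cases hq : q ≠ ι u1 ∧ q ≠ ι z0
      · exact ⟨q, by rw [h4]; simp, hq.1, hq.2⟩
      exact ⟨r, by rw [h4]; simp, by grind, by grind⟩
    obtain ⟨x, hx, hx1, hx2⟩ := this
    obtain ⟨n, g', hg', e0, e1, e2⟩ := Y.ex hx (G.adj hu01) hx1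
    have hg := Y.shift hg' 1
    set g : ℤ → W := fun j => g' (j + 1) with hgdef
    have f0 : g (-1) = x := by simpa [g] using e0
    have f1 : g 0 = ι u0 := by simpa [g] using e1
    have f2 : g 1 = ι u1 := by simpa [g] using e2
    obtain ⟨w1, w2, w3, w4⟩ := walk_good G hg r z0 u0 u1 (-1) (by rw [f0]; exact hx2) (by simpa using f1) (by simpa using f2) hw
    obtain ⟨c', hc, hc'⟩ := opts_mem h (Y.pat hg)
    have hAs := hasAll_spec hA
    obtain ⟨w2a, w2b⟩ := List.getElem?_eq_some_iff.1 w2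
    obtain ⟨w3a, w3b⟩ := List.getElem?_eq_some_iff.1 w3
    have hp : ∀ i (h : i < (u0 :: u1 :: r).length), g i = ι (u0 :: u1 :: r)[i] := by
      intro i hi; rw [← w1 i hi]; congr 1; ring
    obtain ⟨ι', S', hS, hG⟩ := opt_good G (k := Nat.succ r.length) (p := u0 :: u1 :: r) hg (by omega) (by simp) (by
        intro y hy
        rcases List.mem_cons.1 hy with rfl | hy
        · exact G.lt (has_spec hu01)
        · obtain ⟨i, hi, rfl⟩ := List.getElem_of_mem hy
          exact (G.nbr (has_spec (hAs i hi))).1) hp rfl rfl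
      (by simpa using w2b) (by simpa using w3b) (by rw [f0]; exact hx2) (by
        intro e; apply w4; rw [← e]; congr 1; push_cast; ring) h2 (by
        intro i hi
        rw [als_get]
        rw [als_length] at hi
        have h3 := hAs i hi
        rw [← G.val h3, ← hp i (by simp at hi ⊢; omega)]
        have := hp (i + 1) (by simp at hi ⊢; omega)
        rw [List.getElem_cons_succ] at this
        rw [← this]; push_cast; rfl) hc
    exact ⟨ι', S', hc' _ hS, hG⟩
end PartS4

section PartS5
set_option linter.all false
variable {W : Type} {Y : Sys W} {ι : ℕ → W} {S : St}

/-- The graph embeds in the target table `TT b`. -/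
def Res (Y : Sys W) (b : Bool) : Prop := ∃ f : W → ℕ, (∀ a, f a < 60) ∧ Function.Injective f ∧
  ∀ a c, Y.Adj a c → has (TT b) (f a) (f c) = true

theorem closedb_spec {nb : ℕ} : ∀ {N : ℕ}, closedb nb N = true → ∀ u < N, ∀ i < 3,
    byt nb (3 * u + i) ≠ 0 ∧ has nb (Nat.pred (byt nb (3 * u + i) / 2)) u = true
  | 0, _, u, hu, _, _ => by omega
  | N + 1, h, u, hu, i, hi => by
    rw [closedb, Bool.and_eq_true] at h
    by_cases hN : u = N
    · subst hN
      simp only [Bool.and_eq_true, nbeq_iff] at h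
      obtain ⟨⟨⟨⟨⟨⟨h0, h1⟩, h2⟩, h3⟩, h4⟩, h5⟩, -⟩ := h
      interval_cases i
      · exact ⟨h0, h3⟩
      · exact ⟨h1, h4⟩
      · exact ⟨h2, h5⟩
    · exact closedb_spec h.2 u (by omega) i hi

theorem homb_spec {nb T s t : ℕ} : ∀ {N : ℕ}, homb nb T s t N = true → ∀ u < N,
    byt s u < 60 ∧ byt t (byt s u) = u ∧ ∀ i < 3,
      has T (byt s u) (byt s (Nat.pred (byt nb (3 * u + i) / 2))) = true
  | 0, _, u, hu => by omega
  | N + 1, h, u, hu => by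
    rw [homb, Bool.and_eq_true] at h
    by_cases hN : u = N
    · subst hN
      simp only [Bool.and_eq_true, beq_iff, Nat.ble_eq] at h
      obtain ⟨⟨⟨⟨⟨h0, h1⟩, h2⟩, h3⟩, h4⟩, -⟩ := h
      refine ⟨h0, h1, fun i hi => ?_⟩
      interval_cases i
      · exact h2
      · exact h3
      · exact h4
    · exact homb_spec h.2 u (by omega)

theorem closed_nbr (G : Good Y ι S) (hc : closedb S.nb S.N = true) {u : ℕ} (hu : u < S.N) {w : W}
    (hw : Y.Adj (ι u) w) : ∃ x, x < S.N ∧ ι x = w ∧ (∃ i < 3, ∃ b, byt S.nb (3 * u + i) = code x b) ∧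
      has S.nb x u = true := by
  have h := closedb_spec hc u hu
  have key : ∀ i < 3, ∃ x b, byt S.nb (3 * u + i) = code x b ∧ x < S.N ∧ Y.Adj (ι u) (ι x) ∧ has S.nb x u = true := by
    intro i hi
    obtain ⟨h1, h2⟩ := h i hi
    obtain ⟨-, x, b, e⟩ := G.cod _ h1
    have h3 := G.nbr ⟨i, hi, e⟩
    rw [e, code_div] at h2
    exact ⟨x, b, e, h3.1, h3.2.1, h2⟩
  obtain ⟨x0, b0, e0, l0, a0, s0⟩ := key 0 (by omega)
  obtain ⟨x1, b1, e1, l1, a1, s1⟩ := key 1 (by omega)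
  obtain ⟨x2, b2, e2, l2, a2, s2⟩ := key 2 (by omega)
  have n01 := G.li (by omega) (by omega) (by omega) e0 e1
  have n02 := G.li (by omega) (by omega) (by omega) e0 e2
  have n12 := G.li (by omega) (by omega) (by omega) e1 e2
  rcases Y.third a0 a1 a2 n01 n02 n12 hw with rfl | rfl | rfl
  · exact ⟨x0, l0, rfl, ⟨0, by omega, b0, e0⟩, s0⟩
  · exact ⟨x1, l1, rfl, ⟨1, by omega, b1, e1⟩, s1⟩
  · exact ⟨x2, l2, rfl, ⟨2, by omega, b2, e2⟩, s2⟩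

open Classical in
theorem closed_card [Fintype W] (hW : Fintype.card W = 60) (G : Good Y ι S) (hc : closedb S.nb S.N = true) :
    ∃ c, S.N = 60 * c ∧ ∀ w, ((Finset.range S.N).filter (fun u => ι u = w)).card = c := by
  have mono : ∀ w w', Y.Adj w w' → ((Finset.range S.N).filter (fun u => ι u = w)).card ≤
      ((Finset.range S.N).filter (fun u => ι u = w')).card := by
    intro w w' ha
    have : ∀ u, ∃ x, u < S.N → ι u = w → x < S.N ∧ ι x = w' ∧ has S.nb x u = true := by
      intro u
      by_cases h : u < S.N ∧ ι u = w
      · obtain ⟨x, h1, h2, -, h3⟩ := closed_nbr G hc h.1 (w := w') (by rw [h.2]; exact ha)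
        exact ⟨x, fun _ _ => ⟨h1, h2, h3⟩⟩
      · exact ⟨0, fun h1 h2 => absurd ⟨h1, h2⟩ h⟩
    choose φ hφ using this
    refine Finset.card_le_card_of_injOn φ ?_ ?_
    · intro u hu
      simp only [Finset.coe_filter, Finset.mem_range, Set.mem_setOf_eq] at hu ⊢
      obtain ⟨h1, h2, -⟩ := hφ u hu.1 hu.2
      exact ⟨h1, h2⟩
    · intro u hu v hv e
      simp only [Finset.coe_filter, Finset.mem_range, Set.mem_setOf_eq] at hu hv
      obtain ⟨h1, h2, h3⟩ := hφ u hu.1 hu.2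
      obtain ⟨-, -, h6⟩ := hφ v hv.1 hv.2
      by_contra hne
      rw [← e] at h6
      exact G.hne h3 h6 hne (by rw [hu.2, hv.2])
  have hne : Nonempty W := by
    rw [← Fintype.card_pos_iff]; omega
  obtain ⟨w0⟩ := hne
  have hT := Y.conn {w | ((Finset.range S.N).filter (fun u => ι u = w)).card =
      ((Finset.range S.N).filter (fun u => ι u = w0)).card} ⟨w0, rfl⟩ (by
    intro a ha b hab
    simp only [Set.mem_setOf_eq] at ha ⊢
    rw [← ha]
    exact le_antisymm (mono _ _ (Y.symm hab)) (mono _ _ hab))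
  refine ⟨((Finset.range S.N).filter (fun u => ι u = w0)).card, ?_, fun w => ?_⟩
  · have := Finset.card_eq_sum_card_fiberwise (f := ι) (s := Finset.range S.N) (t := Finset.univ) (by simp)
    rw [Finset.card_range] at this
    refine this.trans ?_
    rw [Finset.sum_congr rfl (fun w _ => show _ = ((Finset.range S.N).filter (fun u => ι u = w0)).card from ?_)]
    · simp [hW]
    · have : w ∈ Set.univ := trivial
      rw [← hT] at this; exact this
  · have : w ∈ Set.univ := trivial
    rw [← hT] at this; exact this

theorem leaf_C [Fintype W] (hW : Fintype.card W = 60) (G : Good Y ι S) (hc : closedb S.nb S.N = true)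
    (h : S.N % 60 ≠ 0) : False := by
  obtain ⟨c, h1, -⟩ := closed_card hW G hc
  omega

theorem leaf_I [Fintype W] (hW : Fintype.card W = 60) (G : Good Y ι S) (hc : closedb S.nb S.N = true)
    (h : S.N = 60) {b : Bool} {s t : ℕ} (hh : homb S.nb (TT b) s t 60 = true) : Res Y b := by
  classical
  obtain ⟨c, h1, h2⟩ := closed_card hW G hc
  have hc1 : c = 1 := by omega
  subst hc1
  have : ∀ w, ∃ u, u < 60 ∧ ι u = w := by
    intro w
    have := h2 w
    obtain ⟨u, hu⟩ := Finset.card_pos.1 (by rw [this]; omega : 0 < _)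
    simp only [Finset.mem_filter, Finset.mem_range] at hu
    exact ⟨u, by omega, hu.2⟩
  choose κ hκ hικ using this
  have uni : ∀ u, u < 60 → κ (ι u) = u := by
    intro u hu
    obtain ⟨v, hv⟩ := Finset.card_eq_one.1 (h2 (ι u))
    have m1 : u ∈ (Finset.range S.N).filter (fun x => ι x = ι u) := by simp; omega
    have m2 : κ (ι u) ∈ (Finset.range S.N).filter (fun x => ι x = ι u) := by
      simp [hικ]; have := hκ (ι u); omega
    rw [hv, Finset.mem_singleton] at m1 m2
    exact m2.trans m1.symm
  have hs := homb_spec hh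
  refine ⟨fun w => byt s (κ w), fun a => (hs _ (hκ a)).1, ?_, ?_⟩
  · intro a a' e
    simp only at e
    have := (hs _ (hκ a)).2.1
    rw [e, (hs _ (hκ a')).2.1] at this
    rw [← hικ a, ← hικ a', this]
  · intro a c hac
    obtain ⟨x, hx, rfl, ⟨i, hi, b', e⟩, -⟩ := closed_nbr G hc (u := κ a) (by have := hκ a; omega) (by rw [hικ]; exact hac)
    have := (hs _ (hκ a)).2.2 i hi
    rw [e, code_div] at this
    simp only
    rw [uni x (by omega)]
    exact this

/-! ### Nine alternating hexagons -/

def fim (ι : ℕ → W) (f : ℕ × ℕ × ℕ) : W × W × W := (ι f.1, ι f.2.1, ι f.2.2)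

theorem third_spec {nb b a c d : ℕ} (h : third nb b a c = some d) : three nb b a c d = true := by
  unfold third at h
  revert h
  generalize Nat.pred (Nat.div (byt nb (Nat.mul 3 b)) 2) = x
  generalize Nat.pred (Nat.div (byt nb (Nat.add (Nat.mul 3 b) 1)) 2) = y
  generalize Nat.pred (Nat.div (byt nb (Nat.add (Nat.mul 3 b) 2)) 2) = z
  cases hx : three nb b a c x
  · cases hy : three nb b a c y
    · cases hz : three nb b a c z
      · simp
      · simp only [cond_true, cond_false, Option.some.injEq]; rintro rfl; exact hz
    · simp only [cond_true, cond_false, Option.some.injEq]; rintro rfl; exact hy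
  · simp only [cond_true, Option.some.injEq]; rintro rfl; exact hx

theorem mv_good (G : Good Y ι S) {o : ℕ} {f f' h h' : ℕ × ℕ × ℕ} (e : fim ι f = fim ι f')
    (h1 : mv S o f = some h) (h2 : mv S o f' = some h') : fim ι h = fim ι h' := by
  obtain ⟨a, b, c⟩ := f
  obtain ⟨a', b', c'⟩ := f'
  simp only [fim, Prod.mk.injEq] at e
  obtain ⟨ea, eb, ec⟩ := e
  simp only [mv] at h1 h2
  cases o1 : Nat.beq o 1
  · rw [o1, cond_false] at h1 h2
    cases o2 : Nat.beq o 2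
    · rw [o2, cond_false, Option.some.injEq] at h1 h2
      subst h1 h2
      simp [fim, ea, eb, ec]
    · rw [o2, cond_true] at h1 h2
      cases t1 : third S.nb b a c with
      | none => rw [t1] at h1; simp at h1
      | some d =>
      cases t2 : third S.nb b' a' c' with
      | none => rw [t2] at h2; simp at h2
      | some d' =>
      rw [t1] at h1
      rw [t2] at h2
      simp only [Option.some.injEq] at h1 h2
      subst h1 h2
      simp only [fim, Prod.mk.injEq]
      refine ⟨ea, eb, ?_⟩
      obtain ⟨x1, x2, x3, x4, x5, x6⟩ := three_spec (third_spec t1)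
      obtain ⟨y1, y2, y3, y4, y5, y6⟩ := three_spec (third_spec t2)
      rcases Y.third (G.adj y1) (G.adj y2) (G.adj y3) (G.hne y1 y2 y4) (G.hne y1 y3 y6) (G.hne y2 y3 y5)
        (w := ι d) (by rw [← eb]; exact G.adj x3) with h | h | h
      · exact absurd (h.trans ea.symm).symm (G.hne x1 x3 x6)
      · exact absurd (h.trans ec.symm).symm (G.hne x2 x3 x5)
      · exact h
  · rw [o1, cond_true] at h1 h2
    cases t1 : adv (q3 a b c) a b c S.fs with
    | none => rw [t1] at h1; simp at h1
    | some d =>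
    cases t2 : adv (q3 a' b' c') a' b' c' S.fs with
    | none => rw [t2] at h2; simp at h2
    | some d' =>
    rw [t1] at h1
    rw [t2] at h2
    simp only [Option.some.injEq] at h1 h2
    subst h1 h2
    obtain ⟨n, g, hg, z0, z1, z2, z3⟩ := adv_good G t1
    obtain ⟨n', g', hg', z0', z1', z2', z3'⟩ := adv_good G t2
    obtain ⟨-, rfl⟩ := Y.uniq hg hg' (by rw [z0, z0', ea]) (by rw [z1, z1', eb]) (by rw [z2, z2', ec])
    simp [fim, eb, ec, ← z3, ← z3']

theorem refute_good (G : Good Y ι S) : ∀ (k w : ℕ) (f f' : ℕ × ℕ × ℕ), refute S k w f f' = true →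
    fim ι f ≠ fim ι f'
  | 0, w, f, f', h => by simp [refute] at h
  | k + 1, w, f, f', h => by
    rw [refute] at h
    intro e
    cases hw : Nat.beq w 0
    · rw [hw, cond_false] at h
      cases t1 : mv S (Nat.mod w 4) f with
      | none => rw [t1] at h; simp at h
      | some d =>
      cases t2 : mv S (Nat.mod w 4) f' with
      | none => rw [t1, t2] at h; simp at h
      | some d' =>
      rw [t1, t2] at h
      exact refute_good G k _ _ _ h (mv_good G e t1 t2)
    · rw [hw, cond_true] at h
      apply comd_good G h
      simp only [fim, Prod.mk.injEq] at e
      exact e.2.1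

theorem chkF_spec {f : ℕ × ℕ × ℕ} : ∀ {t : List (ℕ × ℕ × ℕ)} {l : List ℕ}, chkF S f t l = true →
    ∀ g ∈ t, ∃ w, refute S 60 w f g = true
  | [], _, _, g, hg => by simp at hg
  | a :: t, [], h, g, hg => by simp [chkF] at h
  | a :: t, w :: ws, h, g, hg => by
    rw [chkF, Bool.and_eq_true] at h
    rcases List.mem_cons.1 hg with rfl | hg
    · exact ⟨w, h.1⟩
    · exact chkF_spec h.2 g hg

theorem chkG_spec {f : ℕ × ℕ × ℕ} : ∀ {t : List (List ℕ)} {l : List (List ℕ)}, chkG S f t l = true →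
    ∀ E ∈ t, ∀ g ∈ flg E, ∃ w, refute S 60 w f g = true
  | [], _, _, g, hg => by simp at hg
  | a :: t, [], h, g, hg => by simp [chkG] at h
  | a :: t, w :: ws, h, g, hg => by
    rw [chkG, Bool.and_eq_true] at h
    rcases List.mem_cons.1 hg with rfl | hg
    · exact chkF_spec h.1
    · exact chkG_spec h.2 g hg

theorem chkH_spec : ∀ {t : List (List ℕ)} {l : List (List (List ℕ))}, chkH S t l = true →
    t.Pairwise fun E E' => ∀ g ∈ flg E', ∃ w, refute S 60 w (hd3 E) g = true
  | [], _, _ => List.Pairwise.nil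
  | a :: t, [], h => by simp [chkH] at h
  | a :: t, w :: ws, h => by
    rw [chkH, Bool.and_eq_true] at h
    exact List.Pairwise.cons (chkG_spec h.1) (chkH_spec h.2)

theorem flg_spec : ∀ {E : List ℕ} (s : ℕ) (h : s + 2 < E.length),
    (E[s], E[s+1], E[s+2]) ∈ flg E ∧ (E[s+2], E[s+1], E[s]) ∈ flg E
  | [], s, h => by simp at h
  | [_], s, h => by simp at h
  | [_, _], s, h => by simp at h
  | a :: b :: c :: t, s, h => by
    rw [flg]
    rcases s with _ | s
    · simp
    · obtain ⟨h1, h2⟩ := flg_spec (E := b :: c :: t) s (by simpa using h)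
      exact ⟨List.mem_cons_of_mem _ (List.mem_cons_of_mem _ h1), List.mem_cons_of_mem _ (List.mem_cons_of_mem _ h2)⟩

theorem hd3_spec {E : List ℕ} (h : 2 < E.length) : hd3 E = (E[0], E[1], E[2]) := by
  match E, h with
  | a :: b :: c :: t, _ => rfl

theorem Hs_spec {nb : ℕ} : ∀ {fs : List (ℕ × List ℕ)} {E : List ℕ}, E ∈ Hs nb fs → isH nb E = true ∧ ∃ f ∈ fs, f.2 = E
  | [], E, h => by simp [Hs] at h
  | (m, F) :: t, E, h => by
    rw [Hs] at h
    cases hF : isH nb F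
    · rw [hF, cond_false] at h
      obtain ⟨h1, f, hf, h2⟩ := Hs_spec h
      exact ⟨h1, f, List.mem_cons_of_mem _ hf, h2⟩
    · rw [hF, cond_true] at h
      rcases List.mem_cons.1 h with rfl | h
      · exact ⟨hF, (m, E), by simp, rfl⟩
      · obtain ⟨h1, f, hf, h2⟩ := Hs_spec h
        exact ⟨h1, f, List.mem_cons_of_mem _ hf, h2⟩

theorem allT_spec : ∀ {l : List Bool}, allT l = true → ∀ b ∈ l, b = true
  | [], _, b, hb => by simp at hb
  | a :: t, h, b, hb => by
    rw [allT, Bool.and_eq_true] at h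
    rcases List.mem_cons.1 hb with rfl | hb
    · exact h.1
    · exact allT_spec h.2 b hb

theorem per_mul (Y : Sys W) {n : ℕ} {g : ℤ → W} (hg : Y.Face n g) (j c : ℤ) : g (j + c * n) = g j := by
  induction c using Int.induction_on with
  | zero => simp
  | succ i ih => rw [← ih, ← Y.per hg (j + i * n)]; congr 1; push_cast; ring
  | pred i ih => rw [← ih, ← Y.per hg]; congr 1; push_cast; ring

theorem isH_good (G : Good Y ι S) {E : List ℕ} (h : isH S.nb E = true) (hE : ∃ f ∈ S.fs, f.2 = E) :
    E.length = 9 ∧ ∃ g, Y.Face 6 g ∧ (∀ j, Y.al (g j) (g (j + 1)) = true) ∧ ∀ i (h : i < E.length), ι E[i] = g i := by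
  obtain ⟨f, hf, rfl⟩ := hE
  obtain ⟨n, g, hg, hl, -, hi⟩ := G.fs f hf
  generalize f.2 = E at *
  match E, h with
  | a :: t, h =>
    simp only [isH, Bool.and_eq_true, beq_iff] at h
    obtain ⟨⟨h1, h2⟩, h3⟩ := h
    simp only [List.length_cons] at hl
    obtain rfl : n = 6 := by omega
    refine ⟨by simp [h1], g, hg, ?_, hi⟩
    intro j
    have key : ∀ i : ℕ, i < 8 → Y.al (g i) (g (i + 1)) = true := by
      intro i hi8
      have x1 := hasAll_spec h2 i (by omega)
      have x2 := allT_spec h3 _ (List.getElem_mem (n := i) (by rw [als_length]; omega))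
      rw [als_get, ← G.val x1, hi] at x2
      have x3 := hi (i + 1) (by simp; omega)
      simp only [List.getElem_cons_succ] at x3
      rw [x3] at x2
      push_cast at x2
      exact x2
    have hj : j = ((j % 6).toNat : ℤ) + (j / 6) * (6 : ℕ) := by
      have := Int.emod_add_mul_ediv j 6
      have h6 := Int.emod_nonneg j (show (6 : ℤ) ≠ 0 by norm_num)
      rw [Int.toNat_of_nonneg h6]; push_cast; omega
    have k1 := key (j % 6).toNat (by omega)
    have e1 := per_mul Y hg ((j % 6).toNat : ℤ) (j / 6)
    have e2 := per_mul Y hg ((j % 6).toNat + 1 : ℤ) (j / 6)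
    rw [← hj] at e1
    rw [show ((j % 6).toNat + 1 : ℤ) + j / 6 * (6 : ℕ) = j + 1 by omega] at e2
    rw [e1, e2]; exact k1

theorem leaf_B (G : Good Y ι S) {l : List (List (List ℕ))} (h : bigb S l = true) : False := by
  rw [bigb, Bool.and_eq_true, beq_iff] at h
  obtain ⟨hlen, hc⟩ := h
  generalize hL : (Hs S.nb S.fs).reverse.take 9 = L at *
  have hm : ∀ E ∈ L, E ∈ Hs S.nb S.fs := by
    intro E hE
    rw [← hL] at hE
    exact List.mem_reverse.1 (List.mem_of_mem_take hE)
  have hP := List.pairwise_iff_getElem.1 (chkH_spec hc)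
  have hA : ∀ i : Fin 9, ∃ g, (L[i.1]'(by omega)).length = 9 ∧ Y.Face 6 g ∧ (∀ j, Y.al (g j) (g (j + 1)) = true) ∧
      ∀ k (h : k < (L[i.1]'(by omega)).length), ι ((L[i.1]'(by omega))[k]) = g k := by
    intro i
    obtain ⟨h1, h2⟩ := Hs_spec (hm _ (List.getElem_mem (n := i.1) (by omega)))
    obtain ⟨h3, g, h4, h5, h6⟩ := isH_good G h1 h2
    exact ⟨g, h3, h4, h5, h6⟩
  choose g hl hg hal hi using hA
  obtain ⟨i, j, hij, c, h⟩ := Y.hb g (fun i => ⟨hg i, hal i⟩)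
  have hr := hP i j (by omega) (by omega) hij
  have li := hl i
  have lj := hl j
  have fi : fim ι (hd3 (L[i.1]'(by omega))) = (g i 0, g i 1, g i 2) := by
    rw [hd3_spec (by omega)]
    simp only [fim]
    rw [hi i 0 (by omega), hi i 1 (by omega), hi i 2 (by omega)]
    rfl
  have red : ∀ x : ℤ, ∃ s : ℕ, s < 6 ∧ ∀ t, g j (x + t) = g j (s + t) := by
    intro x
    refine ⟨(x % 6).toNat, by omega, fun t => ?_⟩
    have := per_mul Y (hg j) ((x % 6).toNat + t : ℤ) (x / 6)
    rw [← this]; congr 1; push_cast; omega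
  rcases h with h | h
  · obtain ⟨s, hs, es⟩ := red c
    obtain ⟨f1, f2⟩ := flg_spec (E := L[j.1]'(by omega)) s (by omega)
    obtain ⟨w, hw⟩ := hr _ f1
    apply refute_good G _ _ _ _ hw
    rw [fi]
    simp only [fim]
    rw [hi j s (by omega), hi j (s+1) (by omega), hi j (s+2) (by omega), h 0, h 1, h 2, es, es, es]
    push_cast; simp
  · obtain ⟨s, hs, es⟩ := red (c - 2)
    obtain ⟨f1, f2⟩ := flg_spec (E := L[j.1]'(by omega)) s (by omega)
    obtain ⟨w, hw⟩ := hr _ f2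
    apply refute_good G _ _ _ _ hw
    rw [fi]
    simp only [fim]
    have e0 := es 2
    have e1 := es 1
    have e2 := es 0
    rw [hi j s (by omega), hi j (s+1) (by omega), hi j (s+2) (by omega), h 0, h 1, h 2]
    push_cast
    rw [← e0, ← e1, show (s : ℤ) = s + 0 by ring, ← e2]
    ring_nf

theorem good_of_run [Fintype W] (hW : Fintype.card W = 60) : ∀ (cs : List Ct) (l : List St), run cs l = true →
    (∃ S ∈ l, ∃ ι, Good Y ι S) → ∃ b, Res Y b
  | [], l, h, ⟨S, hS, _⟩ => by
    rw [run, List.isEmpty_iff] at h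
    subst h; simp at hS
  | c :: cs, [], h, ⟨S, hS, _⟩ => by simp at hS
  | c :: cs, S :: T, h, ⟨S', hS, ι, G⟩ => by
    have tail : run cs T = true → S' ∈ T → ∃ b, Res Y b := fun h' hm => good_of_run hW cs T h' ⟨S', hm, ι, G⟩
    cases c with
    | P n =>
      rw [run] at h
      cases hs : step S (dec 12 n) with
      | none => rw [hs] at h; simp at h
      | some ch =>
        rw [hs] at h
        rcases List.mem_cons.1 hS with rfl | hS
        · obtain ⟨ι', S'', h1, h2⟩ := step_good G hs
          exact good_of_run hW cs _ h ⟨S'', List.mem_append_left _ h1, ι', h2⟩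
        · exact good_of_run hW cs _ h ⟨S', List.mem_append_right _ hS, ι, G⟩
    | C =>
      rw [run] at h
      simp only [Bool.and_eq_true, nbeq_iff] at h
      rcases List.mem_cons.1 hS with rfl | hS
      · exact absurd (leaf_C hW G h.1.1 h.1.2) id
      · exact tail h.2 hS
    | I b s t =>
      rw [run] at h
      simp only [Bool.and_eq_true, beq_iff] at h
      rcases List.mem_cons.1 hS with rfl | hS
      · exact ⟨b, leaf_I hW G h.1.1.1 h.1.1.2 h.1.2⟩
      · exact tail h.2 hS
    | B l =>
      rw [run] at h
      simp only [Bool.and_eq_true] at h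
      rcases List.mem_cons.1 hS with rfl | hS
      · exact absurd (leaf_B G h.1) id
      · exact tail h.2 hS

theorem runAll_spec : ∀ {L : List (List (List Bool))} {cs : List (List Ct)}, runAll L cs = true → ∀ ps ∈ L,
    startOk ps = true ∧ ∃ c, run c [start ps] = true
  | [], _, _, ps, h => by simp at h
  | a :: t, [], h, ps, hp => by simp [runAll] at h
  | a :: t, c :: cs, h, ps, hp => by
    rw [runAll, Bool.and_eq_true, Bool.and_eq_true] at h
    rcases List.mem_cons.1 hp with rfl | hp
    · exact ⟨h.1.1, c, h.1.2⟩
    · exact runAll_spec h.2 ps hp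
end PartS5

section PartS6
set_option linter.all false
variable {W : Type} {Y : Sys W} {ι : ℕ → W} {S : St}

/-- a pentagonal face with given vertices -/
def FL (Y : Sys W) (a b c d e : W) : Prop :=
  ∃ g, Y.Face 5 g ∧ g 0 = a ∧ g 1 = b ∧ g 2 = c ∧ g 3 = d ∧ g 4 = e

structure Strip (Y : Sys W) (ι : ℕ → W) : Prop where
  f0 : FL Y (ι 0) (ι 1) (ι 2) (ι 3) (ι 4)
  f1 : FL Y (ι 1) (ι 0) (ι 7) (ι 11) (ι 10)
  f2 : FL Y (ι 0) (ι 4) (ι 5) (ι 6) (ι 7)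
  f3 : FL Y (ι 1) (ι 10) (ι 9) (ι 8) (ι 2)
  f4 : FL Y (ι 5) (ι 12) (ι 13) (ι 14) (ι 6)
  f5 : FL Y (ι 9) (ι 17) (ι 15) (ι 16) (ι 8)
  n4 : ι 3 ≠ ι 5
  n7 : ι 11 ≠ ι 6
  n2 : ι 3 ≠ ι 8
  n10 : ι 11 ≠ ι 9
  n5 : ι 4 ≠ ι 12
  n6 : ι 7 ≠ ι 14
  n9 : ι 10 ≠ ι 17
  n8 : ι 2 ≠ ι 16

def pt (Y : Sys W) (a b c d e : W) : List Bool := [Y.al a b, Y.al b c, Y.al c d, Y.al d e, Y.al e a]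

theorem FL.info {a b c d e : W} (h : FL Y a b c d e) :
    (Y.Adj a b ∧ Y.Adj b c ∧ Y.Adj c d ∧ Y.Adj d e ∧ Y.Adj e a) ∧
    (a ≠ b ∧ a ≠ c ∧ a ≠ d ∧ a ≠ e ∧ b ≠ c ∧ b ≠ d ∧ b ≠ e ∧ c ≠ d ∧ c ≠ e ∧ d ≠ e) ∧
    pt Y a b c d e ∈ PENT := by
  obtain ⟨g, hg, rfl, rfl, rfl, rfl, rfl⟩ := h
  have e5 : g 5 = g 0 := by have := Y.per hg 0; simpa using this
  have h4 := Y.fadj hg 4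
  norm_num at h4
  rw [e5] at h4
  refine ⟨⟨Y.fadj hg 0, Y.fadj hg 1, Y.fadj hg 2, Y.fadj hg 3, h4⟩, ?_, ?_⟩
  · have : ∀ i j : ℤ, i < j → j < i + 5 → g i ≠ g j := fun i j => Y.ne_of hg
    refine ⟨?_, ?_, ?_, ?_, ?_, ?_, ?_, ?_, ?_, ?_⟩ <;> exact this _ _ (by norm_num) (by norm_num)
  · have := Y.pat hg
    have e : List.ofFn (fun i : Fin 5 => Y.al (g i) (g (i + 1))) = pt Y (g 0) (g 1) (g 2) (g 3) (g 4) := by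
      simp [List.ofFn_succ, pt]
      norm_num [e5]
    rw [e] at this
    revert this
    generalize hp : pt Y (g 0) (g 1) (g 2) (g 3) (g 4) = p
    have hl : p.length = 5 := by rw [← hp]; rfl
    clear hp
    intro hm
    simp only [PATS, List.mem_cons, List.not_mem_nil, or_false] at hm
    rcases hm with rfl | rfl | rfl | rfl | rfl | rfl | rfl | rfl <;> first | (simp at hl; done) | (simp [PENT]; done)

def pats (Y : Sys W) (ι : ℕ → W) : List (List Bool) :=
  [pt Y (ι 0) (ι 1) (ι 2) (ι 3) (ι 4), pt Y (ι 1) (ι 0) (ι 7) (ι 11) (ι 10),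
   pt Y (ι 0) (ι 4) (ι 5) (ι 6) (ι 7), pt Y (ι 1) (ι 10) (ι 9) (ι 8) (ι 2),
   pt Y (ι 5) (ι 12) (ι 13) (ι 14) (ι 6), pt Y (ι 9) (ι 17) (ι 15) (ι 16) (ι 8)]

theorem nvr (Y : Sys W) {b x y z : W} (hx : Y.Adj b x) (hy : Y.Adj b y) (hz : Y.Adj b z) (h1 : x ≠ y) (h2 : x ≠ z)
    (h3 : y ≠ z) : (!(vr (Y.al b x) (Y.al b y) (Y.al b z))) = true := by
  rw [Bool.not_eq_true', Bool.eq_false_iff, Ne, vr_iff]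
  exact Y.vrule hx hy hz h1 h2 h3

theorem pats_mem (H : Strip Y ι) : pats Y ι ∈ starts := by
  obtain ⟨⟨a00, a01, a02, a03, a04⟩, ⟨b00, b01, b02, b03, b04, b05, b06, b07, b08, b09⟩, p0⟩ := H.f0.info
  obtain ⟨⟨a10, a11, a12, a13, a14⟩, ⟨b10, b11, b12, b13, b14, b15, b16, b17, b18, b19⟩, p1⟩ := H.f1.info
  obtain ⟨⟨a20, a21, a22, a23, a24⟩, ⟨b20, b21, b22, b23, b24, b25, b26, b27, b28, b29⟩, p2⟩ := H.f2.info
  obtain ⟨⟨a30, a31, a32, a33, a34⟩, ⟨b30, b31, b32, b33, b34, b35, b36, b37, b38, b39⟩, p3⟩ := H.f3.info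
  obtain ⟨⟨a40, a41, a42, a43, a44⟩, ⟨b40, b41, b42, b43, b44, b45, b46, b47, b48, b49⟩, p4⟩ := H.f4.info
  obtain ⟨⟨a50, a51, a52, a53, a54⟩, ⟨b50, b51, b52, b53, b54, b55, b56, b57, b58, b59⟩, p5⟩ := H.f5.info
  have hs : ∀ {x y}, Y.Adj x y → Y.Adj y x := fun h => Y.symm h
  have hb : ∀ x y, beqb (Y.al x y) (Y.al y x) = true := fun x y => by rw [beqb_iff, Y.alsymm]
  unfold starts pats
  refine List.mem_flatMap.2 ⟨_, p0, List.mem_flatMap.2 ⟨_, List.mem_filter.2 ⟨p1, ?_⟩,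
    List.mem_flatMap.2 ⟨_, List.mem_filter.2 ⟨p2, ?_⟩, List.mem_flatMap.2 ⟨_, List.mem_filter.2 ⟨p3, ?_⟩,
    List.mem_flatMap.2 ⟨_, List.mem_filter.2 ⟨p4, ?_⟩, List.mem_map.2 ⟨_, List.mem_filter.2 ⟨p5, ?_⟩, rfl⟩⟩⟩⟩⟩⟩ <;>
    simp only [Bool.and_eq_true, ix, pt, List.getD_cons_zero, List.getD_cons_succ]
  · refine ⟨⟨hb _ _, ?_⟩, ?_⟩
    · rw [Y.alsymm (ι 4) (ι 0)]
      exact nvr Y a00 (hs a04) a11 b06 b11 b26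
    · rw [Y.alsymm (ι 0) (ι 1), Y.alsymm (ι 10) (ι 1)]
      exact nvr Y (hs a00) a01 a30 b01 b16 b36.symm
  · refine ⟨⟨⟨hb _ _, hb _ _⟩, ?_⟩, ?_⟩
    · rw [Y.alsymm (ι 3) (ι 4)]
      exact nvr Y (hs a03) a04 a21 b02.symm H.n4 b21
    · rw [Y.alsymm (ι 0) (ι 7), Y.alsymm (ι 6) (ι 7)]
      exact nvr Y (hs a11) a12 (hs a23) b15 b22 H.n7
  · refine ⟨⟨⟨hb _ _, hb _ _⟩, ?_⟩, ?_⟩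
    · rw [Y.alsymm (ι 1) (ι 2), Y.alsymm (ι 8) (ι 2)]
      exact nvr Y (hs a01) a02 (hs a33) b05 b32 H.n2
    · rw [Y.alsymm (ι 11) (ι 10)]
      exact nvr Y (hs a13) a14 a31 b12.symm H.n10 b31
  · refine ⟨⟨hb _ _, ?_⟩, ?_⟩
    · rw [Y.alsymm (ι 4) (ι 5)]
      exact nvr Y (hs a21) a22 a40 b25 H.n5 b46.symm
    · rw [Y.alsymm (ι 5) (ι 6), Y.alsymm (ι 14) (ι 6)]
      exact nvr Y (hs a22) a23 (hs a43) b28 b42 H.n6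
  · refine ⟨⟨hb _ _, ?_⟩, ?_⟩
    · rw [Y.alsymm (ι 10) (ι 9)]
      exact nvr Y (hs a31) a32 a50 b35 H.n9 b56.symm
    · rw [Y.alsymm (ι 9) (ι 8), Y.alsymm (ι 16) (ι 8)]
      exact nvr Y (hs a32) a33 (hs a53) b38 b52 H.n8

theorem EA_pats (H : Strip Y ι) : ∀ y ∈ EA stripF (pats Y ι), Y.Adj (ι y.1) (ι y.2.1) ∧ Y.al (ι y.1) (ι y.2.1) = y.2.2
    ∧ y.1 < 18 ∧ y.2.1 < 18 ∧ ∃ F ∈ stripF, ∃ i < 5, F.getD i 0 = y.1 ∧ F.getD ((i + 1) % 5) 0 = y.2.1 := by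
  obtain ⟨⟨a00, a01, a02, a03, a04⟩, -, -⟩ := H.f0.info
  obtain ⟨⟨a10, a11, a12, a13, a14⟩, -, -⟩ := H.f1.info
  obtain ⟨⟨a20, a21, a22, a23, a24⟩, -, -⟩ := H.f2.info
  obtain ⟨⟨a30, a31, a32, a33, a34⟩, -, -⟩ := H.f3.info
  obtain ⟨⟨a40, a41, a42, a43, a44⟩, -, -⟩ := H.f4.info
  obtain ⟨⟨a50, a51, a52, a53, a54⟩, -, -⟩ := H.f5.info
  intro y hy
  simp only [EA, stripF, pats, pt, edg, List.headD_cons, List.mem_append, List.mem_cons, List.not_mem_nil, or_false] at hy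
  rcases hy with (h | h | h | h | h) | (h | h | h | h | h) | (h | h | h | h | h) | (h | h | h | h | h) |
    (h | h | h | h | h) | (h | h | h | h | h) <;> subst h <;> (refine ⟨by assumption, rfl, ?_⟩; simp only; decide)

/-- neighbours of a strip label -/
def sn (u x : ℕ) : Bool := stripF.any fun F => (List.range 5).any fun i =>
  (F.getD i 0 == u && F.getD ((i + 1) % 5) 0 == x) || (F.getD i 0 == x && F.getD ((i + 1) % 5) 0 == u)

def nt : List (ℕ × ℕ) := [(3,5),(11,6),(3,8),(11,9),(4,12),(7,14),(10,17),(2,16)]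

def snOk (x y : ℕ) : Bool := (stripF.any fun F => elem x F && elem y F) || nt.any fun p =>
  (Nat.beq p.1 x && Nat.beq p.2 y) || (Nat.beq p.1 y && Nat.beq p.2 x)

theorem sn_pairs' : ((List.range 18).all fun u => (List.range 18).all fun x => (List.range 18).all fun y =>
    !(sn u x && sn u y) || Nat.beq x y || snOk x y) = true := by
  decide +kernel

theorem sn_pairs (u) (hu : u < 18) (x) (hx : x < 18) (h1 : sn u x = true) (y) (hy : y < 18) (h2 : sn u y = true)
    (hxy : x ≠ y) : (∃ F ∈ stripF, x ∈ F ∧ y ∈ F) ∨ (x, y) ∈ nt ∨ (y, x) ∈ nt := by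
  have := List.all_eq_true.1 (List.all_eq_true.1 (List.all_eq_true.1 sn_pairs' u (List.mem_range.2 hu)) x
    (List.mem_range.2 hx)) y (List.mem_range.2 hy)
  rw [h1, h2, Bool.or_eq_true, Bool.or_eq_true, beq_iff] at this
  replace this := this.resolve_left (by simpa using hxy)
  simp only [snOk, Bool.or_eq_true, List.any_eq_true, Bool.and_eq_true, elem_iff, beq_iff] at this
  rcases this with h | ⟨⟨p, q⟩, hp, ⟨rfl, rfl⟩ | ⟨rfl, rfl⟩⟩
  · exact Or.inl h
  · exact Or.inr (Or.inl hp)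
  · exact Or.inr (Or.inr hp)

theorem strip_li (H : Strip Y ι) {u x y : ℕ} (hu : u < 18) (hx : x < 18) (hy : y < 18) (h1 : sn u x = true)
    (h2 : sn u y = true) (hxy : x ≠ y) : ι x ≠ ι y := by
  obtain ⟨-, ⟨b00, b01, b02, b03, b04, b05, b06, b07, b08, b09⟩, p0⟩ := H.f0.info
  obtain ⟨-, ⟨b10, b11, b12, b13, b14, b15, b16, b17, b18, b19⟩, p1⟩ := H.f1.info
  obtain ⟨-, ⟨b20, b21, b22, b23, b24, b25, b26, b27, b28, b29⟩, p2⟩ := H.f2.info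
  obtain ⟨-, ⟨b30, b31, b32, b33, b34, b35, b36, b37, b38, b39⟩, p3⟩ := H.f3.info
  obtain ⟨-, ⟨b40, b41, b42, b43, b44, b45, b46, b47, b48, b49⟩, p4⟩ := H.f4.info
  obtain ⟨-, ⟨b50, b51, b52, b53, b54, b55, b56, b57, b58, b59⟩, p5⟩ := H.f5.info
  obtain ⟨-, -, -, -, -, -, c1, c2, c3, c4, c5, c6, c7, c8⟩ := H
  rcases sn_pairs u hu x hx h1 y hy h2 hxy with ⟨F, hF, hx, hy⟩ | h | h
  · simp only [stripF, List.mem_cons, List.not_mem_nil, or_false] at hF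
    rcases hF with rfl | rfl | rfl | rfl | rfl | rfl <;>
      simp only [List.mem_cons, List.not_mem_nil, or_false] at hx hy <;>
      rcases hx with rfl | rfl | rfl | rfl | rfl <;> rcases hy with rfl | rfl | rfl | rfl | rfl <;>
      first | exact absurd rfl hxy | assumption | (apply Ne.symm; assumption)
  · simp only [nt, List.mem_cons, List.not_mem_nil, or_false, Prod.mk.injEq] at h
    rcases h with ⟨rfl, rfl⟩ | ⟨rfl, rfl⟩ | ⟨rfl, rfl⟩ | ⟨rfl, rfl⟩ | ⟨rfl, rfl⟩ | ⟨rfl, rfl⟩ | ⟨rfl, rfl⟩ | ⟨rfl, rfl⟩ <;> assumption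
  · simp only [nt, List.mem_cons, List.not_mem_nil, or_false, Prod.mk.injEq] at h
    rcases h with ⟨rfl, rfl⟩ | ⟨rfl, rfl⟩ | ⟨rfl, rfl⟩ | ⟨rfl, rfl⟩ | ⟨rfl, rfl⟩ | ⟨rfl, rfl⟩ | ⟨rfl, rfl⟩ | ⟨rfl, rfl⟩ <;>
      (apply Ne.symm; assumption)

theorem okE_spec {l : List (ℕ × ℕ × Bool)} {u e : ℕ} (h : okE l u e = true) (he : e ≠ 0) :
    ∃ y ∈ l, (y.1 = u ∧ code y.2.1 y.2.2 = e) ∨ (y.2.1 = u ∧ code y.1 y.2.2 = e) := by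
  simp only [okE, Bool.or_eq_true, beq_iff, List.any_eq_true, Bool.and_eq_true] at h
  exact h.resolve_left he

theorem nel_spec {x y : ℕ} (h : nel x y = true) : x = 0 ∨ x / 2 ≠ y / 2 := by
  simp only [nel, Bool.or_eq_true, beq_iff, nbeq_iff] at h
  exact h

theorem okS_spec {nb : ℕ} {l : List (ℕ × ℕ × Bool)} : ∀ {N : ℕ}, okS nb l N = true → ∀ u < N,
    (∀ i < 3, okE l u (byt nb (3 * u + i)) = true) ∧
    ∀ i j, i < j → j < 3 → nel (byt nb (3 * u + i)) (byt nb (3 * u + j)) = true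
  | 0, _, u, hu => by omega
  | N + 1, h, u, hu => by
    rw [okS, Bool.and_eq_true] at h
    by_cases hN : u = N
    · subst hN
      simp only [Bool.and_eq_true] at h
      obtain ⟨⟨⟨⟨⟨⟨h0, h1⟩, h2⟩, h3⟩, h4⟩, h5⟩, -⟩ := h
      refine ⟨fun i hi => ?_, fun i j hij hj => ?_⟩
      · interval_cases i
        · exact h0
        · exact h1
        · exact h2
      · interval_cases j
        · omega
        · interval_cases i; exact h3
        · interval_cases i
          · exact h4
          · exact h5
    · exact okS_spec h.2 u (by omega)

theorem byt_big {nb j : ℕ} (h : Nat.shiftRight nb 432 = 0) (hj : 54 ≤ j) : byt nb j = 0 := by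
  have : nb >>> (8 * j) = 0 := by
    have e : 8 * j = 432 + (8 * j - 432) := by omega
    rw [e, Nat.shiftRight_add]
    change Nat.shiftRight nb 432 >>> _ = 0
    rw [h]; simp
  change (nb >>> (8 * j)) &&& 255 = 0
  rw [this]; simp

theorem sn_of {u x : ℕ} (h : ∃ F ∈ stripF, ∃ i < 5, F.getD i 0 = u ∧ F.getD ((i + 1) % 5) 0 = x) :
    sn u x = true ∧ sn x u = true := by
  obtain ⟨F, hF, i, hi, h1, h2⟩ := h
  constructor <;>
  · rw [sn, List.any_eq_true]
    refine ⟨F, hF, ?_⟩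
    rw [List.any_eq_true]
    refine ⟨i, List.mem_range.2 hi, ?_⟩
    rw [h1, h2]; simp

theorem start_good (H : Strip Y ι) (h : startOk (pats Y ι) = true) : Good Y ι (start (pats Y ι)) := by
  rw [startOk, Bool.and_eq_true, beq_iff] at h
  obtain ⟨h1, h2⟩ := h
  have hE := EA_pats H
  have hN : (start (pats Y ι)).N = 18 := rfl
  have key : ∀ u i, i < 3 → byt (start (pats Y ι)).nb (3 * u + i) ≠ 0 → u < 18 ∧ ∃ x b,
      byt (start (pats Y ι)).nb (3 * u + i) = code x b ∧ x < 18 ∧ Y.Adj (ι u) (ι x) ∧ Y.al (ι u) (ι x) = b ∧ sn u x = true := by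
    intro u i hi hne
    have hu : u < 18 := by
      by_contra hu
      exact hne (byt_big h2 (by omega))
    refine ⟨hu, ?_⟩
    obtain ⟨y, hy, ⟨rfl, e⟩ | ⟨rfl, e⟩⟩ := okE_spec ((okS_spec h1 u hu).1 i hi) hne
    · obtain ⟨c1, c2, c3, c4, c5⟩ := hE y hy
      exact ⟨_, _, e.symm, c4, c1, c2, (sn_of c5).1⟩
    · obtain ⟨c1, c2, c3, c4, c5⟩ := hE y hy
      exact ⟨_, _, e.symm, c3, Y.symm c1, by rw [Y.alsymm]; exact c2, (sn_of c5).2⟩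
  refine ⟨?_, ?_, ?_, ?_⟩
  · intro j hj
    have e : j = 3 * (j / 3) + j % 3 := by omega
    rw [e] at hj
    obtain ⟨c1, x, b, c2, -⟩ := key (j / 3) (j % 3) (by omega) hj
    rw [← e] at c2
    exact ⟨by rw [hN]; omega, x, b, c2⟩
  · rintro u x b ⟨i, hi, e⟩
    obtain ⟨c1, x', b', c2, c3, c4, c5, -⟩ := key u i hi (by rw [e]; exact code_ne _ _)
    obtain ⟨rfl, rfl⟩ := code_inj (e.symm.trans c2)
    exact ⟨c3, c4, c5⟩
  · have main : ∀ {u i j x b y c}, i < j → j < 3 → byt (start (pats Y ι)).nb (3 * u + i) = code x b →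
        byt (start (pats Y ι)).nb (3 * u + j) = code y c → ι x ≠ ι y := by
      intro u i j x b y c hij hj e e'
      obtain ⟨c1, x', b', c2, c3, c4, c5, c6⟩ := key u i (by omega) (by rw [e]; exact code_ne _ _)
      obtain ⟨rfl, rfl⟩ := code_inj (e.symm.trans c2)
      obtain ⟨c1', x', b', c2', c3', c4', c5', c6'⟩ := key u j (by omega) (by rw [e']; exact code_ne _ _)
      obtain ⟨rfl, rfl⟩ := code_inj (e'.symm.trans c2')
      refine strip_li H c1 c3 c3' c6 c6' ?_
      rcases nel_spec ((okS_spec h1 u c1).2 i j hij hj) with h | h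
      · rw [e] at h; exact absurd h (code_ne _ _)
      · rw [e, e', code_div, code_div] at h; omega
    intro u i j x b y c hi hj hij e e'
    rcases lt_or_gt_of_ne hij with h | h
    · exact main h hj e e'
    · exact (main h hi e' e).symm
  · intro f hf
    simp only [start, List.mem_map] at hf
    obtain ⟨F, hF, rfl⟩ := hf
    have : F.length = 5 ∧ (∀ x ∈ F, x < 18) ∧ ∃ g, Y.Face 5 g ∧ ∀ i (h : i < F.length), ι F[i] = g i := by
      obtain ⟨g0, hg0, e00, e01, e02, e03, e04⟩ := H.f0
      obtain ⟨g1, hg1, e10, e11, e12, e13, e14⟩ := H.f1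
      obtain ⟨g2, hg2, e20, e21, e22, e23, e24⟩ := H.f2
      obtain ⟨g3, hg3, e30, e31, e32, e33, e34⟩ := H.f3
      obtain ⟨g4, hg4, e40, e41, e42, e43, e44⟩ := H.f4
      obtain ⟨g5, hg5, e50, e51, e52, e53, e54⟩ := H.f5
      simp only [stripF, List.mem_cons, List.not_mem_nil, or_false] at hF
      rcases hF with rfl | rfl | rfl | rfl | rfl | rfl
      · refine ⟨rfl, by decide, g0, hg0, ?_⟩
        intro i hi
        simp only [List.length_cons, List.length_nil] at hi
        interval_cases i
        · exact e00.symm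
        · exact e01.symm
        · exact e02.symm
        · exact e03.symm
        · exact e04.symm
      · refine ⟨rfl, by decide, g1, hg1, ?_⟩
        intro i hi
        simp only [List.length_cons, List.length_nil] at hi
        interval_cases i
        · exact e10.symm
        · exact e11.symm
        · exact e12.symm
        · exact e13.symm
        · exact e14.symm
      · refine ⟨rfl, by decide, g2, hg2, ?_⟩
        intro i hi
        simp only [List.length_cons, List.length_nil] at hi
        interval_cases i
        · exact e20.symm
        · exact e21.symm
        · exact e22.symm
        · exact e23.symm
        · exact e24.symm
      · refine ⟨rfl, by decide, g3, hg3, ?_⟩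
        intro i hi
        simp only [List.length_cons, List.length_nil] at hi
        interval_cases i
        · exact e30.symm
        · exact e31.symm
        · exact e32.symm
        · exact e33.symm
        · exact e34.symm
      · refine ⟨rfl, by decide, g4, hg4, ?_⟩
        intro i hi
        simp only [List.length_cons, List.length_nil] at hi
        interval_cases i
        · exact e40.symm
        · exact e41.symm
        · exact e42.symm
        · exact e43.symm
        · exact e44.symm
      · refine ⟨rfl, by decide, g5, hg5, ?_⟩
        intro i hi
        simp only [List.length_cons, List.length_nil] at hi
        interval_cases i
        · exact e50.symm
        · exact e51.symm
        · exact e52.symm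
        · exact e53.symm
        · exact e54.symm
    obtain ⟨hl, h18, g, hg, hi⟩ := this
    have G0 : Good Y ι ⟨18, 0, []⟩ := by
      have hz : ∀ j, byt 0 j = 0 := fun j => by
        change ((0 : ℕ) >>> (8 * j)) &&& 255 = 0; simp
      refine ⟨fun j hj => absurd (hz j) hj, ?_, ?_, by simp⟩
      · rintro u x b ⟨i, hi, e⟩
        rw [hz] at e; exact absurd e.symm (code_ne _ _)
      · intro u i j x b y c _ _ _ e
        rw [hz] at e; exact absurd e.symm (code_ne _ _)
    exact (G0.addFace (m := mask F) hg hl h18 hi).fs _ (by simp)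

theorem engine [Fintype W] (hW : Fintype.card W = 60) {cs : List (List Ct)} (hrun : runAll starts cs = true)
    (H : Strip Y ι) : ∃ b, Res Y b := by
  obtain ⟨h1, c, h2⟩ := runAll_spec hrun _ (pats_mem H)
  exact good_of_run hW c _ h2 ⟨_, List.mem_singleton.2 rfl, ι, start_good H h1⟩
end PartS6

section PartA1
set_option linter.all false
variable {V : Type} [Fintype V] [DecidableEq V]

/-- `g` is a cyclic parametrization of the face `f`. -/
structure FaceOf (P : PlaneGraph V) (f : Finset (Sym2 V)) (n : ℕ) (g : ℤ → V) : Prop where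
  size : n = 5 ∨ n = 6
  per : ∀ j, g (j + n) = g j
  inj : ∀ i j, g i = g j → (n : ℤ) ∣ i - j
  mem : f ∈ P.faces
  card : f.card = n
  edge : ∀ e, e ∈ f ↔ ∃ j, e = s(g j, g (j + 1))

theorem cyc_param {G : SimpleGraph V} {v : V} {c : G.Walk v v} (hc : c.IsCycle) :
    ∃ g : ℤ → V, (∀ j, g (j + c.length) = g j) ∧ (∀ i j, g i = g j → (c.length : ℤ) ∣ i - j) ∧
      (∀ e, e ∈ c.edges ↔ ∃ j, e = s(g j, g (j + 1))) := by
  have h3 := hc.three_le_length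
  set n := c.length with hn
  have hpos : (0 : ℤ) < n := by omega
  refine ⟨fun j => c.getVert (j % n).toNat, ?_, ?_, ?_⟩
  · intro j; simp
  · intro i j h
    have hi := Int.emod_nonneg i hpos.ne'
    have hj := Int.emod_nonneg j hpos.ne'
    have hi' := Int.emod_lt_of_pos i hpos
    have hj' := Int.emod_lt_of_pos j hpos
    have := hc.getVert_injOn' (show (i % n).toNat ≤ c.length - 1 by omega)
      (show (j % n).toNat ≤ c.length - 1 by omega) h
    exact Int.dvd_of_emod_eq_zero (Int.emod_emod_of_dvd _ (dvd_refl _) ▸ by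
      rw [Int.sub_emod]; rw [show i % n = j % n by omega]; simp)
  · intro e
    have key : e ∈ c.edges ↔ ∃ i < n, e = s(c.getVert i, c.getVert (i + 1)) := by
      constructor
      · intro he
        obtain ⟨i, hi, rfl⟩ := List.getElem_of_mem he
        rw [SimpleGraph.Walk.length_edges] at hi
        exact ⟨i, hi, SimpleGraph.Walk.getElem_edges _⟩
      · rintro ⟨i, hi, rfl⟩
        have : i < c.edges.length := by rw [SimpleGraph.Walk.length_edges]; exact hi
        have h2 := List.getElem_mem this
        rwa [SimpleGraph.Walk.getElem_edges] at h2
    rw [key]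
    have step : ∀ j : ℤ, c.getVert ((j + 1) % n).toNat = c.getVert ((j % n).toNat + 1) := by
      intro j
      have hi := Int.emod_nonneg j hpos.ne'
      have hi' := Int.emod_lt_of_pos j hpos
      rcases eq_or_lt_of_le (show j % n + 1 ≤ n by omega) with h | h
      · have : (j + 1) % n = 0 := by rw [← Int.emod_add_emod, h]; simp
        rw [this, show (j % n).toNat + 1 = c.length by omega]; simp
      · have : (j + 1) % n = j % n + 1 := by
          rw [← Int.emod_add_emod, Int.emod_eq_of_lt (by omega) h]
        rw [this]; congr 1; omega
    constructor
    · rintro ⟨i, hi, rfl⟩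
      refine ⟨i, ?_⟩
      show _ = s(c.getVert ((i:ℤ) % n).toNat, c.getVert (((i:ℤ) + 1) % n).toNat)
      rw [step, Int.emod_eq_of_lt (by omega) (by omega)]; simp
    · rintro ⟨j, rfl⟩
      have hi := Int.emod_nonneg j hpos.ne'
      have hi' := Int.emod_lt_of_pos j hpos
      refine ⟨(j % n).toNat, by omega, ?_⟩
      show s(_, c.getVert ((j + 1) % n).toNat) = _
      rw [step]

theorem exists_param {P : PlaneGraph V} (hF : IsFullerene P) {f} (hf : f ∈ P.faces) :
    ∃ g, FaceOf P f f.card g := by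
  obtain ⟨v, c, hc, rfl⟩ := P.face_cycle f hf
  obtain ⟨g, h1, h2, h3⟩ := cyc_param hc
  have : c.edges.toFinset.card = c.length := by
    rw [List.toFinset_card_of_nodup hc.isCircuit.isTrail.edges_nodup, SimpleGraph.Walk.length_edges]
  refine ⟨g, hF.faceSize _ hf, ?_, ?_, hf, rfl, ?_⟩
  · rw [this]; exact h1
  · rw [this]; exact h2
  · intro e; rw [List.mem_toFinset]; exact h3 e

namespace FaceOf
variable {P : PlaneGraph V} {f : Finset (Sym2 V)} {n : ℕ} {g : ℤ → V}

theorem adj (h : FaceOf P f n g) (j) : P.graph.Adj (g j) (g (j + 1)) :=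
  P.face_edges f h.mem _ ((h.edge _).2 ⟨j, rfl⟩)

theorem shift (h : FaceOf P f n g) (c : ℤ) : FaceOf P f n (fun j => g (j + c)) where
  size := h.size
  per j := by show g (j + n + c) = _; rw [← h.per (j + c)]; congr 1; ring
  inj i j e := by have := h.inj _ _ e; simpa using this
  mem := h.mem
  card := h.card
  edge e := by
    rw [h.edge]
    constructor
    · rintro ⟨j, rfl⟩
      exact ⟨j - c, by show _ = s(g (j - c + c), g (j - c + 1 + c)); congr 2 <;> ring⟩
    · rintro ⟨j, rfl⟩
      exact ⟨j + c, by show s(g (j + c), g (j + 1 + c)) = _; rw [show j + 1 + c = j + c + 1 by ring]⟩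

theorem rev (h : FaceOf P f n g) : FaceOf P f n (fun j => g (-j)) where
  size := h.size
  per j := by show g (-(j + n)) = g (-j); rw [← h.per (-(j+n))]; congr 1; ring
  inj i j e := by obtain ⟨k, hk⟩ := h.inj _ _ e; exact ⟨-k, by rw [mul_neg, ← hk]; ring⟩
  mem := h.mem
  card := h.card
  edge e := by
    rw [h.edge]
    constructor
    · rintro ⟨j, rfl⟩
      exact ⟨-j - 1, by show _ = s(g (-(-j-1)), g (-(-j - 1 + 1))); rw [Sym2.eq_swap]; congr 2 <;> ring⟩
    · rintro ⟨j, rfl⟩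
      exact ⟨-j - 1, by show s(g (-j), g (-(j + 1))) = _; rw [Sym2.eq_swap]; congr 2 <;> ring⟩

theorem ne_of (h : FaceOf P f n g) {i j : ℤ} (hij : ¬ ((n : ℤ) ∣ i - j)) : g i ≠ g j :=
  fun e => hij (h.inj _ _ e)

theorem ne_pm (h : FaceOf P f n g) (j : ℤ) : g (j - 1) ≠ g (j + 1) := by
  apply h.ne_of; rcases h.size with rfl | rfl <;> omega

theorem ne_two (h : FaceOf P f n g) (j : ℤ) : g j ≠ g (j + 2) := by
  apply h.ne_of; rcases h.size with rfl | rfl <;> omega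

theorem congr_dvd (h : FaceOf P f n g) {i j : ℤ} (hij : (n : ℤ) ∣ i - j) : g i = g j := by
  obtain ⟨k, hk⟩ := hij
  have key : ∀ (m : ℕ) (t : ℤ), g (t + n * m) = g t := by
    intro m; induction m with
    | zero => intro t; simp
    | succ m ih => intro t; rw [← ih t, ← h.per (t + n * m)]; congr 1; push_cast; ring
  obtain ⟨m, rfl | rfl⟩ := Int.eq_nat_or_neg k
  · rw [← key m j]; congr 1; linarith
  · rw [← key m i]; congr 1; linarith

/-- the edges of `f` at the vertex `g j` -/
theorem at_iff (h : FaceOf P f n g) (j : ℤ) (x : V) :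
    s(g j, x) ∈ f ↔ x = g (j - 1) ∨ x = g (j + 1) := by
  rw [h.edge]
  constructor
  · rintro ⟨i, hi⟩
    rw [Sym2.eq_iff] at hi
    rcases hi with ⟨h1, rfl⟩ | ⟨h1, rfl⟩
    · right; apply h.congr_dvd; obtain ⟨k, hk⟩ := h.inj _ _ h1; exact ⟨-k, by rw [mul_neg, ← hk]; ring⟩
    · left; apply h.congr_dvd; obtain ⟨k, hk⟩ := h.inj _ _ h1; exact ⟨-k, by rw [mul_neg, ← hk]; ring⟩
  · rintro (rfl | rfl)
    · exact ⟨j - 1, by rw [Sym2.eq_swap]; congr 2 <;> ring⟩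
    · exact ⟨j, rfl⟩

theorem edge_iff (h : FaceOf P f n g) (a x : V) :
    s(a, x) ∈ f ↔ ∃ j, a = g j ∧ (x = g (j - 1) ∨ x = g (j + 1)) := by
  constructor
  · intro hh
    obtain ⟨j, hj⟩ := (h.edge _).1 hh
    rw [Sym2.eq_iff] at hj
    rcases hj with ⟨rfl, rfl⟩ | ⟨rfl, rfl⟩
    · exact ⟨j, rfl, Or.inr rfl⟩
    · exact ⟨j + 1, rfl, Or.inl (by congr 1; ring)⟩
  · rintro ⟨j, rfl, hx⟩; exact (h.at_iff j x).2 hx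

theorem verts (h : FaceOf P f n g) (v : V) : v ∈ edgeVerts f ↔ ∃ j, v = g j := by
  simp only [edgeVerts, Finset.mem_filter, Finset.mem_univ, true_and]
  constructor
  · rintro ⟨e, he, hv⟩
    obtain ⟨j, rfl⟩ := (h.edge e).1 he
    rcases Sym2.mem_iff.1 hv with rfl | rfl
    · exact ⟨j, rfl⟩
    · exact ⟨_, rfl⟩
  · rintro ⟨j, rfl⟩
    exact ⟨_, (h.edge _).2 ⟨j, rfl⟩, Sym2.mem_mk_left _ _⟩

theorem uniq2 {n' : ℕ} {g' : ℤ → V} (h : FaceOf P f n g) (h' : FaceOf P f n' g')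
    (h0 : g 0 = g' 0) (h1 : g 1 = g' 1) : n = n' ∧ g = g' := by
  refine ⟨h.card.symm.trans h'.card, ?_⟩
  have fwd : ∀ j, g j = g' j → g (j + 1) = g' (j + 1) → g (j + 2) = g' (j + 2) := by
    intro j e0 e1
    have := (h.at_iff (j + 1) (g (j + 2))).2 (Or.inr (by congr 1; ring))
    rw [e1, h'.at_iff] at this
    rcases this with h2 | h2
    · exfalso; apply h.ne_two j; rw [e0, h2]; congr 1; ring
    · rw [h2]; congr 1; ring
  have bwd : ∀ j, g j = g' j → g (j + 1) = g' (j + 1) → g (j - 1) = g' (j - 1) := by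
    intro j e0 e1
    have := (h.at_iff j (g (j - 1))).2 (Or.inl rfl)
    rw [e0, h'.at_iff] at this
    rcases this with h2 | h2
    · exact h2
    · exfalso; apply h.ne_pm j; rw [e1, h2]
  have key : ∀ j : ℤ, g j = g' j ∧ g (j + 1) = g' (j + 1) := by
    intro j
    induction j using Int.induction_on with
    | zero => exact ⟨h0, by simpa using h1⟩
    | succ i ih => exact ⟨ih.2, by rw [add_assoc]; exact fwd _ ih.1 ih.2⟩
    | pred i ih => exact ⟨bwd _ ih.1 ih.2, by rw [sub_add_cancel]; exact ih.1⟩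
  exact funext fun j => (key j).1

theorem same {n' : ℕ} {g' : ℤ → V} (h : FaceOf P f n g) (h' : FaceOf P f n' g') :
    ∃ c : ℤ, (∀ t, g t = g' (c + t)) ∨ (∀ t, g t = g' (c - t)) := by
  have := (h.edge _).2 ⟨0, rfl⟩
  obtain ⟨i, hi, hx⟩ := (h'.edge_iff _ _).1 this
  refine ⟨i, ?_⟩
  rcases hx with hx | hx
  · right
    have := (h.uniq2 (((h'.shift i).rev)) (by simpa using hi) (by
      show g 1 = g' (-1 + i); rw [show (1:ℤ) = 0 + 1 by ring, hx]; congr 1; ring)).2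
    intro t; rw [this]; show g' (-t + i) = _; congr 1; ring
  · left
    have := (h.uniq2 (h'.shift i) (by simpa using hi) (by
      show g 1 = g' (1 + i); rw [show (1:ℤ) = 0 + 1 by ring, hx]; congr 1; ring)).2
    intro t; rw [this]; show g' (t + i) = _; congr 1; ring

end FaceOf

/-! ### Vertices and corners -/
section
variable {P : PlaneGraph V} (hF : IsFullerene P)

theorem cubic' (hF : IsFullerene P) (b : V) : ∃ x y z, x ≠ y ∧ x ≠ z ∧ y ≠ z ∧
    ∀ w, P.graph.Adj b w ↔ (w = x ∨ w = y ∨ w = z) := by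
  obtain ⟨x, y, z, h1, h2, h3, h⟩ := Set.ncard_eq_three.1 (hF.cubic b)
  refine ⟨x, y, z, h1, h2, h3, fun w => ?_⟩
  have : w ∈ P.graph.neighborSet b ↔ _ := Set.ext_iff.1 h w
  simpa using this

theorem third' (hF : IsFullerene P) {b x y : V} (hx : P.graph.Adj b x) (hy : P.graph.Adj b y) (hxy : x ≠ y) :
    ∃ z, z ≠ x ∧ z ≠ y ∧ P.graph.Adj b z ∧ ∀ w, P.graph.Adj b w ↔ (w = x ∨ w = y ∨ w = z) := by
  obtain ⟨p, q, r, h1, h2, h3, h⟩ := cubic' hF b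
  rw [h] at hx hy
  have : (x ≠ p ∧ y ≠ p) ∨ (x ≠ q ∧ y ≠ q) ∨ (x ≠ r ∧ y ≠ r) := by grind
  rcases this with ⟨a1, a2⟩ | ⟨a1, a2⟩ | ⟨a1, a2⟩
  · exact ⟨p, a1.symm, a2.symm, (h _).2 (Or.inl rfl), fun w => by rw [h]; grind⟩
  · exact ⟨q, a1.symm, a2.symm, (h _).2 (Or.inr (Or.inl rfl)), fun w => by rw [h]; grind⟩
  · exact ⟨r, a1.symm, a2.symm, (h _).2 (Or.inr (Or.inr rfl)), fun w => by rw [h]; grind⟩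

theorem edge_two (P : PlaneGraph V) {a b : V} (h : P.graph.Adj a b) :
    ∃ f₁ f₂, f₁ ≠ f₂ ∧ ∀ f, (f ∈ P.faces ∧ s(a, b) ∈ f) ↔ (f = f₁ ∨ f = f₂) := by
  obtain ⟨f₁, f₂, h1, h2⟩ := Finset.card_eq_two.1 (P.edge_faces s(a, b) h)
  refine ⟨f₁, f₂, h1, fun f => ?_⟩
  have := Finset.ext_iff.1 h2 f
  simpa using this

theorem face_at (hF : IsFullerene P) {f} (hf : f ∈ P.faces) {b x y z : V} (hx : s(b, x) ∈ f)
    (h1 : x ≠ y) (h2 : x ≠ z) (h3 : y ≠ z)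
    (hn : ∀ w, P.graph.Adj b w ↔ (w = x ∨ w = y ∨ w = z)) :
    (s(b, y) ∈ f ∧ s(b, z) ∉ f) ∨ (s(b, y) ∉ f ∧ s(b, z) ∈ f) := by
  obtain ⟨g, hg⟩ := exists_param hF hf
  obtain ⟨j, rfl, hj⟩ := (hg.edge_iff _ _).1 hx
  have hp := hg.ne_pm j
  have hm : P.graph.Adj (g j) (g (j - 1)) := by
    have := (hg.adj (j - 1)).symm; rwa [sub_add_cancel] at this
  have hm' := hg.adj j
  rw [hn] at hm hm'
  simp only [hg.at_iff]
  grind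

theorem corner_ex (hF : IsFullerene P) {a b c : V} (ha : P.graph.Adj b a) (hc : P.graph.Adj b c)
    (hac : a ≠ c) : ∃ f ∈ P.faces, s(b, a) ∈ f ∧ s(b, c) ∈ f := by
  obtain ⟨z, hza, hzc, hz, hn⟩ := third' hF ha hc hac
  obtain ⟨f₁, f₂, h12, h⟩ := edge_two P ha
  obtain ⟨f₃, f₄, h34, h'⟩ := edge_two P hc
  obtain ⟨f₅, f₆, h56, h''⟩ := edge_two P hz
  by_contra hcon
  push Not at hcon
  have hn2 : ∀ w, P.graph.Adj b w ↔ (w = c ∨ w = a ∨ w = z) := fun w => by rw [hn]; tauto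
  have F1 := (h f₁).2 (Or.inl rfl)
  have F2 := (h f₂).2 (Or.inr rfl)
  have F3 := (h' f₃).2 (Or.inl rfl)
  have A1 := face_at hF F1.1 F1.2 hac hza.symm hzc.symm hn
  have A2 := face_at hF F2.1 F2.2 hac hza.symm hzc.symm hn
  have A3 := face_at hF F3.1 F3.2 hac.symm hzc.symm hza.symm hn2
  have B1 := hcon f₁ F1.1 F1.2
  have B2 := hcon f₂ F2.1 F2.2
  have B3 : s(b, a) ∉ f₃ := fun q => hcon f₃ F3.1 q F3.2
  have C1 : f₁ = f₅ ∨ f₁ = f₆ := (h'' f₁).1 ⟨F1.1, by tauto⟩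
  have C2 : f₂ = f₅ ∨ f₂ = f₆ := (h'' f₂).1 ⟨F2.1, by tauto⟩
  have C3 : f₃ = f₅ ∨ f₃ = f₆ := (h'' f₃).1 ⟨F3.1, by tauto⟩
  have D3 : f₃ ≠ f₁ := fun q => B3 (q ▸ F1.2)
  have D4 : f₃ ≠ f₂ := fun q => B3 (q ▸ F2.2)
  grind

theorem corner_uniq (hF : IsFullerene P) {a b c : V} (hac : a ≠ c) {f f'} (hf : f ∈ P.faces)
    (hf' : f' ∈ P.faces) (h1 : s(b, a) ∈ f) (h2 : s(b, c) ∈ f) (h3 : s(b, a) ∈ f') (h4 : s(b, c) ∈ f') :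
    f = f' := by
  have ha : P.graph.Adj b a := P.face_edges _ hf _ h1
  have hc : P.graph.Adj b c := P.face_edges _ hf _ h2
  obtain ⟨z, hza, hzc, hz, hn⟩ := third' hF ha hc hac
  obtain ⟨f₁, f₂, h12, h⟩ := edge_two P ha
  obtain ⟨f₃, f₄, h34, h'⟩ := edge_two P hc
  obtain ⟨f₅, f₆, h56, h''⟩ := edge_two P hz
  have hn2 : ∀ w, P.graph.Adj b w ↔ (w = z ∨ w = a ∨ w = c) := fun w => by rw [hn]; tauto
  have F5 := (h'' f₅).2 (Or.inl rfl)
  have A5 := face_at hF F5.1 F5.2 hza hzc hac hn2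
  have A := face_at hF hf h1 hac hza.symm hzc.symm hn
  have A' := face_at hF hf' h3 hac hza.symm hzc.symm hn
  by_contra hne
  have e1 := (h f).1 ⟨hf, h1⟩
  have e2 := (h f').1 ⟨hf', h3⟩
  have e3 := (h' f).1 ⟨hf, h2⟩
  have e4 := (h' f').1 ⟨hf', h4⟩
  have d1 : f₅ ≠ f := by rintro rfl; tauto
  have d2 : f₅ ≠ f' := by rintro rfl; tauto
  have := h f₅
  have := h' f₅
  grind

theorem face_conn (hF : IsFullerene P) (T : Set V) (hT : T.Nonempty)
    (h : ∀ a ∈ T, ∀ b, P.graph.Adj a b → b ∈ T) : T = Set.univ := by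
  have hc := hF.threeConnected ∅ (by simp)
  obtain ⟨a, ha⟩ := hT
  ext b
  simp only [Set.mem_univ, iff_true]
  obtain ⟨w⟩ := hc.preconnected ⟨a, by simp⟩ ⟨b, by simp⟩
  have : ∀ (x y : (∅ᶜ : Set V)) (w : (SimpleGraph.induce ∅ᶜ P.graph).Walk x y), (x : V) ∈ T → (y : V) ∈ T := by
    intro x y w
    induction w with
    | nil => exact id
    | cons hadj _ ih => exact fun hx => ih (h _ hx _ hadj)
  exact this _ _ w ha

/-- a face with prescribed corner, parametrized -/
theorem corner_param (hF : IsFullerene P) {a b c : V} (ha : P.graph.Adj b a) (hc : P.graph.Adj b c)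
    (hac : a ≠ c) : ∃ f n g, FaceOf P f n g ∧ g 0 = a ∧ g 1 = b ∧ g 2 = c := by
  obtain ⟨f, hf, h1, h2⟩ := corner_ex hF ha hc hac
  obtain ⟨g, hg⟩ := exists_param hF hf
  obtain ⟨j, rfl, hj⟩ := (hg.edge_iff _ _).1 h1
  have hj2 := (hg.at_iff _ _).1 h2
  rcases hj with hj | hj
  · have hc : c = g (j + 1) := by
      rcases hj2 with h | h
      · exact absurd (hj.trans h.symm) hac
      · exact h
    exact ⟨f, _, _, hg.shift (j - 1), by show g (0 + (j-1)) = _; rw [hj]; congr 1; ring,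
      by show g (1 + (j-1)) = _; congr 1; ring, by show g (2 + (j-1)) = _; rw [hc]; congr 1; ring⟩
  · have hc : c = g (j - 1) := by
      rcases hj2 with h | h
      · exact h
      · exact absurd (hj.trans h.symm) hac
    refine ⟨f, _, _, (hg.shift (j + 1)).rev, ?_, ?_, ?_⟩
    · show g (-0 + (j + 1)) = _; rw [hj]; congr 1; ring
    · show g (-1 + (j + 1)) = _; congr 1; ring
    · show g (-2 + (j + 1)) = _; rw [hc]; congr 1; ring

theorem param_uniq (hF : IsFullerene P) {f f' n n' g g'} (h : FaceOf P f n g) (h' : FaceOf P f' n' g')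
    (h0 : g 0 = g' 0) (h1 : g 1 = g' 1) (h2 : g 2 = g' 2) : f = f' ∧ n = n' ∧ g = g' := by
  have e : f = f' := by
    apply corner_uniq hF (h.ne_two 0) h.mem h'.mem (b := g 1)
    · exact (h.at_iff 1 _).2 (Or.inl rfl)
    · exact (h.at_iff 1 _).2 (Or.inr rfl)
    · rw [h1, h0]; exact (h'.at_iff 1 _).2 (Or.inl rfl)
    · rw [h1, show (0:ℤ) + 2 = 2 by ring, h2]; exact (h'.at_iff 1 _).2 (Or.inr rfl)
  subst e
  exact ⟨rfl, h.uniq2 h' h0 h1⟩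
end
end PartA1

section PartB1
set_option linter.all false
variable {V : Type} [Fintype V] [DecidableEq V]

theorem mem_edgeVerts {E : Finset (Sym2 V)} {v : V} : v ∈ edgeVerts E ↔ ∃ e ∈ E, v ∈ e := by
  simp [edgeVerts]

theorem mem_facesVerts {H : Finset (Finset (Sym2 V))} {v : V} :
    v ∈ facesVerts H ↔ ∃ h ∈ H, v ∈ edgeVerts h := by
  simp only [facesVerts, mem_edgeVerts, Finset.mem_sup, id]
  constructor
  · rintro ⟨e, ⟨h, hh, he⟩, hv⟩; exact ⟨h, hh, e, he, hv⟩
  · rintro ⟨h, hh, e, he, hv⟩; exact ⟨e, ⟨h, hh, he⟩, hv⟩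

/-- A set of disjoint hexagons and a matching avoiding them. -/
structure Half (P : PlaneGraph V) (H : Finset (Finset (Sym2 V))) (M : Finset (Sym2 V)) : Prop where
  hex : ∀ h ∈ H, h ∈ P.faces ∧ h.card = 6
  disj : ∀ f ∈ H, ∀ g ∈ H, f ≠ g → Disjoint (edgeVerts f) (edgeVerts g)
  sub : ∀ e ∈ M, e ∈ P.graph.edgeSet
  mat : IsMatching M
  avoid : ∀ e ∈ M, ∀ v : V, v ∈ e → v ∉ facesVerts H

/-- the edge label -/
def alp (H : Finset (Finset (Sym2 V))) (M : Finset (Sym2 V)) (a b : V) : Bool :=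
  decide (s(a, b) ∈ M ∨ ∃ h ∈ H, s(a, b) ∈ h)

def Exit (M : Finset (Sym2 V)) (f : Finset (Sym2 V)) (v : V) : Prop :=
  v ∈ edgeVerts f ∧ ∃ e ∈ M, v ∈ e ∧ e ∉ f

def Cov (H : Finset (Finset (Sym2 V))) (M : Finset (Sym2 V)) (v : V) : Prop :=
  v ∈ facesVerts H ∨ v ∈ edgeVerts M

theorem alp_symm (H : Finset (Finset (Sym2 V))) (M : Finset (Sym2 V)) (a b : V) :
    alp H M a b = alp H M b a := by unfold alp; rw [Sym2.eq_swap]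

section
variable {P : PlaneGraph V} {H : Finset (Finset (Sym2 V))} {M : Finset (Sym2 V)}

theorem Half.mate (hM : Half P H M) {b : V} (hb : b ∈ edgeVerts M) :
    ∃ z, P.graph.Adj b z ∧ s(b, z) ∈ M ∧ (∀ e ∈ M, b ∈ e → e = s(b, z)) ∧ b ∉ facesVerts H ∧
      z ∉ facesVerts H := by
  obtain ⟨e, he, hbe⟩ := mem_edgeVerts.1 hb
  obtain ⟨z, rfl⟩ := Sym2.mem_iff_exists.1 hbe
  refine ⟨z, hM.sub _ he, he, ?_, hM.avoid _ he _ (Sym2.mem_mk_left _ _), hM.avoid _ he _ (Sym2.mem_mk_right _ _)⟩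
  intro e' he' hb'
  by_contra hne
  exact hM.mat.2 _ he' _ he hne b hb' hbe

theorem Half.alp_mate (hM : Half P H M) {b z : V} (hz : s(b, z) ∈ M) (w : V) :
    alp H M b w = true ↔ w = z := by
  have hb : b ∈ edgeVerts M := mem_edgeVerts.2 ⟨_, hz, Sym2.mem_mk_left _ _⟩
  obtain ⟨z', h1, h2, h3, h4, -⟩ := hM.mate hb
  have : z = z' := by
    have := h3 _ hz (Sym2.mem_mk_left _ _)
    rw [Sym2.eq_iff] at this; rcases this with h | h
    · exact h.2
    · rw [h.2, ← h.1]
  subst this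
  unfold alp
  rw [decide_eq_true_iff]
  constructor
  · rintro (h | ⟨h, hh, he⟩)
    · have := h3 _ h (Sym2.mem_mk_left _ _)
      rw [Sym2.eq_iff] at this; rcases this with h | h
      · exact h.2
      · rw [h.2, ← h.1]
    · exact absurd (mem_facesVerts.2 ⟨h, hh, mem_edgeVerts.2 ⟨_, he, Sym2.mem_mk_left _ _⟩⟩) h4
  · rintro rfl; exact Or.inl hz

theorem Half.alp_hex (hM : Half P H M) {b : V} {h} (hh : h ∈ H) (hb : b ∈ edgeVerts h) (w : V) :
    alp H M b w = true ↔ s(b, w) ∈ h := by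
  unfold alp
  rw [decide_eq_true_iff]
  constructor
  · rintro (h1 | ⟨h', hh', he⟩)
    · exact absurd (mem_facesVerts.2 ⟨h, hh, hb⟩) (hM.avoid _ h1 _ (Sym2.mem_mk_left _ _))
    · by_cases e : h = h'
      · rwa [e]
      · exact absurd (mem_edgeVerts.2 ⟨_, he, Sym2.mem_mk_left _ _⟩)
          (Finset.disjoint_left.1 (hM.disj _ hh _ hh' e) hb)
  · exact fun h1 => Or.inr ⟨h, hh, h1⟩

theorem FaceOf.adj' {f n g} (h : FaceOf P f n g) (j : ℤ) : P.graph.Adj (g j) (g (j - 1)) := by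
  have := (h.adj (j - 1)).symm; rwa [sub_add_cancel] at this

theorem Half.corner (hF : IsFullerene P) (hM : Half P H M) {f n g} (hf : FaceOf P f n g) (hfH : f ∉ H) (j : ℤ)
    (hc : Cov H M (g j)) :
    (¬ (alp H M (g j) (g (j - 1)) = true ∧ alp H M (g j) (g (j + 1)) = true)) ∧
    ((alp H M (g j) (g (j - 1)) = false ∧ alp H M (g j) (g (j + 1)) = false) ↔ Exit M f (g j)) := by
  have hpm := hf.ne_pm j
  have hv : g j ∈ edgeVerts f := (hf.verts _).2 ⟨j, rfl⟩
  rcases hc with hc | hc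
  · obtain ⟨h, hh, hb⟩ := mem_facesVerts.1 hc
    have hx : ¬ Exit M f (g j) := by
      rintro ⟨-, e, he, hve, -⟩
      exact hM.avoid _ he _ hve hc
    have e1 := hM.alp_hex hh hb (g (j - 1))
    have e2 := hM.alp_hex hh hb (g (j + 1))
    obtain ⟨g', hg'⟩ := exists_param hF (hM.hex h hh).1
    obtain ⟨i, hi⟩ := (hg'.verts _).1 hb
    have hne : f ≠ h := fun e => hfH (e ▸ hh)
    have hnot : ¬ (s(g j, g (j - 1)) ∈ h ∧ s(g j, g (j + 1)) ∈ h) := fun q =>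
      hne (corner_uniq hF hpm hf.mem hg'.mem ((hf.at_iff _ _).2 (Or.inl rfl))
        ((hf.at_iff _ _).2 (Or.inr rfl)) q.1 q.2)
    have hp : s(g j, g (j - 1)) ∈ h ∨ s(g j, g (j + 1)) ∈ h := by
      obtain ⟨z, h1, h2, h3, h4⟩ := third' hF (hf.adj' j) (hf.adj j) hpm
      have a1 := hg'.adj' i
      have a2 := hg'.adj i
      have a3 := hg'.ne_pm i
      rw [hi, hg'.at_iff, hg'.at_iff]
      rw [← hi, h4] at a1 a2
      grind
    rw [← Bool.not_eq_true, ← Bool.not_eq_true, e1, e2]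
    tauto
  · obtain ⟨z, hz, hzM, hun, hbH, -⟩ := hM.mate hc
    have hx : Exit M f (g j) ↔ s(g j, z) ∉ f := by
      constructor
      · rintro ⟨-, e, he, hve, hef⟩
        rwa [← hun e he hve]
      · exact fun h => ⟨hv, _, hzM, Sym2.mem_mk_left _ _, h⟩
    rw [hx, hf.at_iff, ← Bool.not_eq_true, ← Bool.not_eq_true, hM.alp_mate hzM, hM.alp_mate hzM]
    grind

theorem Half.exit_uniq (hF : IsFullerene P) (hM : Half P H M) {f f' v} (hf : f ∈ P.faces) (hf' : f' ∈ P.faces)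
    (h : Exit M f v) (h' : Exit M f' v) : f = f' := by
  obtain ⟨h1, e, he, hve, h2⟩ := h
  obtain ⟨h1', e', he', hve', h2'⟩ := h'
  obtain ⟨z, hz, hzM, hun, -⟩ := hM.mate (mem_edgeVerts.2 ⟨e, he, hve⟩)
  rw [hun e he hve] at h2
  rw [hun e' he' hve'] at h2'
  obtain ⟨g, hg⟩ := exists_param hF hf
  obtain ⟨g', hg'⟩ := exists_param hF hf'
  obtain ⟨j, rfl⟩ := (hg.verts _).1 h1
  obtain ⟨i, hi⟩ := (hg'.verts _).1 h1'
  have hpm := hg.ne_pm j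
  have hpm' := hg'.ne_pm i
  have a1 := hg'.adj' i
  have a2 := hg'.adj i
  rw [hg.at_iff] at h2
  rw [hi, hg'.at_iff] at h2'
  obtain ⟨w, w1, w2, w3, w4⟩ := third' hF (hg.adj' j) (hg.adj j) hpm
  rw [← hi] at a1 a2
  rw [w4] at a1 a2 hz
  apply corner_uniq hF hpm hf hf' ((hg.at_iff _ _).2 (Or.inl rfl)) ((hg.at_iff _ _).2 (Or.inr rfl))
  · rw [hi, hg'.at_iff]; grind
  · rw [hi, hg'.at_iff]; grind

theorem Half.pent_exit (hF : IsFullerene P) (hM : Half P H M) {f} (hf : f ∈ P.faces) (h5 : f.card = 5)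
    (hc : ∀ v ∈ edgeVerts f, Cov H M v) : ∃ v, Exit M f v := by
  obtain ⟨g, hg⟩ := exists_param hF hf
  have hfH : f ∉ H := fun h => by have := (hM.hex f h).2; omega
  have hcov : ∀ j, Cov H M (g j) := fun j => hc _ ((hg.verts _).2 ⟨j, rfl⟩)
  have C := fun j => hM.corner hF hg hfH j (hcov j)
  by_contra hno
  push Not at hno
  have per := hg.per
  rw [h5] at per
  have p0 := per 0
  have p1 := per (-1)
  have C0 := C 0
  have C1 := C 1
  have C2 := C 2
  have C3 := C 3
  have C4 := C 4
  have N := fun j => hno (g j)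
  norm_num at C0 C1 C2 C3 C4 p0 p1
  rw [← p1] at C0
  rw [p0] at C4
  simp only [N, iff_false] at C0 C1 C2 C3 C4
  have s1 := alp_symm H M (g 1) (g 0)
  have s2 := alp_symm H M (g 2) (g 1)
  have s3 := alp_symm H M (g 3) (g 2)
  have s4 := alp_symm H M (g 4) (g 3)
  have s5 := alp_symm H M (g 0) (g 4)
  rw [s1] at C1
  rw [s2] at C2
  rw [s3] at C3
  rw [s4] at C4
  rw [s5] at C0
  generalize alp H M (g 0) (g 1) = a0 at *
  generalize alp H M (g 1) (g 2) = a1 at *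
  generalize alp H M (g 2) (g 3) = a2 at *
  generalize alp H M (g 3) (g 4) = a3 at *
  generalize alp H M (g 4) (g 0) = a4 at *
  clear * - C0 C1 C2 C3 C4
  revert a0 a1 a2 a3 a4
  decide

theorem Half.count_le (hF : IsFullerene P) (hM : Half P H M) (S : Finset (Finset (Sym2 V)))
    (hS : ∀ f ∈ S, f ∈ P.faces ∧ f.card = 5 ∧ ∀ v ∈ edgeVerts f, Cov H M v) :
    S.card ≤ (edgeVerts M).card ∧ (S.card = (edgeVerts M).card →
      (∀ f ∈ P.faces, ∀ v, Exit M f v → f ∈ S) ∧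
      (∀ f ∈ P.faces, ∀ v v', Exit M f v → Exit M f v' → v = v')) := by
  have : ∀ f ∈ S, ∃ v, Exit M f v := fun f hf => hM.pent_exit hF (hS f hf).1 (hS f hf).2.1 (hS f hf).2.2
  have hne : Nonempty V := (hF.threeConnected ∅ (by simp)).nonempty.map Subtype.val
  choose! ψ hψ using this
  have hinj : Set.InjOn ψ S := fun f hf f' hf' e =>
    hM.exit_uniq hF (hS f hf).1 (hS f' hf').1 (hψ f hf) (e ▸ hψ f' hf')
  have himg : S.image ψ ⊆ edgeVerts M := by
    intro v hv
    obtain ⟨f, hf, rfl⟩ := Finset.mem_image.1 hv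
    obtain ⟨-, e, he, hve, -⟩ := hψ f hf
    exact mem_edgeVerts.2 ⟨e, he, hve⟩
  have hcard := Finset.card_image_of_injOn hinj
  refine ⟨hcard ▸ Finset.card_le_card himg, fun heq => ?_⟩
  have himg' := Finset.eq_of_subset_of_card_le himg (by omega)
  have key : ∀ f ∈ P.faces, ∀ v, Exit M f v → f ∈ S ∧ v = ψ f := by
    intro f hf v hv
    have : v ∈ S.image ψ := by
      rw [himg']; obtain ⟨-, e, he, hve, -⟩ := hv; exact mem_edgeVerts.2 ⟨e, he, hve⟩
    obtain ⟨f', hf', rfl⟩ := Finset.mem_image.1 this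
    have := hM.exit_uniq hF hf (hS f' hf').1 hv (hψ f' hf')
    subst this
    exact ⟨hf', rfl⟩
  exact ⟨fun f hf v hv => (key f hf v hv).1, fun f hf v v' h h' =>
    (key f hf v h).2.trans (key f hf v' h').2.symm⟩

end
end PartB1

section PartB2
set_option linter.all false
variable {V : Type} [Fintype V] [DecidableEq V]

theorem card_edgeVerts_matching {M : Finset (Sym2 V)} (hM : IsMatching M) :
    (edgeVerts M).card = 2 * M.card := by
  have : edgeVerts M = M.biUnion Sym2.toFinset := by
    ext v; simp [mem_edgeVerts]
  rw [this, Finset.card_biUnion, Finset.sum_congr rfl (fun e he => Sym2.card_toFinset_of_not_isDiag e (hM.1 e he))]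
  · simp [mul_comm]
  · intro e he e' he' hne
    show Disjoint _ _
    rw [Finset.disjoint_left]
    intro v hv hv'
    rw [Sym2.mem_toFinset] at hv hv'
    exact hM.2 e he e' he' hne v hv hv'

section
variable {P : PlaneGraph V} {H : Finset (Finset (Sym2 V))} {M : Finset (Sym2 V)}

theorem FaceOf.card_verts {f n g} (h : FaceOf P f n g) : (edgeVerts f).card = n := by
  have hpos : (0:ℤ) < n := by rcases h.size with rfl | rfl <;> norm_num
  have : edgeVerts f = (Finset.range n).image (fun i : ℕ => g i) := by
    ext v
    rw [h.verts, Finset.mem_image]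
    constructor
    · rintro ⟨j, rfl⟩
      have h1 := Int.emod_nonneg j hpos.ne'
      have h2 := Int.emod_lt_of_pos j hpos
      refine ⟨(j % n).toNat, Finset.mem_range.2 (by omega), ?_⟩
      apply h.congr_dvd
      rw [Int.toNat_of_nonneg h1]
      exact ⟨-(j / n), by have := Int.emod_add_mul_ediv j n; linarith⟩
    · rintro ⟨i, -, rfl⟩; exact ⟨_, rfl⟩
  rw [this, Finset.card_image_of_injOn, Finset.card_range]
  intro a ha b hb e
  have := h.inj _ _ e
  rw [Finset.mem_coe, Finset.mem_range] at ha hb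
  rcases h.size with rfl | rfl <;> omega

theorem card_facesVerts (hF : IsFullerene P) (hex : ∀ h ∈ H, h ∈ P.faces ∧ h.card = 6)
    (disj : ∀ f ∈ H, ∀ g ∈ H, f ≠ g → Disjoint (edgeVerts f) (edgeVerts g)) :
    (facesVerts H).card = 6 * H.card := by
  have : facesVerts H = H.biUnion edgeVerts := by
    ext v; simp [mem_facesVerts]
  rw [this, Finset.card_biUnion]
  · rw [Finset.sum_congr rfl (g := fun _ => 6)]
    · simp [mul_comm]
    · intro h hh
      obtain ⟨g, hg⟩ := exists_param hF (hex h hh).1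
      rw [hg.card_verts, (hex h hh).2]
  · exact disj

/-- the half structure of a sextet pattern -/
theorem sextet_half (hF : IsFullerene P) (hS : IsSextetPattern P H) :
    ∃ M, Half P H M ∧ ∀ v, Cov H M v := by
  obtain ⟨hex, disj, M, ⟨hsub, hmat, hcov⟩, h3⟩ := hS
  have hmat' : ∀ M' ⊆ M, IsMatching M' := fun M' h =>
    ⟨fun e he => hmat.1 e (h he), fun e he e' he' => hmat.2 e (h he) e' (h he')⟩
  have key : ∀ h ∈ H, ∀ v ∈ edgeVerts h, ∃ e ∈ M, e ∈ h ∧ v ∈ e := by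
    intro h hh v hv
    have c1 := card_edgeVerts_matching (hmat' (h ∩ M) Finset.inter_subset_right)
    rw [h3 h hh] at c1
    obtain ⟨g, hg⟩ := exists_param hF (hex h hh).1
    have c2 := hg.card_verts
    rw [(hex h hh).2] at c2
    have sub : edgeVerts (h ∩ M) ⊆ edgeVerts h := by
      intro x hx
      obtain ⟨e, he, hxe⟩ := mem_edgeVerts.1 hx
      exact mem_edgeVerts.2 ⟨e, (Finset.mem_inter.1 he).1, hxe⟩
    have := Finset.eq_of_subset_of_card_le sub (by omega)
    rw [← this] at hv
    obtain ⟨e, he, hve⟩ := mem_edgeVerts.1 hv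
    exact ⟨e, (Finset.mem_inter.1 he).2, (Finset.mem_inter.1 he).1, hve⟩
  refine ⟨M.filter (fun e => ∀ v ∈ e, v ∉ facesVerts H), ⟨hex, disj, fun e he => hsub e (Finset.mem_filter.1 he).1,
    hmat' _ (Finset.filter_subset _ _), fun e he => (Finset.mem_filter.1 he).2⟩, fun v => ?_⟩
  by_cases hv : v ∈ facesVerts H
  · exact Or.inl hv
  · right
    obtain ⟨e, he, hve⟩ := hcov v
    refine mem_edgeVerts.2 ⟨e, Finset.mem_filter.2 ⟨he, fun w hw hwH => hv ?_⟩, hve⟩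
    obtain ⟨h, hh, hwh⟩ := mem_facesVerts.1 hwH
    obtain ⟨e', he', heh, hwe⟩ := key h hh w hwh
    have : e = e' := by
      by_contra hne
      exact hmat.2 _ he _ he' hne w hw hwe
    subst this
    exact mem_facesVerts.2 ⟨h, hh, mem_edgeVerts.2 ⟨e, heh, hve⟩⟩

theorem half_card (hF : IsFullerene P) (hM : Half P H M) (hc : ∀ v, Cov H M v) :
    6 * H.card + (edgeVerts M).card = Fintype.card V := by
  have h1 := card_facesVerts hF hM.hex hM.disj
  rw [← h1, ← Finset.card_union_of_disjoint, ← Finset.card_univ]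
  · congr 1; ext v; simp only [Finset.mem_union, Finset.mem_univ, iff_true]; exact hc v
  · rw [Finset.disjoint_left]
    intro v hv hv'
    obtain ⟨e, he, hve⟩ := mem_edgeVerts.1 hv'
    exact hM.avoid _ he _ hve hv

theorem clar_bound (hF : IsFullerene P) (hS : IsSextetPattern P H) : 6 * H.card + 12 ≤ Fintype.card V := by
  obtain ⟨M, hM, hc⟩ := sextet_half hF hS
  have h1 := half_card hF hM hc
  have h2 := (hM.count_le hF (P.faces.filter fun f => f.card = 5) (fun f hf =>
    ⟨(Finset.mem_filter.1 hf).1, (Finset.mem_filter.1 hf).2, fun v _ => hc v⟩)).1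
  rw [hF.pentTwelve] at h2
  omega

theorem extremal_half (hF : IsFullerene P) (hV : Fintype.card V = 60) (hE : IsExtremalFullerene P) :
    ∃ H M, Half P H M ∧ (∀ v, Cov H M v) ∧ H.card = 8 ∧
      (∀ f ∈ P.faces, ∀ v, Exit M f v → f.card = 5) ∧
      (∀ f ∈ P.faces, ∀ v v', Exit M f v → Exit M f v' → v = v') := by
  obtain ⟨H, ⟨hS, -⟩, h8⟩ := hE
  obtain ⟨M, hM, hc⟩ := sextet_half hF hS
  have h1 := half_card hF hM hc
  have h2 := (hM.count_le hF (P.faces.filter fun f => f.card = 5) (fun f hf =>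
    ⟨(Finset.mem_filter.1 hf).1, (Finset.mem_filter.1 hf).2, fun v _ => hc v⟩)).2
    (by rw [hF.pentTwelve]; omega)
  exact ⟨H, M, hM, hc, by omega, fun f hf v hv => (Finset.mem_filter.1 (h2.1 f hf v hv)).2, h2.2⟩

set_option maxHeartbeats 1000000 in
theorem sys_pat (hF : IsFullerene P) (hM : Half P H M) (hc : ∀ v, Cov H M v)
    (hx5 : ∀ f ∈ P.faces, ∀ v, Exit M f v → f.card = 5)
    (hx1 : ∀ f ∈ P.faces, ∀ v v', Exit M f v → Exit M f v' → v = v') :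
    ∀ {n g}, (∃ f, FaceOf P f n g) → List.ofFn (fun i : Fin n => alp H M (g i) (g (i + 1))) ∈ PATS := by
    rintro n g ⟨f, hf⟩
    have p0 := hf.per 0
    have p1 := hf.per (-1)
    have C := fun h => fun j => hM.corner hF hf h j (hc _)
    have s1 := alp_symm H M (g 1) (g 0)
    have s2 := alp_symm H M (g 2) (g 1)
    have s3 := alp_symm H M (g 3) (g 2)
    have s4 := alp_symm H M (g 4) (g 3)
    by_cases hfH : f ∈ H
    · have hn : n = 6 := by rw [← hf.card, (hM.hex f hfH).2]
      subst hn
      have : ∀ j : ℤ, alp H M (g j) (g (j + 1)) = true := fun j => by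
        rw [hM.alp_hex hfH ((hf.verts _).2 ⟨j, rfl⟩), hf.at_iff]; exact Or.inr rfl
      have e : (fun i : Fin 6 => alp H M (g i) (g (i + 1))) = fun _ => true := funext fun i => this i
      rw [e]; decide
    · replace C := C hfH
      have C0 := C 0
      have C1 := C 1
      have C2 := C 2
      have C3 := C 3
      have C4 := C 4
      rcases hf.size with rfl | rfl
      · obtain ⟨v, hv⟩ := hM.pent_exit hF hf.mem hf.card (fun v _ => hc v)
        obtain ⟨i, rfl⟩ := (hf.verts _).1 hv.1
        have U : ∀ a b : ℤ, ¬ ((5:ℤ) ∣ a - b) → ¬ (Exit M f (g a) ∧ Exit M f (g b)) := fun a b h q =>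
          h (hf.inj _ _ (hx1 f hf.mem _ _ q.1 q.2))
        have hi : Exit M f (g 0) ∨ Exit M f (g 1) ∨ Exit M f (g 2) ∨ Exit M f (g 3) ∨ Exit M f (g 4) := by
          have : ∀ a : ℤ, (5:ℤ) ∣ i - a → Exit M f (g a) := fun a h => by
            have e : g i = g a := hf.congr_dvd h
            rwa [← e]
          have h0 := this 0
          have h1 := this 1
          have h2 := this 2
          have h3 := this 3
          have h4 := this 4
          have : (5:ℤ) ∣ i - 0 ∨ (5:ℤ) ∣ i - 1 ∨ (5:ℤ) ∣ i - 2 ∨ (5:ℤ) ∣ i - 3 ∨ (5:ℤ) ∣ i - 4 := by omega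
          rcases this with h | h | h | h | h
          · exact Or.inl (h0 h)
          · exact Or.inr (Or.inl (h1 h))
          · exact Or.inr (Or.inr (Or.inl (h2 h)))
          · exact Or.inr (Or.inr (Or.inr (Or.inl (h3 h))))
          · exact Or.inr (Or.inr (Or.inr (Or.inr (h4 h))))
        have U01 := U 0 1 (by norm_num)
        have U02 := U 0 2 (by norm_num)
        have U03 := U 0 3 (by norm_num)
        have U04 := U 0 4 (by norm_num)
        have U12 := U 1 2 (by norm_num)
        have U13 := U 1 3 (by norm_num)
        have U14 := U 1 4 (by norm_num)
        have U23 := U 2 3 (by norm_num)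
        have U24 := U 2 4 (by norm_num)
        have U34 := U 3 4 (by norm_num)
        norm_num at C0 C1 C2 C3 C4 p0 p1
        rw [← p1] at C0
        rw [p0] at C4
        have s5 := alp_symm H M (g 0) (g 4)
        simp only [← C0.2, ← C1.2, ← C2.2, ← C3.2, ← C4.2] at hi U01 U02 U03 U04 U12 U13 U14 U23 U24 U34
        replace C0 := C0.1
        replace C1 := C1.1
        replace C2 := C2.1
        replace C3 := C3.1
        replace C4 := C4.1
        rw [s1] at *
        rw [s2] at *
        rw [s3] at *
        rw [s4] at *
        rw [s5] at *
        have e : (List.ofFn fun i : Fin 5 => alp H M (g i) (g (i + 1))) =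
          [alp H M (g 0) (g 1), alp H M (g 1) (g 2), alp H M (g 2) (g 3), alp H M (g 3) (g 4), alp H M (g 4) (g 0)] := by
          rw [show alp H M (g 4) (g 0) = alp H M (g 4) (g (4+1)) from by rw [← p0]; norm_num]
          simp [List.ofFn_succ, Fin.succ]
        rw [e]
        clear e
        generalize alp H M (g 0) (g 1) = a0 at *
        generalize alp H M (g 1) (g 2) = a1 at *
        generalize alp H M (g 2) (g 3) = a2 at *
        generalize alp H M (g 3) (g 4) = a3 at *
        generalize alp H M (g 4) (g 0) = a4 at *
        clear * - C0 C1 C2 C3 C4 hi U01 U02 U03 U04 U12 U13 U14 U23 U24 U34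
        cases a0 <;> cases a1 <;> cases a2 <;> cases a3 <;> cases a4 <;> first | decide | (exfalso; simp_all)
      · have C5 := C 5
        have N : ∀ v, ¬ Exit M f v := fun v hv => by
          have h1 := hx5 f hf.mem v hv
          have h2 := hf.card
          omega
        norm_num at C0 C1 C2 C3 C4 C5 p0 p1
        rw [← p1] at C0
        rw [p0] at C5
        simp only [N, iff_false] at C0 C1 C2 C3 C4 C5
        have s5 := alp_symm H M (g 5) (g 4)
        have s6 := alp_symm H M (g 0) (g 5)
        rw [s1] at *
        rw [s2] at *
        rw [s3] at *
        rw [s4] at *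
        rw [s5] at C5
        rw [s6] at C0
        have e : (List.ofFn fun i : Fin 6 => alp H M (g i) (g (i + 1))) =
          [alp H M (g 0) (g 1), alp H M (g 1) (g 2), alp H M (g 2) (g 3), alp H M (g 3) (g 4), alp H M (g 4) (g 5), alp H M (g 5) (g 0)] := by
          rw [show alp H M (g 5) (g 0) = alp H M (g 5) (g (5+1)) from by rw [← p0]; norm_num]
          simp [List.ofFn_succ, Fin.succ]
        rw [e]
        clear e
        generalize alp H M (g 0) (g 1) = a0 at *
        generalize alp H M (g 1) (g 2) = a1 at *
        generalize alp H M (g 2) (g 3) = a2 at *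
        generalize alp H M (g 3) (g 4) = a3 at *
        generalize alp H M (g 4) (g 5) = a4 at *
        generalize alp H M (g 5) (g 0) = a5 at *
        clear * - C0 C1 C2 C3 C4 C5
        cases a0 <;> cases a1 <;> cases a2 <;> cases a3 <;> cases a4 <;> cases a5 <;> first | decide | (exfalso; simp_all)

theorem sys_vrule (hF : IsFullerene P) (hM : Half P H M) (hc : ∀ v, Cov H M v) : ∀ {b x y z}, P.graph.Adj b x → P.graph.Adj b y → P.graph.Adj b z → x ≠ y → x ≠ z → y ≠ z →
    ¬ (alp H M b x = alp H M b y ∧ alp H M b y = alp H M b z) := by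
    intro b x y z hx hy hz hxy hxz hyz ⟨e1, e2⟩
    obtain ⟨z', h1, h2, h3, h4⟩ := third' hF hx hy hxy
    have : z = z' := by have := (h4 z).1 hz; tauto
    subst this
    rcases hc b with hb | hb
    · obtain ⟨h, hh, hb⟩ := mem_facesVerts.1 hb
      obtain ⟨g, hg⟩ := exists_param hF (hM.hex h hh).1
      have ax := hM.alp_hex hh hb x
      have ay := hM.alp_hex hh hb y
      have az := hM.alp_hex hh hb z
      obtain ⟨i, hi⟩ := (hg.verts _).1 hb
      have a1 := hg.adj' i
      have a2 := hg.adj i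
      have a3 := hg.ne_pm i
      rw [← hi, h4] at a1 a2
      rw [hi, hg.at_iff] at ax ay az
      rw [← hi] at ax ay az
      rw [e1, e2] at *
      grind
    · obtain ⟨w, hw, hwM, -⟩ := hM.mate hb
      have ax := hM.alp_mate hwM x
      have ay := hM.alp_mate hwM y
      have az := hM.alp_mate hwM z
      rw [h4] at hw
      grind

theorem sys_hb (hF : IsFullerene P) (hM : Half P H M) (hc : ∀ v, Cov H M v) (h8 : H.card = 8) : ∀ G : Fin 9 → ℤ → V, (∀ i, (∃ f, FaceOf P f 6 (G i)) ∧ ∀ j, alp H M (G i j) (G i (j + 1)) = true) →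
    ∃ i j, i < j ∧ ∃ c : ℤ, (∀ t, G i t = G j (c + t)) ∨ (∀ t, G i t = G j (c - t)) := by
    intro G hG
    choose F hF' using fun i => (hG i).1
    have hin : ∀ i, F i ∈ H := by
      intro i
      by_contra hn
      have := (hM.corner hF (hF' i) hn 1 (hc _)).1
      apply this
      have t0 := (hG i).2 0
      have t1 := (hG i).2 1
      refine ⟨?_, t1⟩
      rw [alp_symm]; exact t0
    have : ∃ i ∈ (Finset.univ : Finset (Fin 9)), ∃ j ∈ (Finset.univ : Finset (Fin 9)), i ≠ j ∧ F i = F j :=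
      Finset.exists_ne_map_eq_of_card_lt_of_maps_to (t := H) (by rw [h8]; simp) (fun i _ => hin i)
    obtain ⟨i, -, j, -, hij, e⟩ := this
    have key : ∀ i j, i < j → F i = F j → ∃ i j, i < j ∧ ∃ c : ℤ, (∀ t, G i t = G j (c + t)) ∨ (∀ t, G i t = G j (c - t)) := by
      intro i j hij e
      exact ⟨i, j, hij, (hF' i).same (e ▸ hF' j)⟩
    rcases lt_or_gt_of_ne hij with h | h
    · exact key i j h e
    · exact key j i h e.symm

/-- the abstract system of an extremal fullerene -/
noncomputable def mkSys (hF : IsFullerene P) (hM : Half P H M) (hc : ∀ v, Cov H M v) (h8 : H.card = 8)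
    (hx5 : ∀ f ∈ P.faces, ∀ v, Exit M f v → f.card = 5)
    (hx1 : ∀ f ∈ P.faces, ∀ v v', Exit M f v → Exit M f v' → v = v') : Sys V where
  Adj := P.graph.Adj
  al := alp H M
  Face n g := ∃ f, FaceOf P f n g
  symm h := h.symm
  alsymm := alp_symm H M
  size := fun ⟨f, h⟩ => h.size
  per := fun ⟨f, h⟩ => h.per
  inj := fun ⟨f, h⟩ => h.inj
  fadj := fun ⟨f, h⟩ => h.adj
  shift := fun ⟨f, h⟩ c => ⟨f, h.shift c⟩
  rev := fun ⟨f, h⟩ => ⟨f, h.rev⟩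
  ex h1 h2 h3 := by
    obtain ⟨f, n, g, h, h'⟩ := corner_param hF h1 h2 h3
    exact ⟨n, g, ⟨f, h⟩, h'⟩
  uniq := fun ⟨f, h⟩ ⟨f', h'⟩ e0 e1 e2 => (param_uniq hF h h' e0 e1 e2).2
  cubic := cubic' hF
  pat := sys_pat hF hM hc hx5 hx1
  vrule := sys_vrule hF hM hc
  hb := sys_hb hF hM hc h8
  conn := face_conn hF

end
end PartB2

section PartC1
set_option linter.all false
variable {V : Type} [Fintype V] [DecidableEq V]

def Pent (P : PlaneGraph V) (f : Finset (Sym2 V)) (a b c d e : V) : Prop :=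
  ∃ g, FaceOf P f 5 g ∧ g 0 = a ∧ g 1 = b ∧ g 2 = c ∧ g 3 = d ∧ g 4 = e

section
variable {P : PlaneGraph V} {H : Finset (Finset (Sym2 V))} {M : Finset (Sym2 V)}
variable {f : Finset (Sym2 V)} {a b c d e : V}

theorem Pent.rot (h : Pent P f a b c d e) : Pent P f b c d e a := by
  obtain ⟨g, hg, rfl, rfl, rfl, rfl, rfl⟩ := h
  refine ⟨_, hg.shift 1, ?_, ?_, ?_, ?_, ?_⟩ <;> norm_num
  have := hg.per 0
  norm_num at this; exact this

theorem Pent.refl (h : Pent P f a b c d e) : Pent P f e d c b a := by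
  obtain ⟨g, hg, rfl, rfl, rfl, rfl, rfl⟩ := h
  refine ⟨_, (hg.shift 4).rev, ?_, ?_, ?_, ?_, ?_⟩ <;> norm_num

theorem Pent.at' (h : Pent P f a b c d e) (x : V) : s(b, x) ∈ f ↔ x = a ∨ x = c := by
  obtain ⟨g, hg, rfl, rfl, rfl, rfl, rfl⟩ := h
  exact hg.at_iff 1 x

theorem Pent.ne2 (h : Pent P f a b c d e) : a ≠ c := by
  obtain ⟨g, hg, rfl, rfl, rfl, rfl, rfl⟩ := h
  exact hg.ne_two 0

theorem Pent.adj (h : Pent P f a b c d e) : P.graph.Adj a b := by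
  obtain ⟨g, hg, rfl, rfl, rfl, rfl, rfl⟩ := h
  exact hg.adj 0

theorem Pent.mem (h : Pent P f a b c d e) : f ∈ P.faces := by
  obtain ⟨g, hg, -⟩ := h
  exact hg.mem

theorem Pent.vert (h : Pent P f a b c d e) (x : V) :
    x ∈ edgeVerts f ↔ x = a ∨ x = b ∨ x = c ∨ x = d ∨ x = e := by
  obtain ⟨g, hg, rfl, rfl, rfl, rfl, rfl⟩ := h
  rw [hg.verts]
  constructor
  · rintro ⟨j, rfl⟩
    have : (5:ℤ) ∣ j - 0 ∨ (5:ℤ) ∣ j - 1 ∨ (5:ℤ) ∣ j - 2 ∨ (5:ℤ) ∣ j - 3 ∨ (5:ℤ) ∣ j - 4 := by omega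
    rcases this with h | h | h | h | h
    · exact Or.inl (hg.congr_dvd h)
    · exact Or.inr (Or.inl (hg.congr_dvd h))
    · exact Or.inr (Or.inr (Or.inl (hg.congr_dvd h)))
    · exact Or.inr (Or.inr (Or.inr (Or.inl (hg.congr_dvd h))))
    · exact Or.inr (Or.inr (Or.inr (Or.inr (hg.congr_dvd h))))
  · rintro (rfl | rfl | rfl | rfl | rfl) <;> exact ⟨_, rfl⟩

theorem pent_of_corner (hF : IsFullerene P) (hf : f ∈ P.faces) (h5 : f.card = 5) (h1 : s(b, a) ∈ f)
    (h2 : s(b, c) ∈ f) (hac : a ≠ c) : ∃ d e, Pent P f a b c d e := by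
  obtain ⟨f', n, g, hg, rfl, rfl, rfl⟩ := corner_param hF (P.face_edges f hf _ h1) (P.face_edges f hf _ h2) hac
  have e := corner_uniq hF hac hf hg.mem h1 h2 ((hg.at_iff 1 _).2 (Or.inl rfl)) ((hg.at_iff 1 _).2 (Or.inr rfl))
  subst e
  have : n = 5 := hg.card.symm.trans h5
  subst this
  exact ⟨_, _, g, hg, rfl, rfl, rfl, rfl, rfl⟩

theorem pent_of_edge (hF : IsFullerene P) (hf : f ∈ P.faces) (h5 : f.card = 5) (h1 : s(a, b) ∈ f) :
    ∃ c d e, Pent P f a b c d e := by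
  obtain ⟨g, hg⟩ := exists_param hF hf
  obtain ⟨j, hj, hx⟩ := (hg.edge_iff _ _).1 (by rwa [Sym2.eq_swap] at h1 : s(b, a) ∈ f)
  rcases hx with hx | hx
  · obtain ⟨d, e, h⟩ := pent_of_corner hF hf h5 (a := a) (b := b) (c := g (j + 1))
      (by rw [hj, hx]; exact (hg.at_iff _ _).2 (Or.inl rfl)) (by rw [hj]; exact (hg.at_iff _ _).2 (Or.inr rfl))
      (by rw [hx]; exact hg.ne_pm j)
    exact ⟨_, _, _, h⟩
  · obtain ⟨d, e, h⟩ := pent_of_corner hF hf h5 (a := a) (b := b) (c := g (j - 1))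
      (by rw [hj, hx]; exact (hg.at_iff _ _).2 (Or.inr rfl)) (by rw [hj]; exact (hg.at_iff _ _).2 (Or.inl rfl))
      (by rw [hx]; exact (hg.ne_pm j).symm)
    exact ⟨_, _, _, h⟩

/-- two different pentagons sharing an edge diverge -/
theorem Pent.div (hF : IsFullerene P) {f' a' d' e' : _} (h : Pent P f a b c d e) (h' : Pent P f' a' b c d' e')
    (hne : f ≠ f') : a ≠ a' := by
  rintro rfl
  exact hne (corner_uniq hF h.ne2 h.mem h'.mem ((h.at' _).2 (Or.inl rfl)) ((h.at' _).2 (Or.inr rfl))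
    ((h'.at' _).2 (Or.inl rfl)) ((h'.at' _).2 (Or.inr rfl)))

structure Loc (P : PlaneGraph V) (H : Finset (Finset (Sym2 V))) (M : Finset (Sym2 V))
    (S : Finset (Finset (Sym2 V))) : Prop where
  ful : IsFullerene P
  half : Half P H M
  pent : ∀ f ∈ S, f ∈ P.faces ∧ f.card = 5 ∧ ∀ v ∈ edgeVerts f, Cov H M v
  ex : ∀ f ∈ P.faces, ∀ v, Exit M f v → f ∈ S
  un : ∀ f ∈ P.faces, ∀ v v', Exit M f v → Exit M f v' → v = v'

variable {S : Finset (Finset (Sym2 V))}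

theorem Loc.notH (L : Loc P H M S) (hf : f ∈ S) : f ∉ H := fun h => by
  have h1 := (L.half.hex f h).2
  have h2 := (L.pent f hf).2.1
  omega

theorem Loc.corner (L : Loc P H M S) (hf : f ∈ S) (h : Pent P f a b c d e) :
    (¬ (alp H M b a = true ∧ alp H M b c = true)) ∧
    ((alp H M b a = false ∧ alp H M b c = false) ↔ Exit M f b) := by
  have hv := (L.pent f hf).2.2 b ((h.vert b).2 (by tauto))
  obtain ⟨g, hg, rfl, rfl, rfl, rfl, rfl⟩ := h
  exact L.half.corner L.ful hg (L.notH hf) 1 hv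

theorem Pent.mv (h : Pent P f a b c d e) : b ∈ edgeVerts f := (h.vert b).2 (by tauto)

/-- label pattern of a pentagon with exit `a` -/
theorem Loc.pattern (L : Loc P H M S) {v w : V} (hf : f ∈ S) (h : Pent P f v w a b c) (hx : Exit M f a) :
    alp H M v w = true ∧ alp H M b c = true ∧ alp H M w a = false ∧ alp H M a b = false ∧ alp H M c v = false := by
  have hne : ∀ x, x ≠ a → ¬ Exit M f x := fun x hxa q => hxa (L.un f h.mem _ _ q hx)
  have c1 := L.corner hf h
  have c2 := L.corner hf h.rot
  have c3 := L.corner hf h.rot.rot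
  have c4 := L.corner hf h.rot.rot.rot
  have c5 := L.corner hf h.rot.rot.rot.rot
  have n1 := hne w h.rot.adj.ne
  have n2 := hne b h.rot.rot.adj.ne.symm
  have n3 := hne c h.rot.rot.ne2.symm
  have n4 := hne v h.ne2
  rw [alp_symm H M w v] at c1
  rw [alp_symm H M a w] at c2
  rw [alp_symm H M b a] at c3
  rw [alp_symm H M c b] at c4
  rw [alp_symm H M v c] at c5
  simp only [n1, n2, n3, n4, hx, iff_false, iff_true] at c1 c2 c3 c4 c5
  clear * - c1 c2 c3 c4 c5
  generalize alp H M v w = x1 at *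
  generalize alp H M w a = x2 at *
  generalize alp H M a b = x3 at *
  generalize alp H M b c = x4 at *
  generalize alp H M c v = x5 at *
  revert x1 x2 x3 x4 x5
  decide

theorem Half.exit_of (hM : Half P H M) {v z : V} (hz : s(v, z) ∈ M) (hv : v ∈ edgeVerts f) (hn : s(v, z) ∉ f) :
    Exit M f v := ⟨hv, _, hz, Sym2.mem_mk_left _ _, hn⟩

theorem Half.exit_notin (hM : Half P H M) {v z : V} (hz : s(v, z) ∈ M) (hx : Exit M f v) : s(v, z) ∉ f := by
  obtain ⟨-, e, he, hve, hef⟩ := hx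
  obtain ⟨z', -, -, h3, -⟩ := hM.mate (mem_edgeVerts.2 ⟨_, hz, Sym2.mem_mk_left v z⟩)
  rw [h3 _ hz (Sym2.mem_mk_left _ _), ← h3 e he hve]; exact hef

theorem Loc.opp (L : Loc P H M S) {v z x y : V} (hz : s(v, z) ∈ M) (hx : P.graph.Adj v x) (hy : P.graph.Adj v y)
    (hxy : x ≠ y) (hxz : x ≠ z) (hyz : y ≠ z) : ∃ f ∈ S, ∃ p q, Pent P f x v y p q ∧ Exit M f v := by
  obtain ⟨f, n, g, hg, rfl, rfl, rfl⟩ := corner_param L.ful hx hy hxy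
  have hE : Exit M f (g 1) := L.half.exit_of hz ((hg.verts _).2 ⟨1, rfl⟩) (by
    rw [hg.at_iff]; rintro (rfl | rfl)
    · exact hxz rfl
    · exact hyz rfl)
  have hS := L.ex f hg.mem _ hE
  have : n = 5 := hg.card.symm.trans (L.pent f hS).2.1
  subst this
  exact ⟨f, hS, _, _, ⟨g, hg, rfl, rfl, rfl, rfl, rfl⟩, hE⟩

theorem Loc.ex_exit (L : Loc P H M S) (hf : f ∈ S) : ∃ v, Exit M f v :=
  L.half.pent_exit L.ful (L.pent f hf).1 (L.pent f hf).2.1 (L.pent f hf).2.2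

theorem alp_of_M {x y : V} (h : s(x, y) ∈ M) : alp H M x y = true := by
  unfold alp; rw [decide_eq_true_iff]; exact Or.inl h

/-- the configuration of two adjacent pentagons around a path of two matching edges -/
structure Cfg (P : PlaneGraph V) (M : Finset (Sym2 V)) (S : Finset (Finset (Sym2 V)))
    (g f2 : Finset (Sym2 V)) (v w a b c a1 d d1 : V) : Prop where
  gS : g ∈ S
  fS : f2 ∈ S
  pg : Pent P g v w a b c
  pf : Pent P f2 a1 a w d1 d
  m1 : s(v, w) ∈ M
  m2 : s(a1, a) ∈ M
  xg : Exit M g a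
  xf : Exit M f2 w

theorem Cfg.swap {g f2 v w a b c a1 d d1} (C : Cfg P M S g f2 v w a b c a1 d d1) :
    Cfg P M S f2 g a1 a w d1 d v c b :=
  ⟨C.fS, C.gS, C.pf, C.pg, C.m2, C.m1, C.xf, C.xg⟩

theorem Loc.cfg (L : Loc P H M S) (hne : M.Nonempty) (side : ∀ e ∈ M, ∃ f ∈ S, e ∈ f) :
    ∃ g f2 v w a b c a1 d d1, Cfg P M S g f2 v w a b c a1 d d1 := by
  obtain ⟨e, he⟩ := hne
  induction e using Sym2.ind with
  | _ v w =>
  obtain ⟨g, hg, heg⟩ := side _ he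
  -- choose orientation
  have key : ∃ v w a b c, s(v, w) ∈ M ∧ Pent P g v w a b c ∧ Exit M g a := by
    obtain ⟨a, b, c, hp⟩ := pent_of_edge L.ful (L.pent g hg).1 (L.pent g hg).2.1 heg
    obtain ⟨x, hx⟩ := L.ex_exit hg
    have he' : s(w, v) ∈ M := by rwa [Sym2.eq_swap]
    rcases (hp.vert x).1 hx.1 with rfl | rfl | rfl | rfl | rfl
    · exact absurd heg (L.half.exit_notin he hx)
    · exact absurd (by rwa [Sym2.eq_swap]) (L.half.exit_notin he' hx)
    · exact ⟨_, _, _, _, _, he, hp, hx⟩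
    · have := L.pattern hg hp.rot hx
      have h2 := alp_of_M (H := H) he
      simp [this] at h2
    · exact ⟨w, v, x, b, a, he', hp.rot.rot.refl, hx⟩
  clear he heg
  obtain ⟨v, w, a, b, c, hM, hp, hx⟩ := key
  obtain ⟨-, e, he, hae, -⟩ := id hx
  obtain ⟨a1, rfl⟩ := Sym2.mem_iff_exists.1 hae
  have hn := L.half.exit_notin he hx
  have hM' : s(w, v) ∈ M := by rwa [Sym2.eq_swap]
  obtain ⟨d1, h1, h2, h3, h4⟩ := third' L.ful hp.adj.symm hp.rot.adj hp.ne2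
  obtain ⟨f2, hf2, p, q, hpf, hxf⟩ := L.opp hM' hp.rot.adj h3 h2.symm hp.ne2.symm h1
  -- hpf : Pent f2 a w d1 p q ; show q = a1
  have hne : g ≠ f2 := by
    rintro rfl
    exact hp.rot.adj.ne (L.un g hp.mem _ _ hxf hx)
  have hq : q = a1 := by
    have adj1 := hpf.rot.rot.rot.rot.adj.symm
    have hqb : q ≠ b := fun hh => (hpf.rot.rot.rot.rot.div L.ful hp.refl.rot hne.symm) hh
    have hqw : q ≠ w := hpf.rot.rot.rot.rot.ne2
    have ha1 : P.graph.Adj a a1 := L.half.sub _ he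
    have := (hp.rot.at' a1).not.1 hn
    obtain ⟨z, z1, z2, z3, z4⟩ := third' L.ful hp.rot.adj.symm hp.rot.rot.adj hp.rot.ne2
    rw [z4] at adj1 ha1
    grind
  subst hq
  exact ⟨g, f2, v, w, a, b, c, q, p, d1, hg, hf2, hp, hpf.rot.rot.rot.rot, hM, by rwa [Sym2.eq_swap], hx, hxf⟩

end
end PartC1

section PartC2
set_option linter.all false
variable {V : Type} [Fintype V] [DecidableEq V]
section
variable {P : PlaneGraph V} {H : Finset (Finset (Sym2 V))} {M : Finset (Sym2 V)}
variable {f : Finset (Sym2 V)} {a b c d e : V} {S : Finset (Finset (Sym2 V))}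

theorem Loc.f1 (L : Loc P H M S) {g f2 v w a b c a1 d d1} (C : Cfg P M S g f2 v w a b c a1 d d1) :
    ∃ f1 ∈ S, ∃ c1 c2 c3, Pent P f1 v c c1 c2 c3 ∧ Exit M f1 v ∧ s(b, c) ∉ M ∧ c ∈ facesVerts H := by
  have hp := C.pg
  obtain ⟨c3, h1, h2, h3, h4⟩ := third' L.ful hp.adj hp.rot.rot.rot.rot.adj.symm hp.rot.rot.rot.rot.ne2.symm
  obtain ⟨f1, hf1, c1, c2, hp1, hx1⟩ := L.opp C.m1 h3 hp.rot.rot.rot.rot.adj.symm h2 h1 hp.rot.rot.rot.rot.ne2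
  have hne : g ≠ f1 := by
    rintro rfl
    exact hp.ne2 (L.un g hp.mem _ _ hx1 C.xg)
  have hbc : s(b, c) ∉ M := by
    intro hM
    have hM' : s(c, b) ∈ M := by rwa [Sym2.eq_swap]
    have hn : s(c, b) ∉ f1 := by
      rw [hp1.rot.at']
      rintro (rfl | rfl)
      · exact hp.rot.rot.rot.ne2 rfl
      · exact hp.rot.rot.rot.div L.ful hp1.rot.refl.rot.rot hne rfl
    have hE := L.half.exit_of hM' hp1.rot.mv hn
    exact hp.rot.rot.rot.rot.adj.ne (L.un f1 hp1.mem _ _ hE hx1)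
  refine ⟨f1, hf1, c1, c2, c3, hp1.rot, hx1, hbc, ?_⟩
  have := (L.pattern C.gS hp C.xg).2.1
  unfold alp at this
  rw [decide_eq_true_iff] at this
  rcases this with h | ⟨h, hh, hb⟩
  · exact absurd h hbc
  · exact mem_facesVerts.2 ⟨h, hh, mem_edgeVerts.2 ⟨_, hb, Sym2.mem_mk_right _ _⟩⟩

/-- the six-pentagon strip, concretely -/
def HasStrip (P : PlaneGraph V) (ι : ℕ → V) : Prop :=
  (∃ f, Pent P f (ι 0) (ι 1) (ι 2) (ι 3) (ι 4)) ∧ (∃ f, Pent P f (ι 1) (ι 0) (ι 7) (ι 11) (ι 10)) ∧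
  (∃ f, Pent P f (ι 0) (ι 4) (ι 5) (ι 6) (ι 7)) ∧ (∃ f, Pent P f (ι 1) (ι 10) (ι 9) (ι 8) (ι 2)) ∧
  (∃ f, Pent P f (ι 5) (ι 12) (ι 13) (ι 14) (ι 6)) ∧ (∃ f, Pent P f (ι 9) (ι 17) (ι 15) (ι 16) (ι 8)) ∧
  ι 3 ≠ ι 5 ∧ ι 11 ≠ ι 6 ∧ ι 3 ≠ ι 8 ∧ ι 11 ≠ ι 9 ∧ ι 4 ≠ ι 12 ∧ ι 7 ≠ ι 14 ∧ ι 10 ≠ ι 17 ∧ ι 2 ≠ ι 16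

theorem Loc.finish (L : Loc P H M S) {g f2 v w a b c a1 d d1} (C : Cfg P M S g f2 v w a b c a1 d d1)
    {f1} (hf1 : f1 ∈ S) (hx1 : Exit M f1 v) {e3} (he3 : e3 ∈ M) (hne1 : e3 ≠ s(a1, a)) (h3 : e3 ∈ f1) :
    ∃ ι, HasStrip P ι := by
  obtain ⟨f1', hf1', c1, c2, c3, hp1, hx1', hbc, hcH⟩ := L.f1 C
  have := L.half.exit_uniq L.ful (L.pent f1 hf1).1 (L.pent f1' hf1').1 hx1 hx1'
  subst this
  clear hf1' hx1'
  obtain ⟨k, hk, kk2, kk3, kk4, hpk, hxk, hdd, hdH⟩ := L.f1 C.swap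
  have hp := C.pg
  have hq := C.pf
  have pat1 := L.pattern hf1 hp1.rot.rot.rot hx1
  -- which edge of f1 is it
  have he : e3 = s(c2, c3) := by
    induction e3 using Sym2.ind with
    | _ x y =>
    have hal := alp_of_M (H := H) he3
    have hxv : ∀ x y, s(x, y) ∈ M → s(x, y) ∈ f1 → x ≠ v := fun x y h1 h2 h => by
      subst h; exact L.half.exit_notin h1 hx1 h2
    have hxc : ∀ x y, s(x, y) ∈ M → x ≠ c := fun x y h1 h => by
      subst h; exact L.half.avoid _ h1 _ (Sym2.mem_mk_left _ _) hcH
    have hx := hxv _ _ he3 h3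
    have hc := hxc _ _ he3
    have he3' : s(y, x) ∈ M := by rwa [Sym2.eq_swap]
    have h3' : s(y, x) ∈ f1 := by rwa [Sym2.eq_swap]
    have hy := hxv _ _ he3' h3'
    have hc' := hxc _ _ he3'
    have hnn : alp H M c1 c2 = false := pat1.2.2.2.2
    rcases (hp1.vert x).1 (mem_edgeVerts.2 ⟨_, h3, Sym2.mem_mk_left _ _⟩) with rfl | rfl | rfl | rfl | rfl
    · exact absurd rfl hx
    · exact absurd rfl hc
    · rcases (hp1.rot.at' _).1 h3 with rfl | rfl
      · exact absurd rfl hc'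
      · rw [hnn] at hal; exact absurd hal (by decide)
    · rcases (hp1.rot.rot.at' _).1 h3 with rfl | rfl
      · rw [alp_symm, hnn] at hal; exact absurd hal (by decide)
      · rfl
    · rcases (hp1.rot.rot.rot.at' _).1 h3 with rfl | rfl
      · exact Sym2.eq_swap
      · exact absurd rfl hy
  subst he
  have he3' : s(c3, c2) ∈ M := by rwa [Sym2.eq_swap]
  have hgf1 : g ≠ f1 := by rintro rfl; exact hp.ne2 (L.un g hp.mem _ _ hx1 C.xg)
  have hgf2 : g ≠ f2 := by rintro rfl; exact hp.rot.adj.ne (L.un g hp.mem _ _ C.xf C.xg)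
  -- g'
  have r1 := hp1.rot.rot.rot.rot -- c3 v c c1 c2
  obtain ⟨m, m1, m2, m3, m4⟩ := third' L.ful r1.adj r1.rot.rot.rot.rot.adj.symm r1.rot.rot.rot.rot.ne2.symm
  obtain ⟨g', hg', d1', x, hpg, hxg⟩ := L.opp he3' m3 r1.adj m1 m2 r1.rot.rot.rot.rot.ne2.symm
  -- hpg : Pent g' m c3 v d1' x, with d1' = w
  have hf1g' : f1 ≠ g' := by
    rintro rfl; exact r1.adj.ne (L.un f1 hp1.mem _ _ hxg hx1)
  have hw : d1' = w := by
    have h1 := hpg.rot.rot.adj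
    have h2 := hpg.rot.ne2
    have h3 := hpg.rot.refl.rot.rot.div L.ful hp1.refl.rot.rot.rot hf1g'.symm
    obtain ⟨z, z1, z2, z3, z4⟩ := third' L.ful r1.adj.symm hp1.adj r1.ne2
    have h5 := hp.adj
    have h6 : w ≠ c := hp.rot.rot.rot.rot.ne2.symm
    have h7 : w ≠ c3 := by
      rintro rfl
      exact L.half.exit_notin C.m1 hx1 ((hp1.rot.rot.rot.rot.at' _).2 (Or.inl rfl))
    rw [z4] at h1 h5
    grind
  subst hw
  have hac3 : c3 ≠ a := by
    rintro rfl
    apply hne1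
    have h1 := (L.half.alp_mate he3' a1).1 (by rw [alp_symm]; exact alp_of_M C.m2)
    rw [h1]
  have hgg' : g ≠ g' := by
    rintro rfl
    exact hac3 (L.un g hp.mem _ _ hxg C.xg)
  have hd : x = d1 := by
    have h1 := hpg.rot.rot.rot.adj
    have h2 := hpg.rot.rot.ne2
    have h3 := hpg.rot.rot.refl.rot.rot.div L.ful hp.refl.rot.rot hgg'.symm
    obtain ⟨z, z1, z2, z3, z4⟩ := third' L.ful hp.adj.symm hp.rot.adj hp.ne2
    have h5 := hq.rot.rot.adj
    have h6 : d1 ≠ a := hq.rot.ne2.symm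
    have h7 : d1 ≠ v := by
      rintro rfl
      exact L.half.exit_notin (by rw [Sym2.eq_swap]; exact C.m1) C.xf ((hq.rot.at' _).2 (Or.inr rfl))
    rw [z4] at h1 h5
    grind
  subst hd
  -- l
  obtain ⟨c21, l1, l2, l3, l4⟩ := third' L.ful hp1.rot.rot.adj.symm hp1.rot.rot.rot.adj hp1.rot.rot.ne2
  obtain ⟨l, hl, n1, n, hpl, hxl⟩ := L.opp he3 hp1.rot.rot.adj.symm l3 l1.symm hp1.rot.rot.ne2 l2
  have hf1l : f1 ≠ l := by
    rintro rfl; exact hp1.rot.rot.rot.ne2.symm (L.un f1 hp1.mem _ _ hx1 hxl)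
  have hf2k : f2 ≠ k := by
    rintro rfl; exact hq.ne2 (L.un f2 hq.mem _ _ hxk C.xf)
  have hf2g' : f2 ≠ g' := by
    rintro rfl
    exact hpg.rot.ne2 (L.un f2 hpg.mem _ _ hxg C.xf)
  refine ⟨fun i => [v, d1', a, b, c, c1, c2, c3, a1, d, x, m, n, n1, c21, kk3, kk4, kk2].getD i v,
    ⟨g, hp⟩, ⟨g', hpg.refl.rot⟩, ⟨f1, hp1⟩, ⟨f2, hq.rot.rot⟩, ⟨l, hpl.refl.rot.rot.rot.rot⟩, ⟨k, hpk.rot⟩, ?_, ?_, ?_, ?_, ?_, ?_, ?_, ?_⟩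
  · exact hp.rot.rot.rot.div L.ful hp1.refl.rot.rot hgf1
  · exact hpg.div L.ful hp1.rot.rot.rot hf1g'.symm
  · exact hp.refl.rot.div L.ful hq hgf2
  · exact hpg.refl.rot.rot.rot.rot.div L.ful hq.refl hf2g'.symm
  · exact hp1.rot.div L.ful hpl.rot.rot.rot.rot hf1l
  · exact hp1.refl.div L.ful hpl.refl.rot.rot hf1l
  · exact hq.rot.rot.rot.div L.ful hpk.refl.rot.rot hf2k
  · exact hq.refl.rot.rot.rot.div L.ful hpk.rot.rot.rot.rot hf2k

end
end PartC2

section PartC3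
set_option linter.all false
variable {V : Type} [Fintype V] [DecidableEq V]
section
variable {P : PlaneGraph V} {H : Finset (Finset (Sym2 V))} {M : Finset (Sym2 V)}
variable {f : Finset (Sym2 V)} {a b c d e : V} {S : Finset (Finset (Sym2 V))}

theorem Loc.strip (L : Loc P H M S) (h3 : M.card = 3) (side : ∀ e ∈ M, ∃ f ∈ S, e ∈ f) :
    ∃ ι, HasStrip P ι := by
  obtain ⟨g, f2, v, w, a, b, c, a1, d, d1, C⟩ := L.cfg (Finset.card_pos.1 (by omega)) side
  have hp := C.pg
  have hq := C.pf
  have hD : s(v, w) ≠ s(a1, a) := by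
    intro h
    have : a ∈ s(v, w) := h ▸ Sym2.mem_mk_right _ _
    rcases Sym2.mem_iff.1 this with h | h
    · exact hp.ne2 h.symm
    · exact hp.rot.adj.ne h.symm
  obtain ⟨e3, he3, hn3⟩ := Finset.exists_mem_notMem_of_card_lt_card
    (s := {s(v, w), s(a1, a)}) (t := M) (by rw [h3]; exact lt_of_le_of_lt Finset.card_le_two (by norm_num))
  simp only [Finset.mem_insert, Finset.mem_singleton, not_or] at hn3
  obtain ⟨hn1, hn2⟩ := hn3
  have hM : ∀ e ∈ M, e = e3 ∨ e = s(v, w) ∨ e = s(a1, a) := by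
    have h1 : ({e3, s(v, w), s(a1, a)} : Finset (Sym2 V)) ⊆ M := by
      intro e he
      simp only [Finset.mem_insert, Finset.mem_singleton] at he
      rcases he with rfl | rfl | rfl
      exacts [he3, C.m1, C.m2]
    have h2 := Finset.eq_of_subset_of_card_le h1 (by
      rw [h3, Finset.card_insert_of_notMem (by simp [hn1, hn2]), Finset.card_pair hD])
    intro e he
    rw [← h2] at he
    simpa using he
  obtain ⟨p, hpS, hep⟩ := side _ he3
  obtain ⟨u, hx⟩ := L.ex_exit hpS
  have hpF := (L.pent p hpS).1
  -- a pentagon of the configuration cannot contain the third edge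
  have key : ∀ {g f2 v w a b c a1 d d1}, Cfg P M S g f2 v w a b c a1 d d1 → e3 ≠ s(v, w) → e3 ≠ s(a1, a) →
      e3 ∈ g → False := by
    clear * - L he3
    intro g f2 v w a b c a1 d d1 C hn1 hn2 hg
    obtain ⟨f1, -, c1, c2, c3, -, -, hbc, -⟩ := L.f1 C
    have hp := C.pg
    have k1 : ∀ x, x ∈ e3 → x ≠ v ∧ x ≠ w ∧ x ≠ a := fun x hx => by
      refine ⟨?_, ?_, ?_⟩
      · rintro rfl; exact L.half.mat.2 _ he3 _ C.m1 hn1 _ hx (Sym2.mem_mk_left _ _)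
      · rintro rfl; exact L.half.mat.2 _ he3 _ C.m1 hn1 _ hx (Sym2.mem_mk_right _ _)
      · rintro rfl; exact L.half.mat.2 _ he3 _ C.m2 hn2 _ hx (Sym2.mem_mk_right _ _)
    have k2 : ∀ x, x ∈ e3 → x = b ∨ x = c := fun x hx => by
      have := (hp.vert x).1 (mem_edgeVerts.2 ⟨_, hg, hx⟩)
      have := k1 x hx
      tauto
    induction e3 using Sym2.ind with
    | _ x y =>
      have hd : x ≠ y := by
        have := L.half.sub _ he3
        exact P.graph.ne_of_adj this
      rcases k2 x (Sym2.mem_mk_left _ _) with rfl | rfl <;> rcases k2 y (Sym2.mem_mk_right _ _) with rfl | rfl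
      · exact hd rfl
      · exact hbc he3
      · rw [Sym2.eq_swap] at he3; exact hbc he3
      · exact hd rfl
  obtain ⟨-, e, he, hue, hep'⟩ := id hx
  rcases hM e he with rfl | rfl | rfl
  · exact absurd hep hep'
  · rcases Sym2.mem_iff.1 hue with rfl | rfl
    · exact L.finish C hpS hx he3 hn2 hep
    · have := L.half.exit_uniq L.ful hpF C.pf.mem hx C.xf
      subst this
      exact (key C.swap hn2 hn1 hep).elim
  · rcases Sym2.mem_iff.1 hue with rfl | rfl
    · exact L.finish C.swap hpS hx he3 hn1 hep
    · have := L.half.exit_uniq L.ful hpF C.pg.mem hx C.xg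
      subst this
      exact (key C hn1 hn2 hep).elim

theorem frag_strip (hF : IsFullerene P) (B : Fragment P) (hB : IsB3Frag B) : ∃ ι, HasStrip P ι := by
  obtain ⟨hpent, h6, ⟨H0, hC0, hU0⟩, H, hCl, M, hME, hMm, hMav, hMc⟩ := hB
  have hE : ∀ e, e ∈ B.edges ↔ ∃ f ∈ B.inFaces, e ∈ f := fun e => by
    simp [Fragment.edges, Finset.mem_sup]
  have hM : Half P H M := ⟨fun h hh => ⟨(hCl.1.1 h hh).1, (hCl.1.1 h hh).2.1⟩, hCl.1.2.1, fun e he => by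
    obtain ⟨f, hf, hef⟩ := (hE e).1 (hME he)
    exact P.face_edges f (B.subFaces hf) e hef, hMm, hMav⟩
  have hU : edgeVerts M = Uset B.edges H := by
    ext v
    constructor
    · intro hv
      obtain ⟨e, he, hve⟩ := mem_edgeVerts.1 hv
      exact Finset.mem_sdiff.2 ⟨mem_edgeVerts.2 ⟨e, hME he, hve⟩, hMav e he v hve⟩
    · intro hv; exact mem_edgeVerts.2 (hMc v hv)
  have hUc : (Uset B.edges H).card = (pentFaces P B.edges).card := by
    have h1 := hC0.2 _ hCl.1
    have h2 := hCl.2 _ hC0.1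
    omega
  have hS : ∀ f ∈ pentFaces P B.edges, f ∈ P.faces ∧ f.card = 5 ∧ ∀ v ∈ edgeVerts f, Cov H M v := by
    intro f hf
    obtain ⟨h1, h2, h3⟩ := Finset.mem_filter.1 hf
    refine ⟨h1, h2, fun v hv => ?_⟩
    by_cases hvH : v ∈ facesVerts H
    · exact Or.inl hvH
    · right
      rw [hU]
      obtain ⟨e, he, hve⟩ := mem_edgeVerts.1 hv
      exact Finset.mem_sdiff.2 ⟨mem_edgeVerts.2 ⟨e, h3 he, hve⟩, hvH⟩
  have hcl := (hM.count_le hF _ hS).2 (by rw [hU, hUc])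
  have L : Loc P H M (pentFaces P B.edges) := ⟨hF, hM, hS, hcl.1, hcl.2⟩
  have hsub : B.inFaces ⊆ pentFaces P B.edges := fun f hf =>
    Finset.mem_filter.2 ⟨B.subFaces hf, hpent f hf, fun e he => (hE e).2 ⟨f, hf, he⟩⟩
  have hEq : pentFaces P B.edges = B.inFaces := by
    apply Finset.Subset.antisymm _ hsub
    intro p hp
    by_contra hpn
    have hnb : ∀ e ∈ p, ∃ q ∈ B.inFaces, e ∈ q ∧ q ≠ p := fun e he => by
      obtain ⟨q, hq, heq⟩ := (hE e).1 ((Finset.mem_filter.1 hp).2.2 he)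
      exact ⟨q, hq, heq, fun h => hpn (h ▸ hq)⟩
    have hal : ∀ x y, s(x, y) ∈ p → alp H M x y = true → s(x, y) ∈ M := fun x y hxy ha => by
      unfold alp at ha
      rw [decide_eq_true_iff] at ha
      rcases ha with h | ⟨h, hh, hb⟩
      · exact h
      · exfalso
        obtain ⟨q, hq, heq, hqp⟩ := hnb _ hxy
        have hqS := hsub hq
        have n1 : q ≠ h := fun e => L.notH hqS (e ▸ hh)
        have n2 : p ≠ h := fun e => L.notH hp (e ▸ hh)
        obtain ⟨f₁, f₂, -, h2⟩ := edge_two P (P.face_edges _ (hS p hp).1 _ hxy)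
        have a1 := (h2 p).1 ⟨(hS p hp).1, hxy⟩
        have a2 := (h2 q).1 ⟨(hS q hqS).1, heq⟩
        have a3 := (h2 h).1 ⟨(hM.hex h hh).1, hb⟩
        grind
    obtain ⟨u, hx⟩ := L.ex_exit hp
    obtain ⟨e, he, hue⟩ := mem_edgeVerts.1 hx.1
    obtain ⟨z, rfl⟩ := Sym2.mem_iff_exists.1 hue
    obtain ⟨b, c, v, hpp⟩ := pent_of_edge hF (hS p hp).1 (hS p hp).2.1 (by rwa [Sym2.eq_swap] at he)
    -- z u b c v
    have hpp' : Pent P p v z u b c := hpp.rot.rot.rot.rot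
    have pat := L.pattern hp hpp' hx
    have m1 : s(v, z) ∈ M := hal _ _ ((hpp'.rot.rot.rot.rot.at' _).2 (Or.inr rfl)) pat.1
    have m2 : s(b, c) ∈ M := hal _ _ ((hpp'.rot.rot.at' _).2 (Or.inr rfl)) pat.2.1
    have hcv : s(c, v) ∈ p := (hpp'.rot.rot.rot.at' _).2 (Or.inr rfl)
    have hcb : s(c, b) ∈ p := (hpp'.rot.rot.rot.at' _).2 (Or.inl rfl)
    have hvc : s(v, c) ∈ p := by rwa [Sym2.eq_swap] at hcv
    have hvz : s(v, z) ∈ p := (hpp'.rot.rot.rot.rot.at' _).2 (Or.inr rfl)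
    obtain ⟨q, hq, heq, hqp⟩ := hnb _ hcv
    have hqS := hsub hq
    have x1 : Exit M q v := hM.exit_of m1 (mem_edgeVerts.2 ⟨_, heq, Sym2.mem_mk_right _ _⟩) (fun h =>
      hqp (corner_uniq hF hpp'.rot.rot.rot.rot.ne2 (hS q hqS).1 (hS p hp).1 (by rwa [Sym2.eq_swap]) h hvc hvz))
    have x2 : Exit M q c := hM.exit_of (z := b) (by rwa [Sym2.eq_swap]) (mem_edgeVerts.2 ⟨_, heq, Sym2.mem_mk_left _ _⟩) (fun h =>
      hqp (corner_uniq hF hpp'.rot.rot.rot.ne2 (hS q hqS).1 (hS p hp).1 h heq hcb hcv))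
    exact hpp'.rot.rot.rot.rot.adj.ne (L.un q (hS q hqS).1 _ _ x2 x1)
  rw [hEq] at L
  refine L.strip ?_ (fun e he => (hE e).1 (hME he))
  have := card_edgeVerts_matching hMm
  rw [hU, hUc, hEq, h6] at this
  omega

theorem b3_res (hV : Fintype.card V = 60) {cs : List (List Ct)} (hrun : runAll starts cs = true)
    (hF : IsFullerene P) (hX : IsExtremalFullerene P) (B : Fragment P) (hB : IsB3Frag B) :
    ∃ (b : Bool) (f : V → ℕ), (∀ a, f a < 60) ∧ Function.Injective f ∧
      ∀ a c, P.graph.Adj a c → has (TT b) (f a) (f c) = true := by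
  obtain ⟨ι, hι⟩ := frag_strip hF B hB
  obtain ⟨H, M, hM, hc, h8, hx5, hx1⟩ := extremal_half hF hV hX
  have conv : ∀ {a b c d e}, (∃ f, Pent P f a b c d e) → FL (mkSys hF hM hc h8 hx5 hx1) a b c d e := by
    rintro a b c d e ⟨f, g, hg, h⟩
    exact ⟨g, ⟨f, hg⟩, h⟩
  obtain ⟨q0, q1, q2, q3, q4, q5, n1, n2, n3, n4, n5, n6, n7, n8⟩ := hι
  obtain ⟨b, hb⟩ := engine hV hrun (Y := mkSys hF hM hc h8 hx5 hx1) (ι := ι)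
    ⟨conv q0, conv q1, conv q2, conv q3, conv q4, conv q5, n1, n2, n3, n4, n5, n6, n7, n8⟩
  exact ⟨b, hb⟩
end
end PartC3

section PartT2
set_option maxRecDepth 100000
def ct4 : List Ct := [.P 4582326789,
  .P 4041344523,
  .P 688279094926,
  .P 48449295,
  .P 759158704400,
  .P 56920081,
  .P 8086899092,
  .P 1104654224409,
  .P 69734302,
  .P 7008930454,
  .P 1311353785885,
  .P 82416282,
  .P 9196407962,
  .P 1518594512169,
  .P 95098274,
  .P 10819669662,
  .P 1725834973731,
  .P 107780264,
  .P 12975640996,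
  .P 1933616929333,
  .P 120462256,
  .P 14598935722,
  .P 2141398456111,
  .P 133144246,
  .P 17312749488,
  .P 2349180247611,
  .P 145826240,
  .P 15689652918,
  .P 2556961972545,
  .P 158508218,
  .P 21092015548,
  .P 2764743729991,
  .P 171190222,
  .P 19468918978,
  .P 2972525454925,
  .P 183872200,
  .P 22182732744,
  .P 3180307246425,
  .P 196554194,
  .P 23806027470,
  .P 3388088773203,
  .P 209236184,
  .P 25961998804,
  .P 3595870728805,
  .P 221918176,
  .B [[[6, 6, 22, 21910, 101, 419158, 25, 365926, 25, 87398, 6, 6, 6, 6], [22, 7, 7, 345, 7, 1382, 23, 1433, 21, 21, 21, 7, 22, 7], [6, 1, 21, 1, 5, 5, 5, 6486, 1, 342, 1, 1369, 6, 1], [1369, 86, 86, 5, 21, 5, 5, 21, 5, 21, 358, 23, 1369, 86], [89, 406, 407, 89, 6657433, 357, 1664342, 101, 353637, 1429, 101, 1622, 89, 406], [5721, 5718, 1622, 26005, 405, 405, 26009, 5717, 91494, 407, 6501, 1622, 5721, 5718], [1430, 1430, 26007, 409, 22870, 101, 1660261, 1429, 101, 405, 409, 5718, 1430, 1430], [22886,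 366169, 22870, 22886, 5717, 26009, 405, 405, 1429, 416086, 22885, 91542, 22886, 366169]], [[6, 1, 21, 1, 5, 5, 5, 6486, 1, 342, 1, 1369, 6, 1], [22, 7, 7, 345, 7, 1382, 23, 1433, 21, 21, 21, 7, 22, 7], [89, 406, 407, 89, 6657433, 357, 1664342, 101, 353637, 1429, 101, 1622, 89, 406], [1369, 86, 86, 5, 21, 5, 5, 21, 5, 21, 358, 23, 1369, 86], [1430, 1430, 26007, 409, 22870, 101, 1660261, 1429, 101, 405, 409, 5718, 1430, 1430], [5721, 5718, 1622, 26005, 405, 405, 26009, 5717, 91494, 407, 6501, 1622, 5721, 5718], [26006, 26006, 104022, 5721, 26005, 26005, 26213, 6657433, 6501, 104021, 5721, 416086, 26006, 26006]], [[1430, 25, 22, 22, 101, 1664342, 357, 26563926, 25, 6706790, 89, 1430, 1430, 25], [1, 342, 1374, 1, 342, 1, 6486, 5, 5, 5, 1, 21, 1, 342], [7, 22, 7, 21, 21, 21, 415070, 23, 415126, 7, 5526, 7, 7, 22], [5470, 86, 86, 5, 21, 5, 5, 21, 5, 21, 88409, 23, 5470, 86], [1622, 26006, 407, 5721, 93672790,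 357, 1664342, 101, 5858646, 1429, 101, 1622, 1622, 26006], [416086, 104022, 104021, 1661273, 405, 101, 1429, 1664342, 101, 22870, 6501, 26007, 416086, 104022]], [[7, 22, 7, 21, 21, 21, 415070, 23, 415126, 7, 5526, 7, 7, 22], [1, 342, 1374, 1, 342, 1, 6486, 5, 5, 5, 1, 21, 1, 342], [1622, 26006, 407, 5721, 93672790, 357, 1664342, 101, 5858646, 1429, 101, 1622, 1622, 26006], [5470, 86, 86, 5, 21, 5, 5, 21, 5, 21, 88409, 23, 5470, 86], [104022, 104038, 1622, 6501, 407, 26629526, 5717, 106517854, 405, 405, 26005, 1622, 104022, 104038]], [[26006, 25, 406, 87638, 101, 23418454, 357, 426072470, 25, 93676950, 1625, 366166, 26006, 25], [22102, 1, 21, 1, 5, 5, 5, 426072470, 1, 1661334, 1, 22102, 22102, 1], [6550, 7, 7, 1660502, 7, 5662297, 23, 1704285782, 21, 21, 21, 7, 6550, 7], [1660502, 22934, 22934, 5, 21, 5, 5, 21, 5, 21, 1414745, 23, 1660502, 22934]], [[6550, 7, 7, 1660502, 7, 5662297, 23, 1704285782, 21, 21, 21, 7, 6550, 7], [22102, 1,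 21, 1, 5, 5, 5, 426072470, 1, 1661334, 1, 22102, 22102, 1], [22934, 1664406, 407, 5721, 5999253078, 357, 5996108182, 101, 1499813462, 1429, 101, 26198, 22934, 1664406]], [[1664406, 25, 406, 1464665, 101, 374760854, 357, 383750923670, 25, 27268634969, 1625, 5658969, 1664406, 25], [7, 1464665, 7, 21, 21, 21, 392961142970713, 23, 6817211798, 7, 1467798, 7, 7, 1464665]], [[1, 419222, 106322265, 1, 6804837974, 1, 98240285795734, 5, 5, 5, 1, 21, 1, 419222]], []],
  .P 27585293530,
  .P 3666213302111,
  .P 226145510,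
  .P 29216976864,
  .P 27868607206,
  .P 3910502185071,
  .P 30840469484,
  .P 509719686575981,
  .P 31373080302,
  .P 522744470780662,
  .P 518346424269549,
  .P 3909978060653,
  .P 505287804450927,
  .P 27868607206,
  .P 3876142446572,
  .P 3912949774062,
  .P 3875618322285,
  .P 500855398201324,
  .P 28409573344,
  .P 28944478948,
  .P 230356575,
  .P 487557651117024,
  .P 63528673969158128,
  .P 28944478948,
  .P 3739775153128,
  .P 61818144183498471,
  .C,
  .P 3631853563743,
  .P 27868607206,
  .P 28940185566,
  .P 230356581,
  .P 496319388611934,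
  .P 62983693605238639,
  .P 3703819629918,
  .P 3739791929310,
  .C,
  .P 3561510990437,
  .P 27585293530,
  .P 3666213302111,
  .P 226145510,
  .P 29216976864,
  .P 3873995093092,
  .P 30552961766,
  .P 30840469484,
  .P 509719686575981,
  .P 31373080302,
  .P 522744470780662,
  .P 518346424269549,
  .P 3844215485158,
  .P 62389821799872238,
  .P 3839635354724,
  .P 30284526310,
  .P 3912949774062,
  .P 28409573344,
  .P 28944478948,
  .P 230356575,
  .P 496317765383268,
  .P 62983626508957551,
  .P 3702196401252,
  .P 3739796222692,
  .C,
  .P 3631853563743,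
  .P 28134879198,
  .P 28942349030,
  .P 230356575,
  .P 487557655328094,
  .P 63528673438578672,
  .P 28942349030,
  .P 3738179368286,
  .P 61830993396053738,
  .C,
  .P 25961998804,
  .P 3458431758552,
  .P 27316858074,
  .P 27593880032,
  .P 456527564992351,
  .P 28134846432,
  .P 469483084461290,
  .P 465085037950175,
  .P 3428662521050,
  .P 53905883735224159,
  .P 3424072020184,
  .P 27048422618,
  .P 3497386323934,
  .P 3353729034835,
  .P 25961998804,
  .P 26511551706,
  .P 3496817783395,
  .P 27593880032,
  .P 456527564992351,
  .P 28134846432,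
  .P 469483084461290,
  .P 465085037950175,
  .P 3494414610271,
  .P 452097561916003,
  .P 26511551706,
  .P 3462458044896,
  .P 3497386323934,
  .P 3460054871903,
  .P 447665155666400,
  .P 23806027470,
  .P 3250649819731,
  .P 200781528,
  .P 25970420178,
  .P 26503163098,
  .P 3528774331858,
  .P 3563654017635,
  .P 3497931649504,
  .P 28126490850,
  .P 469552345003242,
  .P 465154298492129,
  .P 447731991900771,
  .P 3494414593490,
  .P 3529294279267,
  .P 438870172283104,
  .P 26503163098,
  .P 3494414593490,
  .P 3529294279136,
  .P 443302574305506,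
  .P 443299585651168,
  .P 3460054855122,
  .P 3494934540768,
  .P 55040617334976738,
  .P 25163016658,
  .P 25697856730,
  .P 204992595,
  .P 434365533728210,
  .P 56720081869648356,
  .P 25697856730,
  .P 3324211670492,
  .P 55009553157730523,
  .C,
  .P 3216290081363,
  .P 25429421274,
  .P 25699887570,
  .P 204992601,
  .P 443127267012050,
  .P 56174998963384675,
  .P 3288256163282,
  .P 3324234770898,
  .C,
  .P 3145947508057,
  .P 23806027470,
  .P 3250649819731,
  .P 200781528,
  .P 24888256980,
  .P 26769534168,
  .P 213447251,
  .P 460855268864097,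
  .P 452095154549089,
  .P 27868541154,
  .P 469552347084010,
  .P 465154300572897,
  .P 3424071970913,
  .P 3462743370968,
  .P 55581161519853794,
  .P 24888256980,
  .P 25695792344,
  .P 204992595,
  .P 443125643849432,
  .P 56175069306057059,
  .P 3286633000664,
  .P 3324230675672,
  .C,
  .P 3216290081363,
  .P 24888256980,
  .P 25695792344,
  .P 204992595,
  .P 434365529550676,
  .P 56720082412810724,
  .P 25695792344,
  .P 3322611724116,
  .P 55022470552891614,
  .C,
  .P 22182732744,
  .P 22998623950,
  .P 3080985898071,
  .P 24347290578,
  .P 403335443376723,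
  .P 24879868372,
  .P 416290971266782,
  .P 411892924755667,
  .P 3078851127891,
  .P 398905171897431,
  .P 22998623950,
  .P 3046626159570,
  .P 3081822841300,
  .P 3044491389523,
  .P 394472765647826,
  .P 2938165716557,
  .P 22182732744,
  .P 3042868292428,
  .P 24072365774,
  .P 24347290578,
  .P 403335443376723,
  .P 24879868372,
  .P 416290971266782,
  .P 411892924755667,
  .P 3013101168334,
  .P 47637942674696660,
  .P 3008508554060,
  .P 23803930318,
  .P 3081822841300,
  .P 19468918978,
  .P 2835086501453,
  .P 175417544,
  .P 21375329224,
  .P 23520847564,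
  .P 188083271,
  .P 398903032998485,
  .P 407663147248469,
  .P 24617757398,
  .P 416360229695198,
  .P 411962183184085,
  .P 3008508488533,
  .P 3047177823948,
  .P 48232022528027221,
  .P 21375329224,
  .P 22447105740,
  .P 179628615,
  .P 381173407983816,
  .P 49911490848074712,
  .P 22447105740,
  .P 2908648253650,
  .P 48209825870719697,
  .C,
  .P 2800726763085,
  .P 21375329224,
  .P 22447105740,
  .P 179628615,
  .P 389933522250060,
  .P 49366512103156567,
  .P 2871069534540,
  .P 2908665128652,
  .C,
  .P 2730383991623,
  .P 19468918978,
  .P 2835086501453,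
  .P 175417544,
  .P 23256507334,
  .P 22723897038,
  .P 3113210865734,
  .P 3148359003223,
  .P 3082368199638,
  .P 24884095702,
  .P 416360219225822,
  .P 411962172714709,
  .P 394540138753111,
  .P 3078851127366,
  .P 3113999264855,
  .P 385678050667222,
  .P 22723897038,
  .P 3078851127366,
  .P 3113999264726,
  .P 390110452755156,
  .P 390107732503510,
  .P 3044491388998,
  .P 3079639526358,
  .P 48231991414696662,
  .P 21916493518,
  .P 22451200966,
  .P 179628621,
  .P 389935145412678,
  .P 49366441760484183,
  .P 2872692697158,
  .P 2908669223878,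
  .C,
  .P 2800726763085,
  .P 22182765510,
  .P 22453364430,
  .P 179628615,
  .P 381173412128838,
  .P 49911490309106648,
  .P 22453364430,
  .P 2907052435526,
  .P 48205014177753808,
  .C,
  .P 18936176058,
  .P 19468918978,
  .P 2697647531194,
  .P 2734137730635,
  .P 2666804749766,
  .P 21633278920,
  .P 363098845489362,
  .P 358700798978247,
  .P 341349359347275,
  .P 2663287792826,
  .P 2699777992267,
  .P 332485929083846,
  .P 19468918978,
  .P 2663287792826,
  .P 2699777992134,
  .P 336918331106248,
  .P 336916953097670,
  .P 2628928054458,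
  .P 2665418253766,
  .P 40288738209801160,
  .P 2522602234177,
  .P 20018273724,
  .P 20288938176,
  .P 162719291,
  .P 354471025664839,
  .P 345710911349831,
  .P 21375329224,
  .P 363098847570130,
  .P 358700801059015,
  .P 2592945038151,
  .P 2631629054144,
  .P 40829282394678216,
  .P 15689652918,
  .P 2419523019073,
  .P 150053562,
  .P 20009885116,
  .P 2627304759744,
  .P 20811096258,
  .P 21100701130,
  .P 350143321859145,
  .P 21641700554,
  .P 363168097642706,
  .P 358770051131593,
  .P 2597523038402,
  .P 41423396609844297,
  .P 2592945021376,
  .P 20542660802,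
  .P 2666259457224,
  .P 18128772538,
  .P 19200483522,
  .P 154264635,
  .P 327981290595002,
  .P 43102898748564940,
  .P 19200483522,
  .P 2493084771014,
  .P 41401234844951749,
  .C,
  .P 2385163280705,
  .P 18936143292,
  .P 19206807744,
  .P 154264635,
  .P 336741400650176,
  .P 42557817461302603,
  .P 2455506067904,
  .P 2493107970240,
  .C,
  .P 2314820509243,
  .P 15689652918,
  .P 2419523019073,
  .P 150053562,
  .P 20009885116,
  .P 18395177154,
  .P 2664080270923,
  .P 21100701130,
  .P 350143321859145,
  .P 21641700554,
  .P 363168097642706,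
  .P 358770051131593,
  .P 2663287743561,
  .P 345711708137035,
  .P 18395177154,
  .P 2629720532426,
  .P 2666259457224,
  .P 2628928005193,
  .P 341279301887434,
  .P 18395177154,
  .P 19202514362,
  .P 154264641,
  .P 336743023878842,
  .P 42557884557583691,
  .P 2457129296570,
  .P 2493103676858,
  .C,
  .P 2385163280705,
  .P 18936143292,
  .P 19206807744,
  .P 154264635,
  .P 327981286351420,
  .P 43102899283338700,
  .P 19206807744,
  .P 2491484791356,
  .P 41396491334591684,
  .C,
  .P 16505345968,
  .P 17040251572,
  .P 137355311,
  .P 292518789799227,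
  .P 301278904049211,
  .P 18124545468,
  .P 309906730181318,
  .P 305508683670203,
  .P 2177381555771,
  .P 2216063507124,
  .P 33480143402851643,
  .P 2107038717743,
  .P 16222263214,
  .P 15689652918,
  .P 2282084065070,
  .P 2318842716223,
  .P 2251241299900,
  .P 18390883772,
  .P 309906719711942,
  .P 305508673200827,
  .P 288157506199615,
  .P 2247724326702,
  .P 2284482977855,
  .P 279293807467964,
  .P 15689652918,
  .P 2247724326702,
  .P 2284482977724,
  .P 283726209555898,
  .P 283725099950012,
  .P 2213364588334,
  .P 2250123239356,
  .P 33480112289521084,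
  .P 14598935722,
  .P 2003959502639,
  .P 124689590,
  .P 16230619056,
  .P 14882249398,
  .P 2248248385599,
  .P 17854111676,
  .P 296951200243517,
  .P 18386722494,
  .P 309975984448198,
  .P 305577937937085,
  .P 2247724261181,
  .P 292519318118463,
  .P 14882249398,
  .P 2213888647100,
  .P 2250695974590,
  .P 2213364522813,
  .P 288086911868860,
  .P 15423215536,
  .P 15958121140,
  .P 128900655,
  .P 274789164784560,
  .P 36294307718602688,
  .P 15958121140,
  .P 2077521353656,
  .P 34583777932943031,
  .I true 722238911048885615208069953479560075412255447262619392441755590935856861803991603061743714178964601524466533668442002842585457072190895257944320 722238911048885615208069953479560075412255447262619392441755590935856861803991603061743714178964601524466533668442002842585457072190895257944320,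
  .P 1969599764271,
  .P 14882249398,
  .P 15953827758,
  .P 128900661,
  .P 283550902279470,
  .P 35749327354683199,
  .P 2041565830446,
  .P 2077538129838,
  .P 1631136225200,
  .P 1899257190965,
  .P 14598935722,
  .P 2003959502639,
  .P 124689590,
  .P 16230619056,
  .P 2211741293620,
  .P 17566603958,
  .P 17854111676,
  .P 296951200243517,
  .P 18386722494,
  .P 309975984448198,
  .P 305577937937085,
  .P 2181961685686,
  .P 35155455549316798,
  .P 2177381555252,
  .P 17298168502,
  .P 2250695974590,
  .P 15423215536,
  .P 15958121140,
  .P 128900655,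
  .P 283549279050804,
  .P 35749260258402111,
  .P 2039942601780,
  .P 2077542423220,
  .P 1837290560182,
  .P 1969599764271,
  .P 15148521390,
  .P 15955991222,
  .P 128900655,
  .P 274789168995630,
  .P 36294307188023232,
  .P 15955991222,
  .P 2075925568814,
  .P 34596627145498298,
  .I false 722238911048885615208069953479560075412255447262619392441755590935856861803991603061743714178964601524466533668442002842585457072190895257944320 722238911048885615208069953479560075412255447262619392441755590935856861803991603061743714178964601524466533668442002842585457072190895257944320,
  .P 12975640996,
  .P 1796177959080,
  .P 14330500266,
  .P 14607522224,
  .P 243759078659887,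
  .P 15148488624,
  .P 256714598128826,
  .P 252316551617711,
  .P 1766408721578,
  .P 26671517484668719,
  .P 1761818220712,
  .P 14062064810,
  .P 1835132524462,
  .P 1691475235363,
  .P 12975640996,
  .P 13525193898,
  .P 1834563983923,
  .P 14607522224,
  .P 243759078659887,
  .P 15148488624,
  .P 256714598128826,
  .P 252316551617711,
  .P 1832160810799,
  .P 239329075583539,
  .P 13525193898,
  .P 1800204245424,
  .P 1835132524462,
  .P 1797801072431,
  .P 234896669333936,
  .P 10819669662,
  .P 1588396020259,
  .P 99325608,
  .P 12984062370,
  .P 13516805290,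
  .P 1866520532386,
  .P 1901400218163,
  .P 1835677850032,
  .P 15140133042,
  .P 256783858670778,
  .P 252385812159665,
  .P 234963505568307,
  .P 1832160794018,
  .P 1867040479795,
  .P 226101685950640,
  .P 13516805290,
  .P 1832160794018,
  .P 1867040479664,
  .P 230534087973042,
  .P 230531099318704,
  .P 1797801055650,
  .P 1832680741296,
  .P 27806251084421298,
  .P 12176658850,
  .P 12711498922,
  .P 103536675,
  .P 221597047395746,
  .P 29485715619092916,
  .P 12711498922,
  .P 1661957871020,
  .P 27775186907175083,
  .C,
  .P 1554036281891,
  .P 12443063466,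
  .P 12713529762,
  .P 103536681,
  .P 230358780679586,
  .P 28940632712829235,
  .P 1626002363810,
  .P 1661980971426,
  .C,
  .P 1484234773801,
  .P 10819669662,
  .P 1588396020259,
  .P 99325608,
  .P 11901899172,
  .P 13783176360,
  .P 111991331,
  .P 248086782531633,
  .P 239326668216625,
  .P 14882183346,
  .P 256783860751546,
  .P 252385814240433,
  .P 1761818171441,
  .P 1800489571496,
  .P 28346795269298354,
  .P 11901899172,
  .P 12709434536,
  .P 103536675,
  .P 230357157516968,
  .P 28940703055501619,
  .P 1624379201192,
  .P 1661976876200,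
  .C,
  .P 1554036281891,
  .P 11901899172,
  .P 12709434536,
  .P 103536675,
  .P 221597043218212,
  .P 29485716162255284,
  .P 12709434536,
  .P 1660357924644,
  .P 27788104302336174,
  .C,
  .P 9196407962,
  .P 10012266142,
  .P 1418736325671,
  .P 11360932770,
  .P 190566957044259,
  .P 11893510564,
  .P 203522484934318,
  .P 199124438423203,
  .P 1416597328419,
  .P 186136689792039,
  .P 10012266142,
  .P 1384376587170,
  .P 1419569041828,
  .P 1382237590051,
  .P 181704283542434,
  .P 1276994047517,
  .P 9196407962,
  .P 1381155558172,
  .P 11086007966,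
  .P 11360932770,
  .P 190566957044259,
  .P 11893510564,
  .P 203522484934318,
  .P 199124438423203,
  .P 1350847368862,
  .P 20403576424141220,
  .P 1346795819804,
  .P 10817572510,
  .P 1419569041828,
  .P 7008930454,
  .P 1173914832413,
  .P 73961626,
  .P 8389004442,
  .P 10534489756,
  .P 86627353,
  .P 186134546666021,
  .P 194895201981221,
  .P 11631399590,
  .P 203591743362734,
  .P 199193696851621,
  .P 1346795754277,
  .P 1384924024476,
  .P 20997656277471781,
  .P 8389004442,
  .P 9460747932,
  .P 78172697,
  .P 168404921651354,
  .P 22677193853866920,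
  .P 9460747932,
  .P 1246398681250,
  .P 20975459620164257,
  .C,
  .P 1139555094045,
  .P 8389004442,
  .P 9460747932,
  .P 78172697,
  .P 177165576982812,
  .P 22132145852601127,
  .P 1209356800284,
  .P 1246411329180,
  .C,
  .P 1070294486041,
  .P 7008930454,
  .P 1173914832413,
  .P 73961626,
  .P 10270182552,
  .P 9737539230,
  .P 1450957066264,
  .P 1486109430823,
  .P 1420114400166,
  .P 11897737894,
  .P 203591732893358,
  .P 199193686382245,
  .P 181771656647719,
  .P 1416597327896,
  .P 1451749692455,
  .P 172909564334758,
  .P 9737539230,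
  .P 1416597327896,
  .P 1451749692326,
  .P 177341966422692,
  .P 177339250398118,
  .P 1382237589528,
  .P 1417389953958,
  .P 20997625164141222,
  .P 8930135710,
  .P 9464876184,
  .P 78172701,
  .P 177166659080216,
  .P 22132076050993959,
  .P 1210438897688,
  .P 1246415457432,
  .C,
  .P 1139555094045,
  .P 9196440728,
  .P 9467006622,
  .P 78172697,
  .P 168404925796376,
  .P 22677193314898856,
  .P 9467006622,
  .P 1244798636056,
  .P 20970717183546016,
  .C,
  .P 5683578897,
  .P 7550028180,
  .P 61279637,
  .P 132942970342425,
  .P 141670870125849,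
  .P 8384810138,
  .P 150399621779618,
  .P 146001575268505,
  .P 933381770521,
  .P 969354267028,
  .P 14189065260092441,
  .P 759158704400,
  .P 48531473,
  .P 5142431503,
  .P 7545801366,
  .P 61279635,
  .P 132943511407641,
  .P 141670337482009,
  .P 8384810138,
  .P 150399621779618,
  .P 146001575268505,
  .P 932849126681,
  .P 969350040214,
  .P 14189065801157657,
  .P 5142431503,
  .P 6472059542,
  .P 52824979,
  .P 115213886326801,
  .P 15864411197967772,
  .P 6203624086,
  .P 830317299729,
  .P 14144706844167312,
  .C]
def ct59 : List Ct := [.P 3502326275,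
  .P 4852991496,
  .P 759152363406,
  .P 48482061,
  .P 688274950288,
  .P 56903698,
  .P 7008897428,
  .P 1104654290461,
  .P 69734298,
  .P 8086915734,
  .P 1311353719833,
  .P 82416286,
  .P 10819603610,
  .P 1518594413091,
  .P 95098280,
  .P 9196474014,
  .P 1725835072809,
  .P 107780258,
  .P 14598836644,
  .P 1933616830255,
  .P 120462262,
  .P 12975740074,
  .P 2141398555189,
  .P 133144240,
  .P 15689553840,
  .P 2349180346689,
  .P 145826234,
  .P 17312848566,
  .P 2556961873467,
  .P 158508224,
  .P 19468819900,
  .P 2764743829069,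
  .P 171190216,
  .P 21092114626,
  .P 2972525355847,
  .P 183872206,
  .P 23805928392,
  .P 3180307147347,
  .P 196554200,
  .P 22182831822,
  .P 3388088872281,
  .P 209236178,
  .P 27585194452,
  .P 3595870629727,
  .P 221918182,
  .B [[[6, 6, 22, 21910, 101, 419158, 25, 365926, 25, 87398, 6, 6, 6, 6], [6, 1, 21, 1, 5, 5, 5, 6486, 1, 342, 1, 1369, 6, 1], [22, 7, 7, 345, 7, 1382, 23, 1433, 21, 21, 21, 7, 22, 7], [1369, 86, 86, 5, 21, 5, 5, 21, 5, 21, 358, 23, 1369, 86], [89, 406, 407, 89, 6657433, 357, 1664342, 101, 353637, 1429, 101, 1622, 89, 406], [1430, 1430, 26007, 409, 22870, 101, 1660261, 1429, 101, 405, 409, 5718, 1430, 1430], [5721, 5718, 1622, 26005, 405, 405, 26009, 5717, 91494, 407, 6501, 1622, 5721, 5718], [22886, 366169, 22870, 22886, 5717, 26009, 405, 405, 1429, 416086, 22885, 91542, 22886, 366169]], [[22, 7, 7, 345, 7, 1382, 23, 1433, 21, 21, 21, 7, 22, 7], [6, 1, 21, 1, 5, 5, 5, 6486, 1, 342, 1,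 1369, 6, 1], [89, 406, 407, 89, 6657433, 357, 1664342, 101, 353637, 1429, 101, 1622, 89, 406], [1369, 86, 86, 5, 21, 5, 5, 21, 5, 21, 358, 23, 1369, 86], [5721, 5718, 1622, 26005, 405, 405, 26009, 5717, 91494, 407, 6501, 1622, 5721, 5718], [1430, 1430, 26007, 409, 22870, 101, 1660261, 1429, 101, 405, 409, 5718, 1430, 1430], [26006, 26006, 104022, 5721, 26005, 26005, 26213, 6657433, 6501, 104021, 5721, 416086, 26006, 26006]], [[1430, 25, 22, 22, 101, 1664342, 357, 26563926, 25, 6706790, 89, 1430, 1430, 25], [7, 22, 7, 21, 21, 21, 415070, 23, 415126, 7, 5526, 7, 7, 22], [1, 342, 1374, 1, 342, 1, 6486, 5, 5, 5, 1, 21, 1, 342], [5470, 86, 86, 5, 21, 5, 5, 21, 5, 21, 88409, 23, 5470, 86], [1622, 26006, 407, 5721, 93672790, 357, 1664342, 101, 5858646, 1429, 101, 1622, 1622, 26006], [104022, 104038, 1622, 6501, 407, 26629526, 5717, 106517854, 405, 405, 26005, 1622, 104022, 104038]], [[1, 342, 1374, 1, 342, 1, 6486, 5, 5, 5, 1, 21,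 1, 342], [7, 22, 7, 21, 21, 21, 415070, 23, 415126, 7, 5526, 7, 7, 22], [1622, 26006, 407, 5721, 93672790, 357, 1664342, 101, 5858646, 1429, 101, 1622, 1622, 26006], [5470, 86, 86, 5, 21, 5, 5, 21, 5, 21, 88409, 23, 5470, 86], [416086, 104022, 104021, 1661273, 405, 101, 1429, 1664342, 101, 22870, 6501, 26007, 416086, 104022]], [[26006, 25, 406, 87638, 101, 23418454, 357, 426072470, 25, 93676950, 1625, 366166, 26006, 25], [6550, 7, 7, 1660502, 7, 5662297, 23, 1704285782, 21, 21, 21, 7, 6550, 7], [22102, 1, 21, 1, 5, 5, 5, 426072470, 1, 1661334, 1, 22102, 22102, 1], [1660502, 22934, 22934, 5, 21, 5, 5, 21, 5, 21, 1414745, 23, 1660502, 22934]], [[22102, 1, 21, 1, 5, 5, 5, 426072470, 1, 1661334, 1, 22102, 22102, 1], [6550, 7, 7, 1660502, 7, 5662297, 23, 1704285782, 21, 21, 21, 7, 6550, 7], [22934, 1664406, 407, 5721, 5999253078, 357, 5996108182, 101, 1499813462, 1429, 101, 26198, 22934, 1664406]], [[1664406, 25, 406, 1464665, 101, 374760854,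 357, 383750923670, 25, 27268634969, 1625, 5658969, 1664406, 25], [1, 419222, 106322265, 1, 6804837974, 1, 98240285795734, 5, 5, 5, 1, 21, 1, 419222]], [[7, 1464665, 7, 21, 21, 21, 392961142970713, 23, 6817211798, 7, 1467798, 7, 7, 1464665]], []],
  .P 25962097882,
  .P 3666213401189,
  .P 226145504,
  .P 27868508128,
  .P 30014026468,
  .P 238811231,
  .P 505287276164717,
  .P 514047390414701,
  .P 31110936302,
  .P 522744472861430,
  .P 518346426350317,
  .P 3839635388269,
  .P 3878304723684,
  .P 61849205653304941,
  .P 27868508128,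
  .P 28940284644,
  .P 230356575,
  .P 487557651150048,
  .P 63528673973352432,
  .P 28940284644,
  .P 3739775153386,
  .P 61827008995997417,
  .C,
  .P 3631853662821,
  .P 27868508128,
  .P 28940284644,
  .P 230356575,
  .P 496317765416292,
  .P 62983695228434287,
  .P 3702196434276,
  .P 3739792028388,
  .C,
  .P 3561510891359,
  .P 25962097882,
  .P 3666213401189,
  .P 226145504,
  .P 29749686238,
  .P 29217075942,
  .P 3944337765470,
  .P 3979485902959,
  .P 3913495099374,
  .P 31377274606,
  .P 522744462392054,
  .P 518346415880941,
  .P 500924381919343,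
  .P 3909978027102,
  .P 3945126164591,
  .P 492062293833454,
  .P 29217075942,
  .P 3909978027102,
  .P 3945126164462,
  .P 496494695921388,
  .P 496491975669742,
  .P 3875618288734,
  .P 3910766426094,
  .P 61849174539974382,
  .P 28409672422,
  .P 28944379870,
  .P 230356581,
  .P 496319388578910,
  .P 62983624885761903,
  .P 3703819596894,
  .P 3739796123614,
  .C,
  .P 3631853662821,
  .P 28675944414,
  .P 28946543334,
  .P 230356575,
  .P 487557655295070,
  .P 63528673434384368,
  .P 28946543334,
  .P 3738179335262,
  .P 61822197303031528,
  .C,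
  .P 25429354962,
  .P 25962097882,
  .P 3528774430930,
  .P 3565264630371,
  .P 3497931649502,
  .P 28126457824,
  .P 469483088655594,
  .P 465085042144479,
  .P 447733602513507,
  .P 3494414692562,
  .P 3530904892003,
  .P 438870172250078,
  .P 25962097882,
  .P 3494414692562,
  .P 3530904891870,
  .P 443302574272480,
  .P 443301196263902,
  .P 3460054954194,
  .P 3496545153502,
  .P 53905921335078880,
  .P 3353729133913,
  .P 26511452628,
  .P 26782117080,
  .P 213447251,
  .P 460855268831071,
  .P 452095154516063,
  .P 27868508128,
  .P 469483090736362,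
  .P 465085044225247,
  .P 3424071937887,
  .P 3462755953880,
  .P 54446465519955936,
  .P 22182831822,
  .P 3250649918809,
  .P 200781522,
  .P 26503064020,
  .P 3458431659480,
  .P 27304275162,
  .P 27593880034,
  .P 456527565025377,
  .P 28134879458,
  .P 469552340808938,
  .P 465154294297825,
  .P 3428649938138,
  .P 55040579735122017,
  .P 3424071921112,
  .P 27035839706,
  .P 3497386356960,
  .P 24621951442,
  .P 25693662426,
  .P 204992595,
  .P 434365533761234,
  .P 56720081873842660,
  .P 25693662426,
  .P 3324211670750,
  .P 55018417970229469,
  .C,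
  .P 3216290180441,
  .P 25429322196,
  .P 25699986648,
  .P 204992595,
  .P 443125643816408,
  .P 56175000586580323,
  .P 3286632967640,
  .P 3324234869976,
  .C,
  .P 3145947408979,
  .P 22182831822,
  .P 3250649918809,
  .P 200781522,
  .P 26503064020,
  .P 24888356058,
  .P 3495207170659,
  .P 27593880034,
  .P 456527565025377,
  .P 28134879458,
  .P 469552340808938,
  .P 465154294297825,
  .P 3494414643297,
  .P 452095951303267,
  .P 24888356058,
  .P 3460847432162,
  .P 3497386356960,
  .P 3460054904929,
  .P 447663545053666,
  .P 24888356058,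
  .P 25695693266,
  .P 204992601,
  .P 443127267045074,
  .P 56175067682861411,
  .P 3288256196306,
  .P 3324230576594,
  .C,
  .P 3216290180441,
  .P 25429322196,
  .P 25699986648,
  .P 204992595,
  .P 434365529517652,
  .P 56720082408616420,
  .P 25699986648,
  .P 3322611691092,
  .P 55013674459869404,
  .C,
  .P 22998524872,
  .P 23533430476,
  .P 188083271,
  .P 398903032965459,
  .P 407663147215443,
  .P 24617724372,
  .P 416290973347550,
  .P 411892926836435,
  .P 3008508455507,
  .P 3047190406860,
  .P 47097326528129363,
  .P 2938165617479,
  .P 22715442118,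
  .P 22182831822,
  .P 3113210964806,
  .P 3149969615959,
  .P 3082368199636,
  .P 24884062676,
  .P 416290962878174,
  .P 411892916367059,
  .P 394541749365847,
  .P 3078851226438,
  .P 3115609877591,
  .P 385678050634196,
  .P 22182831822,
  .P 3078851226438,
  .P 3115609877460,
  .P 390110452722130,
  .P 390109343116244,
  .P 3044491488070,
  .P 3081250139092,
  .P 47097295414798804,
  .P 21092114626,
  .P 2835086402375,
  .P 175417550,
  .P 22723797960,
  .P 21375428302,
  .P 3079375285335,
  .P 24347290580,
  .P 403335443409749,
  .P 24879901398,
  .P 416360227614430,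
  .P 411962181103317,
  .P 3078851160917,
  .P 398903561284695,
  .P 21375428302,
  .P 3045015546836,
  .P 3081822874326,
  .P 3044491422549,
  .P 394471155035092,
  .P 21916394440,
  .P 22451300044,
  .P 179628615,
  .P 381173407950792,
  .P 49911490843880408,
  .P 22451300044,
  .P 2908648253392,
  .P 48200961058220751,
  .C,
  .P 2800726664007,
  .P 21375428302,
  .P 22447006662,
  .P 179628621,
  .P 389935145445702,
  .P 49366510479960919,
  .P 2872692730182,
  .P 2908665029574,
  .C,
  .P 2730384090701,
  .P 21092114626,
  .P 2835086402375,
  .P 175417550,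
  .P 22723797960,
  .P 3042868193356,
  .P 24059782862,
  .P 24347290580,
  .P 403335443409749,
  .P 24879901398,
  .P 416360227614430,
  .P 411962181103317,
  .P 3013088585422,
  .P 48772638674594518,
  .P 3008508454988,
  .P 23791347406,
  .P 3081822874326,
  .P 21916394440,
  .P 22451300044,
  .P 179628615,
  .P 389933522217036,
  .P 49366443383679831,
  .P 2871069501516,
  .P 2908669322956,
  .C,
  .P 2800726664007,
  .P 21641700294,
  .P 22449170126,
  .P 179628615,
  .P 381173412161862,
  .P 49911490313300952,
  .P 22449170126,
  .P 2907052468550,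
  .P 48213810270776018,
  .C,
  .P 19468819900,
  .P 2627304858816,
  .P 20823679170,
  .P 21100701128,
  .P 350143321826119,
  .P 21641667528,
  .P 363098841295058,
  .P 358700794783943,
  .P 2597535621314,
  .P 40288700609946439,
  .P 2592945120448,
  .P 20555243714,
  .P 2666259424198,
  .P 2522602135099,
  .P 19468819900,
  .P 20018372802,
  .P 2665690883659,
  .P 21100701128,
  .P 350143321826119,
  .P 21641667528,
  .P 363098841295058,
  .P 358700794783943,
  .P 2663287710535,
  .P 345713318749771,
  .P 20018372802,
  .P 2631331145160,
  .P 2666259424198,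
  .P 2628927972167,
  .P 341280912500168,
  .P 17312848566,
  .P 2419522919995,
  .P 150053568,
  .P 19477241274,
  .P 20009984194,
  .P 2697647432122,
  .P 2732527117899,
  .P 2666804749768,
  .P 21633311946,
  .P 363168101837010,
  .P 358770055325897,
  .P 341347748734539,
  .P 2663287693754,
  .P 2698167379531,
  .P 332485929116872,
  .P 20009984194,
  .P 2663287693754,
  .P 2698167379400,
  .P 336918331139274,
  .P 336915342484936,
  .P 2628927955386,
  .P 2663807641032,
  .P 41423434209699018,
  .P 18669837754,
  .P 19204677826,
  .P 154264635,
  .P 327981290561978,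
  .P 43102898744370636,
  .P 19204677826,
  .P 2493084770756,
  .P 41392370032452803,
  .C,
  .P 2385163181627,
  .P 18936242370,
  .P 19206708666,
  .P 154264641,
  .P 336743023845818,
  .P 42557815838106955,
  .P 2457129263546,
  .P 2493107871162,
  .C,
  .P 2314820608321,
  .P 17312848566,
  .P 2419522919995,
  .P 150053568,
  .P 18395078076,
  .P 20276355264,
  .P 162719291,
  .P 354471025697865,
  .P 345710911382857,
  .P 21375362250,
  .P 363168103917778,
  .P 358770057406665,
  .P 2592945071177,
  .P 2631616471232,
  .P 41963978394576074,
  .P 18395078076,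
  .P 19202613440,
  .P 154264635,
  .P 336741400683200,
  .P 42557886180779339,
  .P 2455506100928,
  .P 2493103775936,
  .C,
  .P 2385163181627,
  .P 18395078076,
  .P 19202613440,
  .P 154264635,
  .P 327981286384444,
  .P 43102899287533004,
  .P 19202613440,
  .P 2491484824380,
  .P 41405287427613894,
  .C,
  .P 15689553840,
  .P 16505445046,
  .P 2249858998335,
  .P 17854111674,
  .P 296951200210491,
  .P 18386689468,
  .P 309906728100550,
  .P 305508681589435,
  .P 2247724228155,
  .P 292520928731199,
  .P 16505445046,
  .P 2215499259834,
  .P 2250695941564,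
  .P 2213364489787,
  .P 288088522481594,
  .P 2107038816821,
  .P 15689553840,
  .P 2211741392692,
  .P 17579186870,
  .P 17854111674,
  .P 296951200210491,
  .P 18386689468,
  .P 309906728100550,
  .P 305508681589435,
  .P 2181974268598,
  .P 34020759549418940,
  .P 2177381654324,
  .P 17310751414,
  .P 2250695941564,
  .P 12975740074,
  .P 2003959601717,
  .P 124689584,
  .P 14882150320,
  .P 17027668660,
  .P 137355311,
  .P 292518789832253,
  .P 301278904082237,
  .P 18124578494,
  .P 309975986528966,
  .P 305577940017853,
  .P 2177381588797,
  .P 2216050924212,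
  .P 34614839402749501,
  .P 14882150320,
  .P 15953926836,
  .P 128900655,
  .P 274789164817584,
  .P 36294307722796992,
  .P 15953926836,
  .P 2077521353914,
  .P 34592642745441977,
  .I true 722238537459481936157240606478416040540522966291483045878733084813919742761134028704413978677720168245366413383917988591027062297386158574403840 722238537459481936157240606478416040540522966291483045878733084813919742761134028704413978677720168245366413383917988591027062297386158574403840,
  .P 1969599863349,
  .P 14882150320,
  .P 15953926836,
  .P 128900655,
  .P 283549279083828,
  .P 35749328977878847,
  .P 2039942634804,
  .P 2077538228916,
  .P 1837294754486,
  .P 1899257091887,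
  .P 12975740074,
  .P 2003959601717,
  .P 124689584,
  .P 16763328430,
  .P 16230718134,
  .P 2282083965998,
  .P 2317232103487,
  .P 2251241299902,
  .P 18390916798,
  .P 309975976059590,
  .P 305577929548477,
  .P 288155895586879,
  .P 2247724227630,
  .P 2282872365119,
  .P 279293807500990,
  .P 16230718134,
  .P 2247724227630,
  .P 2282872364990,
  .P 283726209588924,
  .P 283723489337278,
  .P 2213364489262,
  .P 2248512626622,
  .P 34614808289418942,
  .P 15423314614,
  .P 15958022062,
  .P 128900661,
  .P 283550902246446,
  .P 35749258635206463,
  .P 2041565797422,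
  .P 2077542324142,
  .P 1631132030896,
  .P 1969599863349,
  .P 15689586606,
  .P 15960185526,
  .P 128900655,
  .P 274789168962606,
  .P 36294307183828928,
  .P 15960185526,
  .P 2075925535790,
  .P 34587831052476088,
  .I false 710091282317135421361976055342982537324191659672404215668984591044022614982593103179098584474069357655862662620547001143092247406000685419987200 710090161548924471193876672393206601410677493393968313710787630065798117453881419152648220935157416493068868883275462991228971526803715440902400,
  .P 12442997154,
  .P 12975740074,
  .P 1866520631458,
  .P 1903010830899,
  .P 1835677850030,
  .P 15140100016,
  .P 256714602323130,
  .P 252316555812015,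
  .P 234965116181043,
  .P 1832160893090,
  .P 1868651092531,
  .P 226101685917614,
  .P 12975740074,
  .P 1832160893090,
  .P 1868651092398,
  .P 230534087940016,
  .P 230532709931438,
  .P 1797801154722,
  .P 1834291354030,
  .P 26671555084523440,
  .P 1691475334441,
  .P 13525094820,
  .P 13795759272,
  .P 111991331,
  .P 248086782498607,
  .P 239326668183599,
  .P 14882150320,
  .P 256714604403898,
  .P 252316557892783,
  .P 1761818138415,
  .P 1800502154408,
  .P 27212099269400496,
  .P 9196474014,
  .P 1588396119337,
  .P 99325602,
  .P 13516706212,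
  .P 1796177860008,
  .P 14317917354,
  .P 14607522226,
  .P 243759078692913,
  .P 15148521650,
  .P 256783854476474,
  .P 252385807965361,
  .P 1766396138666,
  .P 27806213484566577,
  .P 1761818121640,
  .P 14049481898,
  .P 1835132557488,
  .P 11635593634,
  .P 12707304618,
  .P 103536675,
  .P 221597047428770,
  .P 29485715623287220,
  .P 12707304618,
  .P 1661957871278,
  .P 27784051719674029,
  .C,
  .P 1554036380969,
  .P 12442964388,
  .P 12713628840,
  .P 103536675,
  .P 230357157483944,
  .P 28940634336024883,
  .P 1624379168168,
  .P 1661981070504,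
  .C,
  .P 1484234674723,
  .P 9196474014,
  .P 1588396119337,
  .P 99325602,
  .P 13516706212,
  .P 11901998250,
  .P 1832953371187,
  .P 14607522226,
  .P 243759078692913,
  .P 15148521650,
  .P 256783854476474,
  .P 252385807965361,
  .P 1832160843825,
  .P 239327464970803,
  .P 11901998250,
  .P 1798593632690,
  .P 1835132557488,
  .P 1797801105457,
  .P 234895058721202,
  .P 11901998250,
  .P 12709335458,
  .P 103536681,
  .P 230358780712610,
  .P 28940701432305971,
  .P 1626002396834,
  .P 1661976777122,
  .C,
  .P 1554036380969,
  .P 12442964388,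
  .P 12713628840,
  .P 103536675,
  .P 221597043185188,
  .P 29485716158060980,
  .P 12713628840,
  .P 1660357891620,
  .P 27779308209313964,
  .C,
  .P 10012200090,
  .P 10547072668,
  .P 86627353,
  .P 186134546632995,
  .P 194895201948195,
  .P 11631366564,
  .P 203522487015086,
  .P 199124440503971,
  .P 1346795721251,
  .P 1384936607388,
  .P 19862960277573923,
  .P 1276993981465,
  .P 9729117336,
  .P 9196474014,
  .P 1450957165336,
  .P 1487720043559,
  .P 1420114400164,
  .P 11897704868,
  .P 203522476545710,
  .P 199124430034595,
  .P 181773267260455,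
  .P 1416597426968,
  .P 1453360305191,
  .P 172909564301732,
  .P 9196474014,
  .P 1416597426968,
  .P 1453360305060,
  .P 177341966389666,
  .P 177340861010852,
  .P 1382237688600,
  .P 1419000566692,
  .P 19862929164243364,
  .P 8086915734,
  .P 1173914766361,
  .P 73961630,
  .P 9737473178,
  .P 8389070494,
  .P 1417125712935,
  .P 11360932772,
  .P 190566957077285,
  .P 11893543590,
  .P 203591741281966,
  .P 199193694770853,
  .P 1416597361445,
  .P 186135079179303,
  .P 8389070494,
  .P 1382765974436,
  .P 1419569074854,
  .P 1382237623077,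
  .P 181702672929700,
  .P 8930069658,
  .P 9464942236,
  .P 78172697,
  .P 168404921618330,
  .P 22677193849672616,
  .P 9464942236,
  .P 1246398680992,
  .P 20966594807665311,
  .C,
  .P 1139555027993,
  .P 8389070494,
  .P 9460681880,
  .P 78172701,
  .P 177166659113240,
  .P 22132144770470695,
  .P 1210438930712,
  .P 1246411263128,
  .C,
  .P 1070294552093,
  .P 8086915734,
  .P 1173914766361,
  .P 73961630,
  .P 9737473178,
  .P 1381155459100,
  .P 11073425054,
  .P 11360932772,
  .P 190566957077285,
  .P 11893543590,
  .P 203591741281966,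
  .P 199193694770853,
  .P 1350834785950,
  .P 21538272424039078,
  .P 1346795720732,
  .P 10804989598,
  .P 1419569074854,
  .P 8930069658,
  .P 9464942236,
  .P 78172697,
  .P 177165576949788,
  .P 22132077133124391,
  .P 1209356767260,
  .P 1246415523484,
  .C,
  .P 1139555027993,
  .P 8655375512,
  .P 9462812318,
  .P 78172697,
  .P 168404925829400,
  .P 22677193319093160,
  .P 9462812318,
  .P 1244798669080,
  .P 20979513276568226,
  .C,
  .P 5142497298,
  .P 7550044822,
  .P 61279635,
  .P 132943511407641,
  .P 141670329060633,
  .P 8384810138,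
  .P 150399621779618,
  .P 146001575268505,
  .P 932840705305,
  .P 969354283670,
  .P 14189065801157657,
  .P 688274950288,
  .P 48515090,
  .P 5683529485,
  .P 7545768340,
  .P 61279637,
  .P 132942970342425,
  .P 141670876450073,
  .P 8384810138,
  .P 150399621779618,
  .P 146001575268505,
  .P 933388094745,
  .P 969350007188,
  .P 14189065260092441,
  .P 5683529485,
  .P 6472026516,
  .P 52824981,
  .P 115213345245202,
  .P 15864480185879964,
  .P 6203591060,
  .P 830852073489,
  .P 14144707104214160,
  .C]
def cts : List (List Ct) := [[.P 4582326789],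
 [.P 3502326275],
 [.P 3502326275],
 [.P 4582326789],
 ct4,
 [.P 4852991496],
 [.P 4582326789],
 [.P 3502326275],
 [.P 3502326275],
 [.P 4582326789],
 [.P 3502326275],
 [.P 3502326275],
 [.P 4582326789],
 [.P 4041344523],
 [.P 4041344523],
 [.P 4582326789],
 [.P 3502326275],
 [.P 3502326275],
 [.P 4582326789],
 [.P 4582326789],
 [.P 4582326789],
 [.P 4582326789],
 [.P 4041344523],
 [.P 4041344523],
 [.P 4041344523],
 [.P 4041344523],
 [.P 4582326789],
 [.P 4582326789],
 [.P 4582326789],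
 [.P 4582326789],
 [.P 3502326275],
 [.P 3502326275],
 [.P 4852991496],
 [.P 4582326789, .P 653919356558, .P 4041344523, .P 724798966032, .P 5949867789, .P 5408835602, .P 828966800270, .P 14175388473625751, .C],
 [.P 3502326275],
 [.P 3502326275],
 [.P 3502326275],
 [.P 3502326275],
 [.P 4582326789],
 [.P 3502326275],
 [.P 4582326789],
 [.P 3502326275],
 [.P 4041344523],
 [.P 4041344523],
 [.P 4852991496],
 [.P 4852991496],
 [.P 4582326789],
 [.P 4041344523],
 [.P 4582326789],
 [.P 4582326789, .P 688279094926, .P 4041344523, .P 759158704400, .P 5142431503, .P 5683578897, .P 828964653966, .P 14175389012593815, .C],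
 [.P 4041344523],
 [.P 4582326789],
 [.P 4582326789],
 [.P 3502326275],
 [.P 4582326789],
 [.P 4582326789],
 [.P 4852991496],
 [.P 4582326789],
 [.P 4582326789],
 ct59,
 [.P 4582326789],
 [.P 4582326789],
 [.P 3502326275],
 [.P 4582326789],
 [.P 4582326789],
 [.P 4041344523],
 [.P 4582326789],
 [.P 4582326789]]
theorem runAll_ok : runAll starts cts = true := by decide +kernel
end PartT2

section PartD1
set_option linter.all false

/-! ### The two explicit fullerenes -/

def FC (b : Bool) : List (List (Fin 60)) :=
  bif b then
    [[0, 1, 2, 3, 4],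
     [1, 0, 7, 11, 10],
     [0, 4, 5, 6, 7],
     [1, 10, 9, 8, 2],
     [5, 12, 13, 14, 6],
     [9, 17, 15, 16, 8],
     [3, 2, 8, 16, 18, 19],
     [11, 7, 6, 14, 20, 21],
     [12, 5, 4, 3, 19, 22],
     [13, 12, 22, 23, 24, 25],
     [17, 9, 10, 11, 21, 26],
     [15, 17, 26, 27, 28, 29],
     [18, 16, 15, 29, 30, 31],
     [23, 22, 19, 18, 31, 32],
     [30, 31, 32, 33, 34, 35],
     [20, 14, 13, 25, 36, 37],
     [27, 26, 21, 20, 37, 38],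
     [36, 37, 38, 39, 40, 41],
     [24, 23, 32, 33, 42, 43],
     [41, 36, 25, 24, 43, 44],
     [42, 43, 44, 45, 46, 47],
     [28, 27, 38, 39, 48, 49],
     [35, 30, 29, 28, 49, 50],
     [48, 49, 50, 51, 52, 53],
     [34, 33, 42, 47, 54, 55],
     [51, 50, 35, 34, 55],
     [40, 39, 48, 53, 56, 57],
     [45, 44, 41, 40, 57],
     [46, 45, 57, 56, 58],
     [52, 53, 56, 58, 59],
     [54, 47, 46, 58, 59],
     [51, 52, 59, 54, 55]]
  else
    [[0, 1, 2, 3, 4],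
     [1, 0, 7, 11, 10],
     [0, 4, 5, 6, 7],
     [1, 10, 9, 8, 2],
     [5, 12, 13, 14, 6],
     [9, 17, 15, 16, 8],
     [3, 2, 8, 16, 18, 19],
     [11, 7, 6, 14, 20, 21],
     [12, 5, 4, 3, 19, 22],
     [13, 12, 22, 23, 24, 25],
     [17, 9, 10, 11, 21, 26],
     [15, 17, 26, 27, 28, 29],
     [18, 16, 15, 29, 30, 31],
     [23, 22, 19, 18, 31, 32],
     [30, 31, 32, 33, 34, 35],
     [20, 14, 13, 25, 36, 37],
     [27, 26, 21, 20, 37, 38],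
     [36, 37, 38, 39, 40, 41],
     [24, 23, 32, 33, 42, 43],
     [41, 36, 25, 24, 43, 44],
     [42, 43, 44, 45, 46, 47],
     [28, 27, 38, 39, 48, 49],
     [35, 30, 29, 28, 49, 50],
     [48, 49, 50, 51, 52, 53],
     [34, 33, 42, 47, 54],
     [51, 50, 35, 34, 54, 55],
     [40, 39, 48, 53, 56],
     [45, 44, 41, 40, 56, 57],
     [46, 47, 54, 55, 58],
     [52, 51, 55, 58, 59],
     [57, 56, 53, 52, 59],
     [45, 46, 58, 59, 57]]

def HX (b : Bool) : List (List (Fin 60)) :=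
  bif b then
    [[3, 2, 8, 16, 18, 19],
     [11, 7, 6, 14, 20, 21],
     [13, 12, 22, 23, 24, 25],
     [15, 17, 26, 27, 28, 29],
     [30, 31, 32, 33, 34, 35],
     [36, 37, 38, 39, 40, 41],
     [42, 43, 44, 45, 46, 47],
     [48, 49, 50, 51, 52, 53]]
  else
    [[3, 2, 8, 16, 18, 19],
     [11, 7, 6, 14, 20, 21],
     [13, 12, 22, 23, 24, 25],
     [15, 17, 26, 27, 28, 29],
     [30, 31, 32, 33, 34, 35],
     [36, 37, 38, 39, 40, 41],
     [42, 43, 44, 45, 46, 47],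
     [48, 49, 50, 51, 52, 53]]

def MX (b : Bool) : List (Fin 60 × Fin 60) :=
  bif b then
    [(0, 1), (2, 3), (4, 5), (6, 14), (7, 11), (8, 16), (9, 10), (12, 13), (15, 17), (18, 19), (20, 21), (22, 23), (24, 25), (26, 27), (28, 29), (30, 31), (32, 33), (34, 35), (36, 37), (38, 39), (40, 41), (42, 43), (44, 45), (46, 47), (48, 49), (50, 51), (52, 53), (54, 55), (56, 57), (58, 59)]
  else
    [(0, 1), (2, 3), (4, 5), (6, 14), (7, 11), (8, 16), (9, 10), (12, 13), (15, 17), (18, 19), (20, 21), (22, 23), (24, 25), (26, 27), (28, 29), (30, 31), (32, 33), (34, 35), (36, 37), (38, 39), (40, 41), (42, 43), (44, 45), (46, 47), (48, 49), (50, 51), (52, 53), (54, 55), (56, 57), (58, 59)]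

def AL (b : Bool) : List ℕ :=
  bif b then
    [146, 1029, 266, 524308, 41, 4176, 16544, 2113, 66052, 132352, 2562, 2098304, 4202528, 33574912, 1056832, 537067520, 295168, 67142144, 2148073472, 4456456, 137441067008, 68159488, 8916992, 4315938816, 8796134965248, 68736262144, 136445952, 275213451264, 562950624509952, 1342210048, 37044092928, 5368971264, 10745806848, 4419521347584, 36028839968636928, 1125918160453632, 2336495763456, 343598432256, 687328985088, 282849366245376, 144117936854925312, 18760417148928, 149542171312128, 21990249332736, 46179488366592, 144203149006077952, 288406298012155904, 18089165300170752, 9570698963976192, 1407375151988736, 2814784126844928, 41658296553177088, 587719751371849728, 76842668642009088, 612630286810742784, 20266215503036416, 441352763482308608, 72093877921644544, 648588715085529088, 310748374288564224]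
  else
    [146, 1029, 266, 524308, 41, 4176, 16544, 2113, 66052, 132352, 2562, 2098304, 4202528, 33574912, 1056832, 537067520, 295168, 67142144, 2148073472, 4456456, 137441067008, 68159488, 8916992, 4315938816, 8796134965248, 68736262144, 136445952, 275213451264, 562950624509952, 1342210048, 37044092928, 5368971264, 10745806848, 4419521347584, 18014441459154944, 1125918160453632, 2336495763456, 343598432256, 687328985088, 282849366245376, 72060342816997376, 18760417148928, 149542171312128, 21990249332736, 46179488366592, 144203149006077952, 288406298012155904, 18089165300170752, 9570698963976192, 1407375151988736, 2814784126844928, 41658296553177088, 587719751371849728, 76842668642009088, 36169551687188480, 308496574474878976, 153123486842224640, 648553530713440256, 612559918066565120, 436849163854938112]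

/-- the six pentagons -/
def SL : List (List (Fin 60)) :=
  [[0, 1, 2, 3, 4], [1, 0, 7, 11, 10], [0, 4, 5, 6, 7], [1, 10, 9, 8, 2], [5, 12, 13, 14, 6], [9, 17, 15, 16, 8]]

/-- the boundary of their union -/
def BL : List (Fin 60) := [3, 2, 8, 16, 15, 17, 9, 10, 11, 7, 6, 14, 13, 12, 5, 4]

def H1L : List (List (Fin 60)) :=
  [[3, 2, 8, 16, 18, 19], [11, 7, 6, 14, 20, 21], [15, 17, 26, 27, 28, 29], [13, 12, 22, 23, 24, 25]]

def M1L : List (Fin 60 × Fin 60) := [(0, 1), (4, 5), (9, 10)]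

section
variable {V : Type}

def pc (a0 : V) : V → List V → List (Sym2 V)
  | a, [] => [s(a, a0)]
  | a, b :: t => s(a, b) :: pc a0 b t

/-- closed chain check -/
def pk (r : V → V → Bool) (a0 : V) : V → List V → Bool
  | a, [] => r a a0
  | a, b :: t => r a b && pk r a0 b t

def ck (r : V → V → Bool) : List V → Bool
  | [] => false
  | a :: l => pk r a a l

def ce : List V → List (Sym2 V)
  | [] => []
  | a :: l => pc a a l
end

def fc (l : List (Fin 60)) : Finset (Sym2 (Fin 60)) := (ce l).toFinset
def fcs (L : List (List (Fin 60))) : Finset (Finset (Sym2 (Fin 60))) := (L.map fc).toFinset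
def mts (L : List (Fin 60 × Fin 60)) : Finset (Sym2 (Fin 60)) := (L.map fun p => s(p.1, p.2)).toFinset

theorem g_symm : ∀ (b : Bool) (a c : Fin 60), has (TT b) a c = true → has (TT b) c a = true := by
  decide +kernel
theorem g_loop : ∀ (b : Bool) (a : Fin 60), has (TT b) a a = false := by decide +kernel

/-- the explicit graphs -/
def GG (b : Bool) : SimpleGraph (Fin 60) where
  Adj a c := has (TT b) a c = true
  symm := ⟨g_symm b⟩
  loopless := ⟨fun a h => by rw [g_loop] at h; exact absurd h (by decide)⟩

instance (b : Bool) : DecidableRel (GG b).Adj := fun a c => inferInstanceAs (Decidable (has (TT b) a c = true))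

theorem g_card : ∀ (b : Bool) (a : Fin 60), (Finset.univ.filter fun c : Fin 60 => has (TT b) a c = true).card = 3 := by
  decide +kernel

theorem fc_nodup : ∀ b, ∀ l ∈ FC b, l.Nodup ∧ (ce l).Nodup ∧ (l.length = 5 ∨ l.length = 6) ∧
    ck (fun x y : Fin 60 => has (TT b) x y) l = true := by
  decide +kernel

theorem fcs_nodup : ∀ b, ((FC b).map fc).Nodup := by decide +kernel

theorem fc_count : ∀ (b : Bool) (a c : Fin 60), has (TT b) a c = true →
    ((FC b).countP fun l => s(a, c) ∈ ce l) = 2 := by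
  decide +kernel

theorem al_ok : ∀ (b : Bool) (a c : Fin 60), Nat.testBit ((AL b).getD a 0) c = has (TT b) a c := by
  decide +kernel
end PartD1

section PartD2
set_option linter.all false

section
variable {V : Type} [DecidableEq V]

theorem pk_walk {G : SimpleGraph V} {r : V → V → Bool} (hr : ∀ x y, r x y = true → G.Adj x y) (a0 : V) :
    ∀ (l : List V) (a : V), pk r a0 a l = true → ∃ x, ∃ p : G.Walk a x, G.Adj x a0 ∧ p.support = a :: l ∧
      pc a0 a l = p.edges ++ [s(x, a0)]
  | [], a, h => ⟨a, .nil, hr _ _ h, rfl, rfl⟩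
  | b :: t, a, h => by
    simp only [pk, Bool.and_eq_true] at h
    obtain ⟨x, p, h1, h2, h3⟩ := pk_walk hr a0 t b h.2
    exact ⟨x, .cons (hr _ _ h.1) p, h1, by simp [h2], by simp [pc, h3]⟩

theorem ck_cycle {G : SimpleGraph V} {r : V → V → Bool} (hr : ∀ x y, r x y = true → G.Adj x y) {l : List V}
    (hl : l.Nodup) (he : (ce l).Nodup) (hc : ck r l = true) :
    ∃ (v : V) (c : G.Walk v v), c.IsCycle ∧ c.edges.toFinset = (ce l).toFinset := by
  cases l with
  | nil => simp [ck] at hc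
  | cons a l =>
    obtain ⟨x, p, h1, h2, h3⟩ := pk_walk hr a l a hc
    refine ⟨x, .cons h1 p, ?_, ?_⟩
    · rw [SimpleGraph.Walk.cons_isCycle_iff]
      refine ⟨SimpleGraph.Walk.IsPath.mk' (by rw [h2]; exact hl), fun hm => ?_⟩
      have : (p.edges ++ [s(x, a)]).Nodup := by rw [← h3]; exact he
      rw [List.nodup_append] at this
      exact this.2.2 _ hm _ (by simp) rfl
    · have : ce (a :: l) = p.edges ++ [s(x, a)] := h3
      rw [this]
      ext e; simp [or_comm]

theorem pk_edges {G : SimpleGraph V} {r : V → V → Bool} (hr : ∀ x y, r x y = true → G.Adj x y) (a0 : V) :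
    ∀ (l : List V) (a : V), pk r a0 a l = true → ∀ e ∈ pc a0 a l, e ∈ G.edgeSet
  | [], a, h, e, he => by
    simp only [pc, List.mem_singleton] at he
    subst he; exact hr _ _ h
  | b :: t, a, h, e, he => by
    simp only [pk, Bool.and_eq_true] at h
    simp only [pc, List.mem_cons] at he
    rcases he with rfl | he
    · exact hr _ _ h.1
    · exact pk_edges hr a0 t b h.2 e he

theorem ck_edges {G : SimpleGraph V} {r : V → V → Bool} (hr : ∀ x y, r x y = true → G.Adj x y) {l : List V}
    (hc : ck r l = true) : ∀ e ∈ ce l, e ∈ G.edgeSet := by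
  cases l with
  | nil => simp [ce]
  | cons a l => exact pk_edges hr a l a hc

theorem pc_length (a0 : V) : ∀ (l : List V) (a : V), (pc a0 a l).length = l.length + 1
  | [], a => rfl
  | b :: t, a => by simp [pc, pc_length a0 t b]

theorem ce_length (l : List V) : (ce l).length = l.length := by
  cases l with
  | nil => rfl
  | cons a l => exact pc_length a l a

/-- endpoints of the edges are the vertices -/
theorem pc_vert (a0 : V) : ∀ (l : List V) (a v : V), (∃ e ∈ pc a0 a l, v ∈ e) ↔ v = a0 ∨ v ∈ a :: l
  | [], a, v => by simp [pc, or_comm]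
  | b :: t, a, v => by
    have := pc_vert a0 t b v
    simp only [pc, List.mem_cons, exists_eq_or_imp, this, Sym2.mem_iff]
    tauto

theorem ce_vert (l : List V) (v : V) : (∃ e ∈ ce l, v ∈ e) ↔ v ∈ l := by
  cases l with
  | nil => simp [ce]
  | cons a l => rw [show ce (a :: l) = pc a a l from rfl, pc_vert]; simp
end

theorem fc_card {b : Bool} {l} (hl : l ∈ FC b) : (fc l).card = l.length := by
  rw [fc, List.toFinset_card_of_nodup (fc_nodup b l hl).2.1, ce_length]

theorem mem_fcs {L f} : f ∈ fcs L ↔ ∃ l ∈ L, fc l = f := by simp [fcs]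

theorem mem_fc {l e} : e ∈ fc l ↔ e ∈ ce l := by simp [fc]

theorem fcs_filter (b : Bool) (p : Finset (Sym2 (Fin 60)) → Prop) [DecidablePred p] :
    ((fcs (FC b)).filter p).card = (FC b).countP fun l => p (fc l) := by
  have h := List.toFinset_filter ((FC b).map fc) (fun f => decide (p f))
  have h2 : (fcs (FC b)).filter p = (((FC b).map fc).filter fun f => decide (p f)).toFinset := by
    rw [h]; simp [fcs]
  rw [h2, List.toFinset_card_of_nodup ((fcs_nodup b).filter _),
    ← List.countP_eq_length_filter, List.countP_map]
  rfl

theorem gadj (b : Bool) : ∀ x y : Fin 60, (fun x y : Fin 60 => has (TT b) x y) x y = true → (GG b).Adj x y :=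
  fun _ _ h => h

theorem fc_len : ∀ b, (FC b).length = 32 ∧ ((FC b).map List.length).sum = 180 ∧
    ((FC b).countP fun l => l.length = 5) = 12 := by decide +kernel

/-- the explicit plane graphs -/
def PP (b : Bool) : PlaneGraph (Fin 60) where
  graph := GG b
  faces := fcs (FC b)
  face_edges := by
    intro f hf e he
    obtain ⟨l, hl, rfl⟩ := mem_fcs.1 hf
    exact ck_edges (gadj b) (fc_nodup b l hl).2.2.2 e (mem_fc.1 he)
  face_cycle := by
    intro f hf
    obtain ⟨l, hl, rfl⟩ := mem_fcs.1 hf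
    exact ck_cycle (gadj b) (fc_nodup b l hl).1 (fc_nodup b l hl).2.1 (fc_nodup b l hl).2.2.2
  edge_faces := by
    intro e he
    induction e using Sym2.ind with
    | _ x y =>
      rw [fcs_filter]
      simp only [mem_fc]
      exact fc_count b x y he
  euler := by
    rw [fcs, List.toFinset_card_of_nodup (fcs_nodup b), List.sum_toFinset _ (fcs_nodup b), List.map_map]
    have : (FC b).map (Finset.card ∘ fc) = (FC b).map List.length :=
      List.map_congr_left fun l hl => fc_card hl
    rw [this, List.length_map, (fc_len b).1, (fc_len b).2.1, Fintype.card_fin]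

/-! ### Connectivity -/

/-- one sweep of the closure -/
def sweep (alive : ℕ) : List ℕ → ℕ → ℕ → ℕ
  | [], _, m => m
  | k :: t, i, m =>
    sweep alive t (Nat.succ i) (bif Nat.beq (Nat.land k m) 0 then m
      else Nat.lor m (Nat.land (Nat.shiftLeft 1 i) alive))

def closes (A : List ℕ) (alive : ℕ) : ℕ → ℕ → Bool
  | 0, m => Nat.beq m alive
  | n + 1, m => Nat.beq m alive || closes A alive n (sweep alive A 0 m)

/-- connectivity after the deletion of vertices `u` and `v` -/
def conn2 (b : Bool) (u v : ℕ) : Bool :=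
  let full := 1152921504606846975
  let alive := Nat.xor full (Nat.lor (Nat.shiftLeft 1 u) (Nat.shiftLeft 1 v))
  closes (AL b) alive 10 (Nat.land alive (Nat.shiftLeft 1 (bif Nat.beq u 0 || Nat.beq v 0 then
    bif Nat.beq u 1 || Nat.beq v 1 then 2 else 1 else 0)))
end PartD2

section PartD3
set_option linter.all false

theorem conn_ok : ∀ b, ∀ u v : Fin 60, u ≤ v → conn2 b u v = true := by decide +kernel
theorem conn_ok0 : ∀ b, closes (AL b) 1152921504606846975 10 (Nat.land 1152921504606846975 (Nat.shiftLeft 1 0)) = true := by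
  decide +kernel

theorem tb_bit (i j : ℕ) : Nat.testBit (Nat.shiftLeft 1 i) j = decide (i = j) := by
  change Nat.testBit (1 <<< i) j = _
  rw [Nat.one_shiftLeft, Nat.testBit_two_pow]

theorem tb_full (j : ℕ) : Nat.testBit 1152921504606846975 j = decide (j < 60) := by
  rw [show 1152921504606846975 = 2 ^ 60 - 1 by norm_num, Nat.testBit_two_pow_sub_one]

theorem land_ne {k m : ℕ} (h : Nat.beq (Nat.land k m) 0 = false) : ∃ j, Nat.testBit k j = true ∧ Nat.testBit m j = true := by
  by_contra hc
  push Not at hc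
  have : Nat.land k m = 0 := by
    apply Nat.eq_of_testBit_eq
    intro j
    change Nat.testBit (k &&& m) j = _
    rw [Nat.testBit_and, Nat.zero_testBit]
    have := hc j
    cases h1 : Nat.testBit k j <;> cases h2 : Nat.testBit m j <;> simp_all
  rw [this] at h
  exact absurd h (by decide)

theorem sweep_inv {A : List ℕ} {alive : ℕ} {R : ℕ → Prop}
    (hs : ∀ i j, R j → Nat.testBit (A.getD i 0) j = true → Nat.testBit alive i = true → R i) :
    ∀ (t : List ℕ) (i m : ℕ), (∀ n, t.getD n 0 = A.getD (i + n) 0) → (∀ j, Nat.testBit m j = true → R j) →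
      ∀ j, Nat.testBit (sweep alive t i m) j = true → R j
  | [], i, m, _, hm, j, hj => hm j hj
  | k :: t, i, m, ht, hm, j, hj => by
    refine sweep_inv hs t (i + 1) _ (fun n => ?_) ?_ j hj
    · have := ht (n + 1)
      rw [List.getD_cons_succ] at this
      rw [this]; congr 1; omega
    · intro j hj
      cases hb : Nat.beq (Nat.land k m) 0 with
      | true => rw [hb] at hj; exact hm j hj
      | false =>
        rw [hb] at hj
        change Nat.testBit (m ||| ((Nat.shiftLeft 1 i) &&& alive)) j = true at hj
        rw [Nat.testBit_or, Nat.testBit_and, tb_bit] at hj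
        simp only [Bool.or_eq_true, Bool.and_eq_true, decide_eq_true_eq] at hj
        rcases hj with hj | ⟨rfl, hj⟩
        · exact hm j hj
        · obtain ⟨x, hx1, hx2⟩ := land_ne hb
          have := ht 0
          rw [List.getD_cons_zero] at this
          exact hs i x (hm x hx2) (by rw [this] at hx1; exact hx1) hj

theorem closes_inv {A : List ℕ} {alive : ℕ} {R : ℕ → Prop}
    (hs : ∀ i j, R j → Nat.testBit (A.getD i 0) j = true → Nat.testBit alive i = true → R i) :
    ∀ (n m : ℕ), closes A alive n m = true → (∀ j, Nat.testBit m j = true → R j) →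
      ∀ j, Nat.testBit alive j = true → R j
  | 0, m, hc, hm, j, hj => by
    have := Nat.eq_of_beq_eq_true hc
    subst this; exact hm j hj
  | n + 1, m, hc, hm, j, hj => by
    simp only [closes, Bool.or_eq_true] at hc
    rcases hc with hc | hc
    · have := Nat.eq_of_beq_eq_true hc
      subst this; exact hm j hj
    · exact closes_inv hs n _ hc (sweep_inv hs A 0 m (fun n => by rw [Nat.zero_add]) hm) j hj

theorem conn_of {b : Bool} {s : Set (Fin 60)} {alive n k : ℕ}
    (ha : ∀ i, Nat.testBit alive i = true ↔ ∃ h : i < 60, (⟨i, h⟩ : Fin 60) ∉ s)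
    (hc : closes (AL b) alive n (Nat.land alive (Nat.shiftLeft 1 k)) = true) (hs : s.ncard ≤ 2) :
    (SimpleGraph.induce sᶜ (GG b)).Connected := by
  have key : ∀ j, Nat.testBit alive j = true → ∃ (h : k < 60) (h' : (⟨k, h⟩ : Fin 60) ∈ sᶜ) (q : j < 60)
      (q' : (⟨j, q⟩ : Fin 60) ∈ sᶜ),
      (SimpleGraph.induce sᶜ (GG b)).Reachable ⟨⟨k, h⟩, h'⟩ ⟨⟨j, q⟩, q'⟩ := by
    refine closes_inv (A := AL b) ?_ n _ hc ?_
    · rintro i j ⟨h, h', q, q', hr⟩ hA hi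
      obtain ⟨p, p'⟩ := (ha i).1 hi
      refine ⟨h, h', p, p', hr.trans (SimpleGraph.Adj.reachable ?_)⟩
      have : (GG b).Adj ⟨i, p⟩ ⟨j, q⟩ := by
        have := al_ok b ⟨i, p⟩ ⟨j, q⟩
        exact this.symm.trans hA
      exact this.symm
    · intro j hj
      change Nat.testBit (alive &&& (Nat.shiftLeft 1 k)) j = true at hj
      rw [Nat.testBit_and, tb_bit] at hj
      simp only [Bool.and_eq_true, decide_eq_true_eq] at hj
      obtain ⟨hj, rfl⟩ := hj
      obtain ⟨p, p'⟩ := (ha k).1 hj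
      exact ⟨p, p', p, p', SimpleGraph.Reachable.refl _⟩
  obtain ⟨x, hx⟩ : ∃ x, x ∉ s := by
    by_contra hn
    push Not at hn
    have : s = Set.univ := Set.eq_univ_of_forall hn
    rw [this, Set.ncard_univ, Nat.card_eq_fintype_card, Fintype.card_fin] at hs
    omega
  obtain ⟨h, h', -⟩ := key x ((ha x).2 ⟨x.2, hx⟩)
  have hall : ∀ y : (sᶜ : Set (Fin 60)), (SimpleGraph.induce sᶜ (GG b)).Reachable ⟨⟨k, h⟩, h'⟩ y := by
    rintro ⟨y, hy⟩
    obtain ⟨_, _, _, _, hr⟩ := key y ((ha y).2 ⟨y.2, hy⟩)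
    exact hr
  haveI : Nonempty (sᶜ : Set (Fin 60)) := ⟨⟨_, h'⟩⟩
  exact ⟨fun y z => (hall y).symm.trans (hall z)⟩

theorem g_conn (b : Bool) (s : Set (Fin 60)) (hs : s.ncard ≤ 2) : (SimpleGraph.induce sᶜ (GG b)).Connected := by
  have h2 : ∀ u v : Fin 60, s = {u, v} → (SimpleGraph.induce sᶜ (GG b)).Connected := by
    have : ∀ u v : Fin 60, u ≤ v → s = {u, v} → (SimpleGraph.induce sᶜ (GG b)).Connected := by
      intro u v huv h
      refine conn_of (fun i => ?_) (conn_ok b u v huv) hs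
      change Nat.testBit (1152921504606846975 ^^^ ((Nat.shiftLeft 1 u) ||| (Nat.shiftLeft 1 v))) i = true ↔ _
      rw [Nat.testBit_xor, Nat.testBit_or, tb_bit, tb_bit, tb_full, h]
      have hu := u.2
      have hv := v.2
      simp only [Set.mem_insert_iff, Set.mem_singleton_iff, Fin.ext_iff]
      by_cases h1 : (u : ℕ) = i <;> by_cases h2 : (v : ℕ) = i <;> by_cases h3 : i < 60 <;> simp [h1, h2, h3] <;> omega
    intro u v h
    rcases le_total u v with huv | huv
    · exact this u v huv h
    · exact this v u huv (by rw [h, Set.pair_comm])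
  have h0 : s.ncard = 0 ∨ s.ncard = 1 ∨ s.ncard = 2 := by omega
  rcases h0 with h | h | h
  · rw [Set.ncard_eq_zero] at h
    refine conn_of (fun i => ?_) (conn_ok0 b) hs
    rw [tb_full, h]; simp
  · obtain ⟨u, h⟩ := Set.ncard_eq_one.1 h
    exact h2 u u (by rw [h, Set.pair_eq_singleton])
  · obtain ⟨u, v, -, h⟩ := Set.ncard_eq_two.1 h
    exact h2 u v h

theorem g_cubic (b : Bool) (v : Fin 60) : ((GG b).neighborSet v).ncard = 3 := by
  have : (GG b).neighborSet v = ((Finset.univ.filter fun c : Fin 60 => has (TT b) v c = true : Finset (Fin 60)) : Set (Fin 60)) := by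
    ext x; simp [GG]
  rw [this, Set.ncard_coe_finset, g_card]

theorem pp_ful (b : Bool) : IsFullerene (PP b) where
  cubic := g_cubic b
  threeConnected := g_conn b
  faceSize := by
    intro f hf
    obtain ⟨l, hl, rfl⟩ := mem_fcs.1 hf
    rw [fc_card hl]; exact (fc_nodup b l hl).2.2.1
  pentTwelve := by
    have h := fcs_filter b (fun f => f.card = 5)
    refine h.trans ?_
    rw [← (fc_len b).2.2]
    exact List.countP_congr fun l hl => by simp [fc_card hl]
end PartD3

section PartD4
set_option linter.all false

instance ball_inst {α : Type} (L : List α) (p : α → Prop) [DecidablePred p] : Decidable (∀ x ∈ L, p x) := List.decidableBAll p L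
instance bex_inst {α : Type} (L : List α) (p : α → Prop) [DecidablePred p] : Decidable (∃ x ∈ L, p x) := List.decidableBEx p L

theorem mem_mts {L : List (Fin 60 × Fin 60)} {e} : e ∈ mts L ↔ ∃ p ∈ L, s(p.1, p.2) = e := by simp [mts]

theorem verts_fc (l : List (Fin 60)) (v : Fin 60) : v ∈ edgeVerts (fc l) ↔ v ∈ l := by
  rw [mem_edgeVerts]
  simp only [mem_fc]
  exact ce_vert l v

theorem verts_fcs (L : List (List (Fin 60))) (v : Fin 60) : v ∈ facesVerts (fcs L) ↔ ∃ l ∈ L, v ∈ l := by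
  rw [mem_facesVerts]
  constructor
  · rintro ⟨h, hh, hv⟩
    obtain ⟨l, hl, rfl⟩ := mem_fcs.1 hh
    exact ⟨l, hl, (verts_fc l v).1 hv⟩
  · rintro ⟨l, hl, hv⟩; exact ⟨_, mem_fcs.2 ⟨l, hl, rfl⟩, (verts_fc l v).2 hv⟩

theorem mts_matching {L : List (Fin 60 × Fin 60)} (h1 : ∀ p ∈ L, p.1 ≠ p.2)
    (h2 : ∀ p ∈ L, ∀ q ∈ L, (p.1 = q.1 ∧ p.2 = q.2) ∨ (p.1 ≠ q.1 ∧ p.1 ≠ q.2 ∧ p.2 ≠ q.1 ∧ p.2 ≠ q.2)) : IsMatching (mts L) := by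
  refine ⟨fun e he => ?_, fun e he e' he' hne v hv hv' => ?_⟩
  · obtain ⟨p, hp, rfl⟩ := mem_mts.1 he
    exact h1 p hp
  · obtain ⟨p, hp, rfl⟩ := mem_mts.1 he
    obtain ⟨q, hq, rfl⟩ := mem_mts.1 he'
    rcases h2 p hp q hq with ⟨a, b⟩ | ⟨a, b, c, d⟩
    · exact hne (by rw [a, b])
    · rw [Sym2.mem_iff] at hv hv'
      rcases hv with rfl | rfl <;> rcases hv' with h | h <;> contradiction

theorem fcs_disj {L : List (List (Fin 60))} (h : ∀ l ∈ L, ∀ l' ∈ L, l = l' ∨ ∀ x ∈ l, x ∉ l') :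
    ∀ f ∈ fcs L, ∀ g ∈ fcs L, f ≠ g → Disjoint (edgeVerts f) (edgeVerts g) := by
  intro f hf g hg hne
  obtain ⟨l, hl, rfl⟩ := mem_fcs.1 hf
  obtain ⟨l', hl', rfl⟩ := mem_fcs.1 hg
  rw [Finset.disjoint_left]
  intro x hx hx'
  rw [verts_fc] at hx hx'
  rcases h l hl l' hl' with rfl | h
  · exact hne rfl
  · exact h x hx hx'

theorem mx1 : ∀ b, ∀ p ∈ MX b, p.1 ≠ p.2 ∧ has (TT b) p.1 p.2 = true := by decide +kernel
theorem mx2 : ∀ b, ∀ p ∈ MX b, ∀ q ∈ MX b, (p.1 = q.1 ∧ p.2 = q.2) ∨ (p.1 ≠ q.1 ∧ p.1 ≠ q.2 ∧ p.2 ≠ q.1 ∧ p.2 ≠ q.2) := by decide +kernel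
theorem mx3 : ∀ b, ∀ v : Fin 60, ∃ p ∈ MX b, v = p.1 ∨ v = p.2 := by decide +kernel

theorem hx_ok : ∀ b, (∀ l ∈ HX b, l ∈ FC b ∧ l.length = 6) ∧
    (∀ l ∈ HX b, ∀ l' ∈ HX b, l = l' ∨ ∀ x ∈ l, x ∉ l') ∧ (fcs (HX b)).card = 8 ∧
    (∀ l ∈ HX b, (fc l ∩ mts (MX b)).card = 3) := by decide +kernel

theorem pp_ext (b : Bool) : IsExtremalFullerene (PP b) := by
  have m1 := mx1 b
  have m2 := mx2 b
  have m3 := mx3 b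
  obtain ⟨h1, h2, h3, h4⟩ := hx_ok b
  refine ⟨fcs (HX b), ⟨⟨?_, fcs_disj h2, mts (MX b), ⟨?_, mts_matching (fun p hp => (m1 p hp).1) m2, ?_⟩, ?_⟩, ?_⟩, ?_⟩
  · intro f hf
    obtain ⟨l, hl, rfl⟩ := mem_fcs.1 hf
    exact ⟨mem_fcs.2 ⟨l, (h1 l hl).1, rfl⟩, (fc_card (h1 l hl).1).trans (h1 l hl).2⟩
  · intro e he
    obtain ⟨p, hp, rfl⟩ := mem_mts.1 he
    exact (m1 p hp).2
  · intro v
    obtain ⟨p, hp, h⟩ := m3 v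
    exact ⟨_, mem_mts.2 ⟨p, hp, rfl⟩, Sym2.mem_iff.2 h⟩
  · intro f hf
    obtain ⟨l, hl, rfl⟩ := mem_fcs.1 hf
    exact h4 l hl
  · intro H' hH'
    have := clar_bound (pp_ful b) hH'
    rw [Fintype.card_fin] at this
    omega
  · rw [h3, Fintype.card_fin]

theorem sl_ok : ∀ b, ∀ l ∈ SL, l ∈ FC b := by decide +kernel
theorem bl_ok : BL.Nodup ∧ (ce BL).Nodup ∧ ∀ b, ck (fun x y : Fin 60 => has (TT b) x y) BL = true := by decide +kernel
theorem bl_eq : fc BL = ((fcs SL).sup id).filter fun e => ((fcs SL).filter fun f => e ∈ f).card = 1 := by decide +kernel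

/-- the fragment -/
def FB (b : Bool) : Fragment (PP b) where
  inFaces := fcs SL
  nonempty := ⟨fc [0, 1, 2, 3, 4], mem_fcs.2 ⟨_, by decide, rfl⟩⟩
  subFaces := by
    intro f hf
    obtain ⟨l, hl, rfl⟩ := mem_fcs.1 hf
    exact mem_fcs.2 ⟨l, sl_ok b l hl, rfl⟩
  boundary_cycle := by
    rw [← bl_eq]
    exact ck_cycle (gadj b) bl_ok.1 bl_ok.2.1 (bl_ok.2.2 b)

theorem sl5 : (∀ l ∈ SL, l.length = 5) ∧ (fcs SL).card = 6 := by decide +kernel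

theorem h11 : ∀ b, ∀ l ∈ H1L, l ∈ FC b := by decide +kernel
theorem h12 : ∀ l ∈ H1L, l.length = 6 ∧ ∃ e ∈ ce l, ∃ m ∈ SL, e ∈ ce m := by decide +kernel
theorem h13 : ∀ l ∈ H1L, ∀ l' ∈ H1L, l = l' ∨ ∀ x ∈ l, x ∉ l' := by decide +kernel
theorem h14 : ∀ p ∈ M1L, p.1 ≠ p.2 ∧ (∃ m ∈ SL, s(p.1, p.2) ∈ ce m) ∧ ∀ l ∈ H1L, p.1 ∉ l ∧ p.2 ∉ l := by decide +kernel
theorem h15 : ∀ p ∈ M1L, ∀ q ∈ M1L, (p.1 = q.1 ∧ p.2 = q.2) ∨ (p.1 ≠ q.1 ∧ p.1 ≠ q.2 ∧ p.2 ≠ q.1 ∧ p.2 ≠ q.2) := by decide +kernel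
theorem h16 : ∀ v : Fin 60, (∃ l ∈ SL, v ∈ l) → (∃ l ∈ H1L, v ∈ l) ∨ (∃ p ∈ M1L, v = p.1 ∨ v = p.2) := by decide +kernel

theorem pent_ok : ∀ b, ((FC b).countP fun l => l.length = 5 ∧ ∀ e ∈ ce l, ∃ m ∈ SL, e ∈ ce m) = 6 := by decide +kernel

theorem u_card : (Finset.univ.filter fun v : Fin 60 => (∃ l ∈ SL, v ∈ l) ∧ ¬ ∃ l ∈ H1L, v ∈ l).card = 6 := by decide +kernel

/-- hexagons covering the inner vertices -/
theorem hex1 : ∀ b, ∀ l ∈ FC b, l.length = 6 → 0 ∉ l ∧ 1 ∉ l := by decide +kernel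
theorem hex2 : ∀ b, ∀ l ∈ FC b, l.length = 6 → ((2 ∈ l ∨ 8 ∈ l) → 3 ∈ l) ∧ ((4 ∈ l ∨ 5 ∈ l) → 3 ∈ l) := by decide +kernel
theorem hex3 : ∀ b, ∀ l ∈ FC b, l.length = 6 → ((9 ∈ l ∨ 10 ∈ l) → 11 ∈ l) ∧ ((6 ∈ l ∨ 7 ∈ l) → 11 ∈ l) := by decide +kernel
theorem hex4 : ∀ b, ∀ l ∈ FC b, l.length = 6 → ¬ ((2 ∈ l ∨ 8 ∈ l) ∧ (4 ∈ l ∨ 5 ∈ l)) := by decide +kernel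
theorem hex5 : ∀ b, ∀ l ∈ FC b, l.length = 6 → ¬ ((9 ∈ l ∨ 10 ∈ l) ∧ (6 ∈ l ∨ 7 ∈ l)) := by decide +kernel
theorem hex_ok (b : Bool) (l) (hl : l ∈ FC b) (h6 : l.length = 6) : 0 ∉ l ∧ 1 ∉ l ∧
    ((2 ∈ l ∨ 8 ∈ l) → 3 ∈ l) ∧ ((4 ∈ l ∨ 5 ∈ l) → 3 ∈ l) ∧ ((9 ∈ l ∨ 10 ∈ l) → 11 ∈ l) ∧ ((6 ∈ l ∨ 7 ∈ l) → 11 ∈ l) ∧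
    ¬ ((2 ∈ l ∨ 8 ∈ l) ∧ (4 ∈ l ∨ 5 ∈ l)) ∧ ¬ ((9 ∈ l ∨ 10 ∈ l) ∧ (6 ∈ l ∨ 7 ∈ l)) :=
  ⟨(hex1 b l hl h6).1, (hex1 b l hl h6).2, (hex2 b l hl h6).1, (hex2 b l hl h6).2, (hex3 b l hl h6).1,
    (hex3 b l hl h6).2, hex4 b l hl h6, hex5 b l hl h6⟩

theorem mem_E {b : Bool} {e} : e ∈ (FB b).edges ↔ ∃ m ∈ SL, e ∈ ce m := by
  change e ∈ (fcs SL).sup id ↔ _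
  simp only [Finset.mem_sup, id, mem_fcs]
  constructor
  · rintro ⟨f, ⟨l, hl, rfl⟩, he⟩; exact ⟨l, hl, mem_fc.1 he⟩
  · rintro ⟨l, hl, he⟩; exact ⟨_, ⟨l, hl, rfl⟩, mem_fc.2 he⟩

theorem verts_E {b : Bool} {v} : v ∈ edgeVerts (FB b).edges ↔ ∃ l ∈ SL, v ∈ l := verts_fcs SL v

theorem u_min (b : Bool) (H : Finset (Finset (Sym2 (Fin 60)))) (hH : SextetAdm (PP b) (FB b).edges H) :
    6 ≤ (Uset (FB b).edges H).card := by
  obtain ⟨h1, h2, -⟩ := hH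
  have hc : ∀ v, v ∈ facesVerts H → ∃ l ∈ FC b, l.length = 6 ∧ v ∈ l ∧ fc l ∈ H := by
    intro v hv
    obtain ⟨f, hf, hvf⟩ := mem_facesVerts.1 hv
    obtain ⟨q1, q2, -⟩ := h1 f hf
    obtain ⟨l, hl, rfl⟩ := mem_fcs.1 q1
    exact ⟨l, hl, (fc_card hl).symm.trans q2, (verts_fc l v).1 hvf, hf⟩
  have hU : ∀ v : Fin 60, v < 18 → v ∉ facesVerts H → v ∈ Uset (FB b).edges H := by
    intro v hv hn
    have : ∀ v : Fin 60, v < 18 → ∃ l ∈ SL, v ∈ l := by decide +kernel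
    exact Finset.mem_sdiff.2 ⟨verts_E.2 (this v hv), hn⟩
  -- two hexagons of `H` through a common vertex agree
  have hun : ∀ l l' : List (Fin 60), fc l ∈ H → fc l' ∈ H → ∀ x, x ∈ l → x ∈ l' → ∀ y, y ∈ l ↔ y ∈ l' := by
    intro l l' hl hl' x hx hx' y
    have : fc l = fc l' := by
      by_contra hne
      exact Finset.disjoint_left.1 (h2 _ hl _ hl' hne) ((verts_fc _ _).2 hx) ((verts_fc _ _).2 hx')
    rw [← verts_fc, this, verts_fc]
  have n0 : 0 ∉ facesVerts H := fun h => by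
    obtain ⟨l, hl, h6, hv, -⟩ := hc _ h
    exact (hex_ok b l hl h6).1 hv
  have n1 : 1 ∉ facesVerts H := fun h => by
    obtain ⟨l, hl, h6, hv, -⟩ := hc _ h
    exact (hex_ok b l hl h6).2.1 hv
  have p1 : (2 ∉ facesVerts H ∧ 8 ∉ facesVerts H) ∨ (4 ∉ facesVerts H ∧ 5 ∉ facesVerts H) := by
    by_contra hcon
    have hA : ∃ v, (v = 2 ∨ v = 8) ∧ v ∈ facesVerts H := by grind
    have hB : ∃ v, (v = 4 ∨ v = 5) ∧ v ∈ facesVerts H := by grind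
    obtain ⟨v, hv, hvH⟩ := hA
    obtain ⟨w, hw, hwH⟩ := hB
    obtain ⟨l, hl, h6, hvl, hlH⟩ := hc _ hvH
    obtain ⟨l', hl', h6', hwl, hlH'⟩ := hc _ hwH
    have o1 := hex_ok b l hl h6
    have o2 := hex_ok b l' hl' h6'
    have e1 : 2 ∈ l ∨ 8 ∈ l := by rcases hv with rfl | rfl <;> simp [hvl]
    have e2 : 4 ∈ l' ∨ 5 ∈ l' := by rcases hw with rfl | rfl <;> simp [hwl]
    have := hun l l' hlH hlH' 3 (o1.2.2.1 e1) (o2.2.2.2.1 e2)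
    rw [← this, ← this] at e2
    exact o1.2.2.2.2.2.2.1 ⟨e1, e2⟩
  have p2 : (9 ∉ facesVerts H ∧ 10 ∉ facesVerts H) ∨ (6 ∉ facesVerts H ∧ 7 ∉ facesVerts H) := by
    by_contra hcon
    have hA : ∃ v, (v = 9 ∨ v = 10) ∧ v ∈ facesVerts H := by grind
    have hB : ∃ v, (v = 6 ∨ v = 7) ∧ v ∈ facesVerts H := by grind
    obtain ⟨v, hv, hvH⟩ := hA
    obtain ⟨w, hw, hwH⟩ := hB
    obtain ⟨l, hl, h6, hvl, hlH⟩ := hc _ hvH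
    obtain ⟨l', hl', h6', hwl, hlH'⟩ := hc _ hwH
    have o1 := hex_ok b l hl h6
    have o2 := hex_ok b l' hl' h6'
    have e1 : 9 ∈ l ∨ 10 ∈ l := by rcases hv with rfl | rfl <;> simp [hvl]
    have e2 : 6 ∈ l' ∨ 7 ∈ l' := by rcases hw with rfl | rfl <;> simp [hwl]
    have := hun l l' hlH hlH' 11 (o1.2.2.2.2.1 e1) (o2.2.2.2.2.2.1 e2)
    rw [← this, ← this] at e2
    exact o1.2.2.2.2.2.2.2 ⟨e1, e2⟩
  have sub : ∀ T : Finset (Fin 60), T.card = 6 → (∀ v ∈ T, v < 18 ∧ v ∉ facesVerts H) →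
      6 ≤ (Uset (FB b).edges H).card := fun T hT h =>
    hT ▸ Finset.card_le_card fun v hv => hU v (h v hv).1 (h v hv).2
  rcases p1 with ⟨a1, a2⟩ | ⟨a1, a2⟩ <;> rcases p2 with ⟨a3, a4⟩ | ⟨a3, a4⟩
  · exact sub {0, 1, 2, 8, 9, 10} (by decide) (by simp [n0, n1, a1, a2, a3, a4])
  · exact sub {0, 1, 2, 8, 6, 7} (by decide) (by simp [n0, n1, a1, a2, a3, a4])
  · exact sub {0, 1, 4, 5, 9, 10} (by decide) (by simp [n0, n1, a1, a2, a3, a4])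
  · exact sub {0, 1, 4, 5, 6, 7} (by decide) (by simp [n0, n1, a1, a2, a3, a4])

theorem pp_b3 (b : Bool) : IsB3Frag (FB b) := by
  have q1 := h11
  have q2 := h12
  have q3 := h13
  have q4 := h14
  have q5 := h15
  have q6 := h16
  have hmat : IsMatching (mts M1L) := mts_matching (fun p hp => (q4 p hp).1) q5
  have hsub : mts M1L ⊆ (FB b).edges := by
    intro e he
    obtain ⟨p, hp, rfl⟩ := mem_mts.1 he
    exact mem_E.2 (q4 p hp).2.1
  have hav : ∀ e ∈ mts M1L, ∀ v : Fin 60, v ∈ e → v ∉ facesVerts (fcs H1L) := by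
    intro e he v hv hvH
    obtain ⟨p, hp, rfl⟩ := mem_mts.1 he
    obtain ⟨l, hl, hvl⟩ := (verts_fcs _ _).1 hvH
    have := (q4 p hp).2.2 l hl
    rcases Sym2.mem_iff.1 hv with rfl | rfl
    · exact this.1 hvl
    · exact this.2 hvl
  have hcov : ∀ v ∈ Uset (FB b).edges (fcs H1L), ∃ e ∈ mts M1L, v ∈ e := by
    intro v hv
    obtain ⟨h1, h2⟩ := Finset.mem_sdiff.1 hv
    rw [verts_fcs] at h2
    rcases q6 v (verts_E.1 h1) with h | ⟨p, hp, h⟩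
    · exact absurd h h2
    · exact ⟨_, mem_mts.2 ⟨p, hp, rfl⟩, Sym2.mem_iff.2 h⟩
  have hadm : SextetAdm (PP b) (FB b).edges (fcs H1L) := by
    refine ⟨?_, fcs_disj q3, mts M1L, hsub, hmat, hav, fun v hv _ hn => hcov v (Finset.mem_sdiff.2 ⟨hv, hn⟩)⟩
    intro f hf
    obtain ⟨l, hl, rfl⟩ := mem_fcs.1 hf
    obtain ⟨h6, e, he, hm⟩ := q2 l hl
    exact ⟨mem_fcs.2 ⟨l, q1 b l hl, rfl⟩, (fc_card (q1 b l hl)).trans h6,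
      ⟨e, Finset.mem_inter.2 ⟨mem_fc.2 he, mem_E.2 hm⟩⟩⟩
  have hcard : (Uset (FB b).edges (fcs H1L)).card = 6 := by
    have hs : Uset (FB b).edges (fcs H1L) = Finset.univ.filter fun v : Fin 60 => (∃ l ∈ SL, v ∈ l) ∧ ¬ ∃ l ∈ H1L, v ∈ l := by
      ext v
      rw [Uset, Finset.mem_sdiff, verts_E, verts_fcs, Finset.mem_filter]
      exact ⟨fun h => ⟨Finset.mem_univ _, h⟩, fun h => h.2⟩
    rw [hs]
    exact u_card
  have hclar : IsClarSet (PP b) (FB b).edges (fcs H1L) := ⟨hadm, fun H' hH' => hcard.le.trans (u_min b H' hH')⟩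
  refine ⟨?_, sl5.2, ⟨fcs H1L, hclar, ?_⟩, fcs H1L, hclar, mts M1L, hsub, hmat, hav, hcov⟩
  · intro f hf
    obtain ⟨l, hl, rfl⟩ := mem_fcs.1 hf
    exact (fc_card (sl_ok b l hl)).trans (sl5.1 l hl)
  · refine hcard.trans (Eq.symm ((fcs_filter b _).trans ((List.countP_congr ?_).trans (pent_ok b))))
    intro l hl
    simp only [decide_eq_true_eq, fc_card hl, Finset.subset_iff, mem_fc, mem_E]
end PartD4

set_option linter.all false

/-! ### The two graphs are not isomorphic: balls of radius five -/

/-- balls in a graph -/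
def ballS {W : Type} (G : SimpleGraph W) : ℕ → W → Set W
  | 0, v => {v}
  | n + 1, v => {x | x ∈ ballS G n v ∨ ∃ y ∈ ballS G n v, G.Adj y x}

theorem ballS_iso {W W' : Type} {G : SimpleGraph W} {G' : SimpleGraph W'} (e : G ≃g G') :
    ∀ (n : ℕ) (v x : W), x ∈ ballS G n v ↔ e x ∈ ballS G' n (e v)
  | 0, v, x => by simp [ballS]
  | n + 1, v, x => by
    simp only [ballS, Set.mem_setOf_eq]
    refine or_congr (ballS_iso e n v x) ⟨?_, ?_⟩
    · rintro ⟨y, hy, h⟩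
      exact ⟨e y, (ballS_iso e n v y).1 hy, e.map_rel_iff.2 h⟩
    · rintro ⟨y, hy, h⟩
      obtain ⟨z, rfl⟩ := e.surjective y
      exact ⟨z, (ballS_iso e n v z).2 hy, e.map_rel_iff.1 h⟩

theorem ballS_card {W W' : Type} {G : SimpleGraph W} {G' : SimpleGraph W'} (e : G ≃g G') (n : ℕ) (v : W) :
    (ballS G n v).ncard = (ballS G' n (e v)).ncard := by
  have : ballS G' n (e v) = e '' ballS G n v := by
    ext x
    obtain ⟨z, rfl⟩ := e.surjective x
    rw [← ballS_iso, e.injective.mem_set_image]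
  rw [this, Set.ncard_image_of_injective _ e.injective]

/-- union of the adjacency masks of the vertices of a mask -/
def spread (m : ℕ) : List ℕ → ℕ → ℕ → ℕ
  | [], _, acc => acc
  | k :: t, i, acc => spread m t (Nat.succ i) (bif Nat.testBit m i then Nat.lor acc k else acc)

theorem spread_ok (m x : ℕ) : ∀ (t : List ℕ) (i acc : ℕ), Nat.testBit (spread m t i acc) x = true ↔
    Nat.testBit acc x = true ∨ ∃ n, Nat.testBit m (i + n) = true ∧ Nat.testBit (t.getD n 0) x = true
  | [], i, acc => by simp [spread]
  | k :: t, i, acc => by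
    rw [spread, spread_ok m x t (Nat.succ i)]
    have e : (∃ n, Nat.testBit m (i + n) = true ∧ Nat.testBit ((k :: t).getD n 0) x = true) ↔
        (Nat.testBit m i = true ∧ Nat.testBit k x = true) ∨
          ∃ n, Nat.testBit m (Nat.succ i + n) = true ∧ Nat.testBit (t.getD n 0) x = true := by
      constructor
      · rintro ⟨n, h1, h2⟩
        cases n with
        | zero => exact Or.inl ⟨h1, h2⟩
        | succ n =>
          refine Or.inr ⟨n, ?_, h2⟩
          rw [show Nat.succ i + n = i + (n + 1) by omega]; exact h1
      · rintro (⟨h1, h2⟩ | ⟨n, h1, h2⟩)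
        · exact ⟨0, h1, h2⟩
        · refine ⟨n + 1, ?_, h2⟩
          rw [show i + (n + 1) = Nat.succ i + n by omega]; exact h1
    rw [e]
    cases h : Nat.testBit m i with
    | false => simp
    | true =>
      have : Nat.testBit (Nat.lor acc k) x = (Nat.testBit acc x || Nat.testBit k x) := Nat.testBit_or acc k x
      simp only [cond_true, this, Bool.or_eq_true, true_and, or_assoc]

def mball (A : List ℕ) (v : ℕ) : ℕ → ℕ
  | 0 => Nat.shiftLeft 1 v
  | n + 1 => (fun m => spread m A 0 m) (mball A v n)

theorem al_len : ∀ b, (AL b).length = 60 := by decide +kernel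

theorem mball_ok (b : Bool) (v : Fin 60) : ∀ (n : ℕ) (x : Fin 60),
    Nat.testBit (mball (AL b) v n) x = true ↔ x ∈ ballS (GG b) n v
  | 0, x => by
    rw [mball, tb_bit, ballS, Set.mem_singleton_iff, decide_eq_true_eq, Fin.val_inj]
    exact eq_comm
  | n + 1, x => by
    rw [mball, spread_ok, mball_ok b v n x]
    refine or_congr Iff.rfl ⟨?_, ?_⟩
    · rintro ⟨y, h1, h2⟩
      rw [Nat.zero_add] at h1
      have hy : y < 60 := by
        by_contra hc
        rw [List.getD_eq_default _ _ (by rw [al_len]; omega), Nat.zero_testBit] at h2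
        exact absurd h2 (by decide)
      exact ⟨⟨y, hy⟩, (mball_ok b v n ⟨y, hy⟩).1 h1, (al_ok b ⟨y, hy⟩ x).symm.trans h2⟩
    · rintro ⟨y, h1, h2⟩
      refine ⟨y, ?_, (al_ok b y x).trans h2⟩
      rw [Nat.zero_add]
      exact (mball_ok b v n y).2 h1

def bits (m : ℕ) : ℕ := (Finset.univ.filter fun x : Fin 60 => Nat.testBit m x = true).card

theorem ball_bits (b : Bool) (n : ℕ) (v : Fin 60) : (ballS (GG b) n v).ncard = bits (mball (AL b) v n) := by
  rw [bits, ← Set.ncard_coe_finset]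
  congr 1
  ext x
  simp only [Finset.coe_filter, Finset.mem_univ, true_and, Set.mem_setOf_eq]
  exact (mball_ok b v n x).symm

theorem bits_true : bits (mball (AL true) 23 5) = 45 := by decide +kernel
theorem bits_false : ∀ v : Fin 60, bits (mball (AL false) v 5) ≠ 45 := by decide +kernel

theorem non_iso : ¬ Nonempty ((GG true) ≃g (GG false)) := by
  rintro ⟨e⟩
  have h := ballS_card e 5 23
  rw [ball_bits, ball_bits] at h
  exact bits_false (e 23) (h.symm.trans bits_true)

/-! ### Embeddings of cubic graphs of the same order are isomorphisms -/

theorem iso_of_emb {G : SimpleGraph (Fin 60)} (b : Bool) (hG : ∀ v, (G.neighborSet v).ncard = 3) (f : Fin 60 → ℕ)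
    (h1 : ∀ a, f a < 60) (h2 : Function.Injective f) (h3 : ∀ a c, G.Adj a c → has (TT b) (f a) (f c) = true) :
    Nonempty (G ≃g GG b) := by
  let g : Fin 60 → Fin 60 := fun a => ⟨f a, h1 a⟩
  have hg : Function.Injective g := fun a c h => h2 (Fin.mk.inj_iff.1 h)
  have hb : Function.Bijective g := Finite.injective_iff_bijective.1 hg
  have himg : ∀ a, g '' G.neighborSet a = (GG b).neighborSet (g a) := by
    intro a
    apply Set.eq_of_subset_of_ncard_le
    · rintro _ ⟨c, hc, rfl⟩
      exact h3 a c hc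
    · rw [g_cubic, Set.ncard_image_of_injective _ hg, hG]
    · exact Set.toFinite _
  refine ⟨⟨Equiv.ofBijective g hb, ?_⟩⟩
  intro a c
  constructor
  · intro h
    have : g c ∈ (GG b).neighborSet (g a) := h
    rw [← himg a, hg.mem_set_image] at this
    exact this
  · intro h
    exact h3 a c h

theorem statement_17 :
    ∃ P₁ P₂ : PlaneGraph (Fin 60),
      (IsFullerene P₁ ∧ IsExtremalFullerene P₁ ∧ ∃ B : Fragment P₁, IsB3Frag B) ∧
      (IsFullerene P₂ ∧ IsExtremalFullerene P₂ ∧ ∃ B : Fragment P₂, IsB3Frag B) ∧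
      ¬Nonempty (P₁.graph ≃g P₂.graph) ∧
      ∀ Q : PlaneGraph (Fin 60), IsFullerene Q → IsExtremalFullerene Q →
        (∃ B : Fragment Q, IsB3Frag B) →
        (Nonempty (Q.graph ≃g P₁.graph) ∨ Nonempty (Q.graph ≃g P₂.graph)) := by
  refine ⟨PP true, PP false, ⟨pp_ful _, pp_ext _, FB _, pp_b3 _⟩, ⟨pp_ful _, pp_ext _, FB _, pp_b3 _⟩, non_iso, ?_⟩
  rintro Q hF hX ⟨B, hB⟩
  obtain ⟨b, f, h1, h2, h3⟩ := b3_res (Fintype.card_fin 60) runAll_ok hF hX B hB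
  have h := iso_of_emb b hF.cubic f h1 h2 h3
  cases b with
  | true => exact Or.inl h
  | false => exact Or.inr h

end FG
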